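/- Trace of a weighted Sobolev space (direct estimate): Let n, d ∈ ℕ, p ∈ (1,∞), r ∈ [1,p), l ∈ ℕ with l > d/r, and let γ be a weight on ℝ^{n+d} with γ^p ∈ A^{loc}_{p/r}(ℝ^{n+d}). Define γ̂_{k,m} := ‖γ‖_{L_p(Ξ^{d,n}_{k,m})} and γ_k(x) := 2^{k(l + n/p)}·Σ_{m∈ℤⁿ} χ_{Q̃^n_{k,m}}(x)·γ̂_{k,m}. Then for every f ∈ W^l_p(ℝ^{n+d},γ) the trace φ := tr|_{y=0} f exists, belongs to B̃^l_{p,p,r}(ℝⁿ,{γ_k}), and ‖φ | B̃^l_{p,p,r}(ℝⁿ,{γ_k})‖ ≤ C·‖f | W^l_p(ℝ^{n+d},γ)‖ with C independent of f. -/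

import Mathlib

open MeasureTheory ENNReal Filter
open scoped Classical

noncomputable section

/-- `ℓ_q` quasinorm of a family of extended nonnegative reals (supremum when `q = ∞`). -/
def lqNorm {ι : Type*} (q : ℝ≥0∞) (c : ι → ℝ≥0∞) : ℝ≥0∞ :=
  if q = ∞ then ⨆ i, c i else (∑' i, c i ^ q.toReal) ^ (1 / q.toReal)

/-- `L_p` quasinorm of an `ℝ≥0∞`-valued function (essential supremum when `p = ∞`). -/
def lpNormE {α : Type*} [MeasurableSpace α] (p : ℝ≥0∞) (μ : Measure α) (f : α → ℝ≥0∞) : ℝ≥0∞ :=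
  if p = ∞ then essSup f μ else (∫⁻ x, f x ^ p.toReal ∂μ) ^ (1 / p.toReal)

abbrev Rn (n : ℕ) := Fin n → ℝ

/-- Open cube centred at `x` of half-side `s` (i.e. `x + s·Iⁿ`). -/
def openCube {n : ℕ} (x : Rn n) (s : ℝ) : Set (Rn n) := {y | ∀ i, |y i - x i| < s}

/-- Open axis-parallel cube with lower corner `c` and side `s`. -/
def cubeAt {n : ℕ} (c : Rn n) (s : ℝ) : Set (Rn n) := {x | ∀ i, c i < x i ∧ x i < c i + s}

/-- Open dyadic cube `Q^n_{k,m}` of side `2^{-k}`. -/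
def dyadicCube (n k : ℕ) (m : Fin n → ℤ) : Set (Rn n) :=
  {x | ∀ i, (m i : ℝ) / 2 ^ k < x i ∧ x i < ((m i : ℝ) + 1) / 2 ^ k}

/-- Half-open dyadic cube `Q̃^n_{k,m}`. -/
def dyadicCubeHalf (n k : ℕ) (m : Fin n → ℤ) : Set (Rn n) :=
  {x | ∀ i, (m i : ℝ) / 2 ^ k ≤ x i ∧ x i < ((m i : ℝ) + 1) / 2 ^ k}

def dyadicCenter (n k : ℕ) (m : Fin n → ℤ) : Rn n := fun i => ((m i : ℝ) + 1 / 2) / 2 ^ k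

/-- The concentric dilate `c·Q^n_{k,m}` of a dyadic cube. -/
def dilatedCube (n k : ℕ) (m : Fin n → ℤ) (c : ℝ) : Set (Rn n) :=
  openCube (dyadicCenter n k m) (c / 2 ^ (k + 1))

def euclNorm {d : ℕ} (y : Rn d) : ℝ := Real.sqrt (∑ i, y i ^ 2)

/-- The difference `Δ^l(h)g(x)`. -/
def diffl {n : ℕ} (l : ℕ) (h : Rn n) (g : Rn n → ℝ) (x : Rn n) : ℝ :=
  ∑ j ∈ Finset.range (l + 1), ((l.choose j : ℝ) * (-1 : ℝ) ^ (l + j)) * g (x + (j : ℝ) • h)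

/-- The difference `Δ^l(h,Ω)g(x)`, vanishing unless the segment `[x, x + l·h]` lies in `Ω`. -/
def difflOn {n : ℕ} (l : ℕ) (Ω : Set (Rn n)) (h : Rn n) (g : Rn n → ℝ) (x : Rn n) : ℝ :=
  if ∀ τ ∈ Set.Icc (0 : ℝ) 1, x + (τ * l) • h ∈ Ω then diffl l h g x else 0

/-- `δ^l_r(Q)g`, where `s` is the side length of the cube `Q`. -/
def deltaE (n l : ℕ) (r : ℝ≥0∞) (s : ℝ) (Q : Set (Rn n)) (g : Rn n → ℝ) : ℝ≥0∞ :=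
  ENNReal.ofReal s ^ (-(2 * (n : ℝ)) / r.toReal) *
    eLpNorm (fun hx : Rn n × Rn n => diffl l hx.1 g hx.2) r
      ((volume.restrict (openCube (0 : Rn n) s)).prod (volume.restrict Q))

/-- `δ^l_r(Q,Ω)g`, where `s` is the side length of the cube `Q`. -/
def deltaEOn (n l : ℕ) (r : ℝ≥0∞) (s : ℝ) (Q Ω : Set (Rn n)) (g : Rn n → ℝ) : ℝ≥0∞ :=
  ENNReal.ofReal s ^ (-(2 * (n : ℝ)) / r.toReal) *
    eLpNorm (fun hx : Rn n × Rn n => difflOn l Ω hx.1 g hx.2) r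
      ((volume.restrict (openCube (0 : Rn n) s)).prod (volume.restrict Q))

/-- `Δ̄^l_r(s)g(x)`. -/
def barDelta (n l : ℕ) (r : ℝ≥0∞) (s : ℝ) (g : Rn n → ℝ) (x : Rn n) : ℝ≥0∞ :=
  ENNReal.ofReal s ^ (-(n : ℝ) / r.toReal) *
    eLpNorm (fun h : Rn n => diffl l h g x) r (volume.restrict (openCube (0 : Rn n) s))

/-- Membership in `L_r^{loc}(ℝⁿ)`. -/
def MemLrLoc (n : ℕ) (r : ℝ≥0∞) (φ : Rn n → ℝ) : Prop :=
  Measurable φ ∧ ∀ K : Set (Rn n), IsCompact K → eLpNorm φ r (volume.restrict K) < ∞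

def IsWeight {n : ℕ} (w : Rn n → ℝ) : Prop := Measurable w ∧ ∀ x, 0 < w x

/-- A `p`-admissible weight sequence. -/
def pAdmissible (n : ℕ) (p : ℝ≥0∞) (t : ℕ → Rn n → ℝ) : Prop :=
  ∀ k, IsWeight (t k) ∧ MemLrLoc n p (t k)

/-- The multiple sequence `t_{k,m} = ‖t_k‖_{L_p(Q^n_{k,m})}` associated with a weight sequence. -/
def tkm (n : ℕ) (p : ℝ≥0∞) (t : ℕ → Rn n → ℝ) (k : ℕ) (m : Fin n → ℤ) : ℝ≥0∞ :=
  eLpNorm (t k) p (volume.restrict (dyadicCube n k m))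

/-- The weight `t̄_k` built from a multiple sequence `T`. -/
def tbarOf (n : ℕ) (p : ℝ≥0∞) (T : ℕ → (Fin n → ℤ) → ℝ≥0∞) (k : ℕ) (x : Rn n) : ℝ≥0∞ :=
  (2 : ℝ≥0∞) ^ (((k * n : ℕ) : ℝ) / p.toReal) *
    ∑' m : Fin n → ℤ, (dyadicCubeHalf n k m).indicator (fun _ => T k m) x

/-- `(2^{kn} ∫_Q f^e)^{1/e}`, with the essential supremum modification for `e = ∞`. -/
def avgNorm (n k : ℕ) (e : ℝ≥0∞) (Q : Set (Rn n)) (f : Rn n → ℝ≥0∞) : ℝ≥0∞ :=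
  if e = ∞ then essSup f (volume.restrict Q)
  else ((2 : ℝ≥0∞) ^ (k * n) * ∫⁻ x in Q, f x ^ e.toReal) ^ (1 / e.toReal)

/-- Conditions (2.14)–(2.16) of the class `X^{α₃}_{α,σ,p}`, expressed for a multiple
sequence `T`. -/
def MemXseq (n : ℕ) (α₁ α₂ α₃ : ℝ) (σ₁ σ₂ p : ℝ≥0∞) (T : ℕ → (Fin n → ℤ) → ℝ≥0∞) : Prop :=
  (∃ C₁ : ℝ≥0∞, 0 < C₁ ∧ C₁ < ∞ ∧ ∀ k j : ℕ, k ≤ j → ∀ m : Fin n → ℤ,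
    avgNorm n k p (dyadicCube n k m) (tbarOf n p T k) *
      avgNorm n k σ₁ (dyadicCube n k m) (fun x => (tbarOf n p T j x)⁻¹) ≤
      C₁ * (2 : ℝ≥0∞) ^ (α₁ * ((k : ℝ) - (j : ℝ)))) ∧
  (∃ C₂ : ℝ≥0∞, 0 < C₂ ∧ C₂ < ∞ ∧ ∀ k j : ℕ, k ≤ j → ∀ m : Fin n → ℤ,
    (avgNorm n k p (dyadicCube n k m) (tbarOf n p T k))⁻¹ *
      avgNorm n k σ₂ (dyadicCube n k m) (tbarOf n p T j) ≤
      C₂ * (2 : ℝ≥0∞) ^ (α₂ * ((j : ℝ) - (k : ℝ)))) ∧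
  (∀ k : ℕ, ∀ m m' : Fin n → ℤ, (∀ i, |m i - m' i| ≤ 1) →
    0 < T k m ∧ T k m ≤ (2 : ℝ≥0∞) ^ (α₃ : ℝ) * T k m')

/-- The weighted class `X^{α₃}_{α,σ,p}` of weight sequences. -/
def MemX (n : ℕ) (α₁ α₂ α₃ : ℝ) (σ₁ σ₂ p : ℝ≥0∞) (t : ℕ → Rn n → ℝ) : Prop :=
  pAdmissible n p t ∧ MemXseq n α₁ α₂ α₃ σ₁ σ₂ p (tkm n p t)

/-- Quasinorm of `B̃^l_{p,q,r}(ℝⁿ, T)` with an `ℝ≥0∞`-valued weight sequence `T`. -/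
def tildeBnormE (n l : ℕ) (p q r : ℝ≥0∞) (T : ℕ → Rn n → ℝ≥0∞) (φ : Rn n → ℝ) : ℝ≥0∞ :=
  lqNorm q (fun k : ℕ =>
    lpNormE p volume (fun x =>
      T (k + 1) x *
        deltaE n l r ((2 : ℝ) ^ (1 - ((k : ℤ) + 1))) (openCube x ((2 : ℝ) ^ (-((k : ℤ) + 1)))) φ)) +
  lpNormE p volume (fun x => T 0 x * eLpNorm φ r (volume.restrict (openCube x 1)))

/-- Quasinorm of `B̃^l_{p,q,r}(ℝⁿ, {t_k})`. -/
def tildeBnorm (n l : ℕ) (p q r : ℝ≥0∞) (t : ℕ → Rn n → ℝ) (φ : Rn n → ℝ) : ℝ≥0∞ :=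
  tildeBnormE n l p q r (fun k x => ENNReal.ofReal (t k x)) φ

/-- Membership in `B̃^l_{p,q,r}(ℝⁿ, {t_k})`. -/
def MemTildeB (n l : ℕ) (p q r : ℝ≥0∞) (t : ℕ → Rn n → ℝ) (φ : Rn n → ℝ) : Prop :=
  MemLrLoc n r φ ∧ tildeBnorm n l p q r t φ < ∞

/-- Quasinorm of `B̄^l_{p,q,r}(ℝⁿ, {t_k})`. -/
def barBnorm (n l : ℕ) (p q r : ℝ≥0∞) (t : ℕ → Rn n → ℝ) (φ : Rn n → ℝ) : ℝ≥0∞ :=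
  lqNorm q (fun k : ℕ =>
    lpNormE p volume (fun x =>
      ENNReal.ofReal (t (k + 1) x) * barDelta n l r ((2 : ℝ) ^ (-((k : ℤ) + 1))) φ x)) +
  lpNormE p volume (fun x => ENNReal.ofReal (t 0 x) * eLpNorm φ r (volume.restrict (openCube x 1)))

/-- Membership in `B̄^l_{p,q,r}(ℝⁿ, {t_k})`. -/
def MemBarB (n l : ℕ) (p q r : ℝ≥0∞) (t : ℕ → Rn n → ℝ) (φ : Rn n → ℝ) : Prop :=
  MemLrLoc n r φ ∧ barBnorm n l p q r t φ < ∞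

/-- The class `A^{loc}_∞`. -/
def MemAlocInfty (n : ℕ) (w : Rn n → ℝ) : Prop :=
  ∃ α : ℝ, α ∈ Set.Ioo (0 : ℝ) 1 ∧ ∃ M : ℝ≥0∞, M < ∞ ∧
    ∀ (c : Rn n) (s : ℝ), 0 < s → s ≤ 1 →
      ∀ F : Set (Rn n), F ⊆ cubeAt c s → MeasurableSet F →
        ENNReal.ofReal α * volume (cubeAt c s) ≤ volume F →
        (∫⁻ x in cubeAt c s, ENNReal.ofReal (w x)) ≤ M * ∫⁻ x in F, ENNReal.ofReal (w x)

/-- The class `A^{loc}_1`. -/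
def MemAloc1 (n : ℕ) (w : Rn n → ℝ) : Prop :=
  ∃ C : ℝ≥0∞, C < ∞ ∧ ∀ (c : Rn n) (s : ℝ), 0 < s → s ≤ 1 →
    ∀ᵐ x ∂volume.restrict (cubeAt c s),
      (∫⁻ y in cubeAt c s, ENNReal.ofReal (w y)) ≤ C * volume (cubeAt c s) * ENNReal.ofReal (w x)

/-- The class `A^{loc}_{p₀}` for `p₀ > 1`. -/
def MemAlocGt (n : ℕ) (p₀ : ℝ) (w : Rn n → ℝ) : Prop :=
  ∃ C : ℝ≥0∞, C < ∞ ∧ ∀ (c : Rn n) (s : ℝ), 0 < s → s ≤ 1 →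
    ((volume (cubeAt c s))⁻¹ * ∫⁻ y in cubeAt c s, ENNReal.ofReal (w y)) *
      ((volume (cubeAt c s))⁻¹ *
        ∫⁻ y in cubeAt c s, ENNReal.ofReal (w y) ^ (-(1 : ℝ) / (p₀ - 1))) ^ (p₀ - 1) ≤ C

/-- The class `A^{loc}_{p₀}` for `p₀ ∈ [1,∞)`. -/
def MemAlocP (n : ℕ) (p₀ : ℝ) (w : Rn n → ℝ) : Prop :=
  if p₀ = 1 then MemAloc1 n w else MemAlocGt n p₀ w

/-- The class `{}^{loc}Y^{α₃}_{α₁,α₂}` of weight sequences of variable smoothness. -/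
def MemLocY (n : ℕ) (α₁ α₂ α₃ : ℝ) (s : ℕ → Rn n → ℝ) : Prop :=
  (∀ k, IsWeight (s k)) ∧
  (∃ C : ℝ, 0 < C ∧ ∀ j k : ℕ, j ≤ k → ∀ x : Rn n,
    C⁻¹ * (2 : ℝ) ^ (α₁ * ((k : ℝ) - (j : ℝ))) ≤ s k x / s j x ∧
      s k x / s j x ≤ C * (2 : ℝ) ^ (α₂ * ((k : ℝ) - (j : ℝ)))) ∧
  (∀ k : ℕ, ∀ x y : Rn n, euclNorm (x - y) ≤ (2 : ℝ) ^ (-(k : ℤ)) →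
    s k x ≤ (2 : ℝ) ^ α₃ * s k y)

/-- The set `Ξ^{d,n}_{k,m} = Q^n_{k,m} × (2^{-k}B^d ∖ 2^{-k-1}B^d) ⊂ ℝ^{n+d}`. -/
def Xi (n d k : ℕ) (m : Fin n → ℤ) : Set (Rn (n + d)) :=
  {z | (fun i => z (Fin.castAdd d i)) ∈ dyadicCube n k m ∧
       euclNorm (fun i : Fin d => z (Fin.natAdd n i)) < (2 : ℝ) ^ (-(k : ℤ)) ∧
       (2 : ℝ) ^ (-(k : ℤ) - 1) ≤ euclNorm (fun i : Fin d => z (Fin.natAdd n i))}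

/-- The multiple sequence `γ̂_{k,m} = ‖γ‖_{L_p(Ξ^{d,n}_{k,m})}` generated by a weight `γ`. -/
def gammaHat (n d : ℕ) (p : ℝ≥0∞) (γ : Rn (n + d) → ℝ) (k : ℕ) (m : Fin n → ℤ) : ℝ≥0∞ :=
  eLpNorm γ p (volume.restrict (Xi n d k m))

def delta1Good (n d : ℕ) (p : ℝ≥0∞) (γ : Rn (n + d) → ℝ) (δ : ℝ) : Prop :=
  ∃ C : ℝ≥0∞, C < ∞ ∧ ∀ k j : ℕ, k ≤ j → ∀ m : Fin n → ℤ,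
    (∑' m' : {m' : Fin n → ℤ // dyadicCube n j m' ⊆ dyadicCube n k m},
        gammaHat n d p γ j m'.1 ^ p.toReal) ≤
      C * (2 : ℝ≥0∞) ^ ((((k : ℝ) - (j : ℝ)) * (d : ℝ)) * δ) * gammaHat n d p γ k m ^ p.toReal

/-- `δ₁(γ,n,d)`. -/
def delta1 (n d : ℕ) (p : ℝ≥0∞) (γ : Rn (n + d) → ℝ) : ℝ :=
  sSup {δ : ℝ | 0 < δ ∧ delta1Good n d p γ δ}

def delta2Good (n d : ℕ) (p : ℝ≥0∞) (γ : Rn (n + d) → ℝ) (δ : ℝ) : Prop :=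
  ∃ C : ℝ≥0∞, C < ∞ ∧ ∀ k j : ℕ, k ≤ j → ∀ m : Fin n → ℤ,
    ∀ G : Set (Fin n → ℤ), (∀ m' ∈ G, dyadicCube n j m' ⊆ dyadicCube n k m) →
      (∑' m' : G, gammaHat n d p γ j m'.1 ^ p.toReal) ≤
        C * (volume (⋃ m' ∈ G, dyadicCube n j m') / volume (dyadicCube n k m)) ^ δ *
          ∑' m' : {m' : Fin n → ℤ // dyadicCube n j m' ⊆ dyadicCube n k m},
            gammaHat n d p γ j m'.1 ^ p.toReal

/-- `δ₂(γ,n,d)`. -/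
def delta2 (n d : ℕ) (p : ℝ≥0∞) (γ : Rn (n + d) → ℝ) : ℝ :=
  sSup {δ : ℝ | 0 < δ ∧ delta2Good n d p γ δ}

/-- The cardinal B-spline of degree `deg` with knots `0, 1, …, deg + 1`. -/
def cardB : ℕ → ℝ → ℝ
  | 0, x => if 0 ≤ x ∧ x < 1 then 1 else 0
  | (d + 1), x => (x / (d + 1)) * cardB d x + (((d : ℝ) + 2 - x) / (d + 1)) * cardB d (x - 1)

/-- The tensor-product B-spline `N^{deg}_{k,m}` on `ℝⁿ`. -/
def Bspl (n deg k : ℕ) (m : Fin n → ℤ) (x : Rn n) : ℝ :=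
  ∏ i, cardB deg (2 ^ k * x i - (m i : ℝ))

/-- The spline `Σ_m β_m N^{deg}_{k,m}`. -/
def splineSum (n deg k : ℕ) (β : (Fin n → ℤ) → ℝ) (x : Rn n) : ℝ :=
  ∑' m, β m * Bspl n deg k m x

/-- A dyadic spline of degree `deg` (an element of `Σ^{deg} = ⋃_k Σ^{deg}_k`). -/
def IsSplineFn (n deg : ℕ) (S : Rn n → ℝ) : Prop :=
  ∃ (k : ℕ) (β : (Fin n → ℤ) → ℝ), S = splineSum n deg k β

/-- The weighted best spline approximation `s_k(φ)` by splines of degree `deg`. -/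
def sApprox (n deg : ℕ) (p r : ℝ≥0∞) (T : ℕ → (Fin n → ℤ) → ℝ≥0∞) (φ : Rn n → ℝ) (k : ℕ) :
    ℝ≥0∞ :=
  ⨅ β : (Fin n → ℤ) → ℝ,
    lqNorm p (fun m => T k m *
      eLpNorm (fun x => φ x - splineSum n deg k β x) r (volume.restrict (dyadicCube n k m)))

/-- `s_j(φ)` for `j ∈ {-1, 0, 1, 2, …}`, including the term `s_{-1}`. -/
def sApproxZ (n deg : ℕ) (p r : ℝ≥0∞) (T : ℕ → (Fin n → ℤ) → ℝ≥0∞) (φ : Rn n → ℝ) (j : ℤ) :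
    ℝ≥0∞ :=
  if j < 0 then
    lqNorm p (fun m => T 0 m * eLpNorm φ r (volume.restrict (dyadicCube n 0 m)))
  else sApprox n deg p r T φ j.toNat

/-- Local best polynomial approximation `E_l(φ,Q)_r` by polynomials of total degree `< l`. -/
def bestApproxE (n l : ℕ) (r : ℝ≥0∞) (φ : Rn n → ℝ) (Q : Set (Rn n)) : ℝ≥0∞ :=
  ⨅ P : {P : MvPolynomial (Fin n) ℝ // P.totalDegree < l},
    eLpNorm (fun x => φ x - MvPolynomial.eval x P.1) r (volume.restrict Q)

/-- The modulus of continuity `ω_l(φ,Q)_r`. -/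
def modulusE (n l : ℕ) (r : ℝ≥0∞) (φ : Rn n → ℝ) (Q : Set (Rn n)) : ℝ≥0∞ :=
  ⨆ h : Rn n, eLpNorm (difflOn l Q h φ) r (volume : Measure (Rn n))

def partialDeriv {N : ℕ} (i : Fin N) (ψ : Rn N → ℝ) : Rn N → ℝ :=
  fun x => fderiv ℝ ψ x (Pi.single i 1)

def iterPD {N : ℕ} : List (Fin N) → (Rn N → ℝ) → Rn N → ℝ
  | [], ψ => ψ
  | i :: L, ψ => partialDeriv i (iterPD L ψ)

def multiIdxList {N : ℕ} (α : Fin N → ℕ) : List (Fin N) :=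
  (List.finRange N).foldr (fun i L => List.replicate (α i) i ++ L) []

/-- Iterated partial derivative `D^α`. -/
def multiDeriv {N : ℕ} (α : Fin N → ℕ) (ψ : Rn N → ℝ) : Rn N → ℝ :=
  iterPD (multiIdxList α) ψ

/-- `g` is the weak (Sobolev) derivative `D^α f`. -/
def IsWeakDeriv {N : ℕ} (α : Fin N → ℕ) (f g : Rn N → ℝ) : Prop :=
  ∀ ψ : Rn N → ℝ, ContDiff ℝ (⊤ : ℕ∞) ψ → HasCompactSupport ψ →
    ∫ x, f x * multiDeriv α ψ x = (-1 : ℝ) ^ (∑ i, α i) * ∫ x, g x * ψ x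

/-- The weighted Sobolev norm `Σ_{|α| ≤ l} ‖γ · D^α f‖_{L_p}` computed from a system `D` of
weak derivatives. -/
def sobNorm (N : ℕ) (p : ℝ≥0∞) (l : ℕ) (γ : Rn N → ℝ) (D : (Fin N → ℕ) → Rn N → ℝ) : ℝ≥0∞ :=
  ∑' α : Fin N → ℕ,
    if (∑ i, α i) ≤ l then eLpNorm (fun x => γ x * D α x) p volume else 0

/-- Membership in the weighted Sobolev space `W^l_p(ℝ^N, γ)`, witnessed by the system `D`
of weak derivatives of `f`. -/
def MemW (N : ℕ) (p : ℝ≥0∞) (l : ℕ) (γ : Rn N → ℝ) (f : Rn N → ℝ)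
    (D : (Fin N → ℕ) → Rn N → ℝ) : Prop :=
  MeasureTheory.LocallyIntegrable f volume ∧ D 0 = f ∧
    (∀ α : Fin N → ℕ, (∑ i, α i) ≤ l →
      MeasureTheory.LocallyIntegrable (D α) volume ∧ IsWeakDeriv α f (D α)) ∧
    sobNorm N p l γ D < ∞

/-- `φ` is the trace of `f` on the plane `y = 0`. -/
def IsTraceSob {n d : ℕ} (f : Rn (n + d) → ℝ) (φ : Rn n → ℝ) : Prop :=
  ∃ f' : Rn (n + d) → ℝ, f' =ᵐ[volume] f ∧
    ∀ (c : Rn n) (s : ℝ), 0 < s →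
      Filter.Tendsto (fun y : Rn d => ∫ x in cubeAt c s, |f' (Fin.append x y) - φ x|)
        (nhds 0) (nhds 0)

/-- The weight sequence `γ_k(x) = 2^{k(l+n/p)} Σ_m χ_{Q̃^n_{k,m}}(x) γ̂_{k,m}`. -/
def gammaSeq (n d : ℕ) (p : ℝ≥0∞) (l : ℕ) (γ : Rn (n + d) → ℝ) (k : ℕ) (x : Rn n) : ℝ≥0∞ :=
  (2 : ℝ≥0∞) ^ ((k : ℝ) * ((l : ℝ) + (n : ℝ) / p.toReal)) *
    ∑' m : Fin n → ℤ, (dyadicCubeHalf n k m).indicator (fun _ => gammaHat n d p γ k m) x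

/-- Conjugate exponent in `ℝ≥0∞`. -/
def conjE (e : ℝ≥0∞) : ℝ≥0∞ := (1 - e⁻¹)⁻¹

/-- The exponent `p_θ`. -/
def pTheta (p θ : ℝ≥0∞) : ℝ≥0∞ := if θ = ∞ ∧ p = ∞ then 1 else p / θ

/-- Coefficients of the `l`-th difference. -/
def cof (l j : ℕ) : ℝ := (l.choose j : ℝ) * (-1 : ℝ) ^ (l + j)

lemma diffl_eq_cof {n : ℕ} (l : ℕ) (h : Rn n) (g : Rn n → ℝ) (x : Rn n) :
    diffl l h g x = ∑ j ∈ Finset.range (l + 1), cof l j * g (x + (j : ℝ) • h) := rfl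

lemma sum_cof_poly (l : ℕ) (P : Polynomial ℝ) (hP : P.natDegree < l) :
    ∑ j ∈ Finset.range (l + 1), cof l j * P.eval (j : ℝ) = 0 := by
  have h := congrFun (Polynomial.fwdDiff_iter_eq_zero_of_degree_lt hP) (0 : ℝ)
  rw [fwdDiff_iter_eq_sum_shift] at h
  simp only [zero_add, nsmul_eq_mul, mul_one, Pi.zero_apply, zsmul_eq_mul, Int.cast_mul,
    Int.cast_pow, Int.cast_neg, Int.cast_one, Int.cast_natCast] at h
  rw [← h]
  refine Finset.sum_congr rfl fun j hj => ?_
  have hj' : j ≤ l := by simpa [Nat.lt_succ_iff] using hj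
  have : (-1 : ℝ) ^ (l + j) = (-1) ^ (l - j) := by
    obtain ⟨k, rfl⟩ := Nat.exists_eq_add_of_le hj'
    have : (j + k + j) = k + 2 * j := by ring
    rw [this, pow_add, pow_mul]; simp
  rw [cof, this]; ring

lemma taylor_at (g : ℝ → ℝ) (hg : ContDiff ℝ (⊤ : ℕ∞) g) (m j : ℕ) (hj : j < m + 1) :
    g j = (∑ k ∈ Finset.range (m + 1), Polynomial.C (iteratedDeriv k g ((m + 1 : ℕ) : ℝ) / k.factorial) *
        (Polynomial.X - Polynomial.C ((m + 1 : ℕ) : ℝ)) ^ k).eval (j : ℝ) +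
      ∫ t in ((m + 1 : ℕ) : ℝ)..(j : ℝ), (((j : ℝ) - t) ^ m / m.factorial) * iteratedDeriv (m + 1) g t := by
  have hne : ((m + 1 : ℕ) : ℝ) ≠ (j : ℝ) := by exact_mod_cast hj.ne'
  have hU : UniqueDiffOn ℝ (Set.uIcc ((m + 1 : ℕ) : ℝ) (j : ℝ)) := uniqueDiffOn_uIcc hne
  have h := taylor_integral_remainder (f := g) (x := (j : ℝ)) (x₀ := ((m + 1 : ℕ) : ℝ)) (n := m)
    ((hg.of_le (by exact_mod_cast le_top)).contDiffOn)
  have e : ∀ k, ∀ t ∈ Set.uIcc ((m + 1 : ℕ) : ℝ) (j : ℝ),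
      iteratedDerivWithin k g (Set.uIcc ((m + 1 : ℕ) : ℝ) (j : ℝ)) t = iteratedDeriv k g t :=
    fun k t ht => iteratedDerivWithin_eq_iteratedDeriv hU
      ((hg.of_le (by exact_mod_cast le_top)).contDiffAt) ht
  rw [sub_eq_iff_eq_add'] at h
  rw [h, taylor_within_apply]
  congr 1
  · rw [Polynomial.eval_finsetSum]
    refine Finset.sum_congr rfl fun k _ => ?_
    rw [e k _ Set.left_mem_uIcc]
    simp [div_eq_mul_inv]; ring
  · refine intervalIntegral.integral_congr fun t ht => ?_
    simp only [smul_eq_mul]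
    rw [e _ _ ht]

lemma diff_one_dim (l : ℕ) (hl : 0 < l) (g : ℝ → ℝ) (hg : ContDiff ℝ (⊤ : ℕ∞) g) :
    ‖∑ j ∈ Finset.range (l + 1), cof l j * g j‖ₑ ≤
      (∑ j ∈ Finset.range (l + 1), ‖cof l j‖ₑ) *
        ∫⁻ t in Set.Ioc (0 : ℝ) l, ENNReal.ofReal (t ^ (l - 1)) * ‖iteratedDeriv l g t‖ₑ := by
  obtain ⟨m, rfl⟩ : ∃ m, l = m + 1 := ⟨l - 1, by omega⟩
  set P : Polynomial ℝ := ∑ k ∈ Finset.range (m + 1),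
    Polynomial.C (iteratedDeriv k g ((m + 1 : ℕ) : ℝ) / k.factorial) *
        (Polynomial.X - Polynomial.C ((m + 1 : ℕ) : ℝ)) ^ k with hP
  set R : ℕ → ℝ := fun j =>
    ∫ t in ((m + 1 : ℕ) : ℝ)..(j : ℝ), (((j : ℝ) - t) ^ m / m.factorial) * iteratedDeriv (m + 1) g t
    with hR
  have hdeg : P.natDegree < m + 1 := by
    rw [Nat.lt_succ_iff]
    refine Polynomial.natDegree_sum_le_of_forall_le _ _ fun k hk => ?_
    refine (Polynomial.natDegree_C_mul_le _ _).trans ?_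
    refine Polynomial.natDegree_pow_le.trans ?_
    rw [Polynomial.natDegree_X_sub_C]
    simp at hk; omega
  have hgj : ∀ j ∈ Finset.range (m + 1 + 1), g j = P.eval (j : ℝ) + R j := by
    intro j hj
    rcases Nat.lt_or_ge j (m + 1) with h | h
    · exact taylor_at g hg m j h
    · have : j = m + 1 := by simp at hj; omega
      subst this
      simp only [hR, intervalIntegral.integral_same, add_zero, hP]
      rw [Polynomial.eval_finsetSum, Finset.sum_eq_single 0]
      · simp
      · intro k _ hk; simp [hk]
      · simp
  have hs : ∑ j ∈ Finset.range (m + 1 + 1), cof (m + 1) j * g j =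
      ∑ j ∈ Finset.range (m + 1 + 1), cof (m + 1) j * R j := by
    rw [← zero_add (∑ j ∈ Finset.range (m + 1 + 1), cof (m + 1) j * R j),
      ← sum_cof_poly (m + 1) P hdeg, ← Finset.sum_add_distrib]
    exact Finset.sum_congr rfl fun j hj => by rw [hgj j hj]; ring
  rw [hs, Finset.sum_mul]
  refine (enorm_sum_le _ _).trans (Finset.sum_le_sum fun j hj => ?_)
  rw [enorm_mul]
  refine mul_le_mul_right ?_ _
  have hj' : j ≤ m + 1 := by simp at hj; omega
  have hjr : (j : ℝ) ≤ ((m + 1 : ℕ) : ℝ) := by exact_mod_cast hj'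
  calc ‖R j‖ₑ ≤ ∫⁻ t in Set.Ioc (j : ℝ) ((m + 1 : ℕ) : ℝ),
        ‖(((j : ℝ) - t) ^ m / m.factorial) * iteratedDeriv (m + 1) g t‖ₑ := by
        simp only [hR]
        rw [intervalIntegral.integral_symm, intervalIntegral.integral_of_le hjr, enorm_neg]
        exact enorm_integral_le_lintegral_enorm _
    _ ≤ ∫⁻ t in Set.Ioc (j : ℝ) ((m + 1 : ℕ) : ℝ),
        ENNReal.ofReal (t ^ (m + 1 - 1)) * ‖iteratedDeriv (m + 1) g t‖ₑ := by
        refine setLIntegral_mono' measurableSet_Ioc fun t ht => ?_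
        rw [enorm_mul]
        refine mul_le_mul_left ?_ _
        rw [Real.enorm_eq_ofReal_abs]
        refine ENNReal.ofReal_le_ofReal ?_
        rw [abs_div, abs_pow, Nat.add_sub_cancel]
        have h1 : |(j : ℝ) - t| ≤ t := by
          have := ht.1
          have h0 : (0 : ℝ) ≤ j := Nat.cast_nonneg j
          rw [abs_le]; constructor <;> linarith
        have h2 : (1 : ℝ) ≤ |(m.factorial : ℝ)| := by
          rw [abs_of_nonneg (by positivity)]
          exact_mod_cast Nat.succ_le_of_lt (Nat.factorial_pos m)
        calc |(j : ℝ) - t| ^ m / |(m.factorial : ℝ)| ≤ |(j : ℝ) - t| ^ m :=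
              div_le_self (by positivity) h2
          _ ≤ t ^ m := pow_le_pow_left₀ (abs_nonneg _) h1 m
    _ ≤ _ := by
        refine lintegral_mono_set ?_
        exact Set.Ioc_subset_Ioc_left (Nat.cast_nonneg j)

lemma partialDeriv_smooth {N : ℕ} (i : Fin N) {u : Rn N → ℝ} (hu : ContDiff ℝ (⊤ : ℕ∞) u) :
    ContDiff ℝ (⊤ : ℕ∞) (partialDeriv i u) := by
  unfold partialDeriv
  have h1 : ContDiff ℝ (⊤ : ℕ∞) (fderiv ℝ u) := hu.fderiv_right (by simp)
  exact h1.clm_apply contDiff_const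

lemma iterPD_smooth {N : ℕ} (L : List (Fin N)) {u : Rn N → ℝ} (hu : ContDiff ℝ (⊤ : ℕ∞) u) :
    ContDiff ℝ (⊤ : ℕ∞) (iterPD L u) := by
  induction L with
  | nil => exact hu
  | cons i L ih => exact partialDeriv_smooth i ih

lemma partialDeriv_comm {N : ℕ} (i j : Fin N) {u : Rn N → ℝ} (hu : ContDiff ℝ (⊤ : ℕ∞) u) :
    partialDeriv i (partialDeriv j u) = partialDeriv j (partialDeriv i u) := by
  have h1 : ContDiff ℝ (⊤ : ℕ∞) (fderiv ℝ u) := hu.fderiv_right (by simp)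
  have key : ∀ a b : Fin N, ∀ x, partialDeriv a (partialDeriv b u) x =
      fderiv ℝ (fderiv ℝ u) x (Pi.single a 1) (Pi.single b 1) := by
    intro a b x
    unfold partialDeriv
    rw [fderiv_clm_apply (h1.differentiable (by simp)).differentiableAt (differentiableAt_const _)]
    simp
  funext x
  rw [key, key]
  have hs : IsSymmSndFDerivAt ℝ u x := hu.contDiffAt.isSymmSndFDerivAt (by
    rw [minSmoothness_of_isRCLikeNormedField]; exact WithTop.coe_le_coe.2 (le_top : (2 : ℕ∞) ≤ ⊤))
  exact hs _ _

lemma iterPD_perm {N : ℕ} {L L' : List (Fin N)} (h : L.Perm L') {u : Rn N → ℝ}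
    (hu : ContDiff ℝ (⊤ : ℕ∞) u) : iterPD L u = iterPD L' u := by
  induction h with
  | nil => rfl
  | cons i _ ih => simp only [iterPD, ih]
  | swap i j L => exact partialDeriv_comm _ _ (iterPD_smooth L hu)
  | trans _ _ ih1 ih2 => exact ih1.trans ih2

lemma count_multiIdxList {N : ℕ} (α : Fin N → ℕ) (i : Fin N) :
    (multiIdxList α).count i = α i := by
  have key : ∀ M : List (Fin N), M.Nodup →
      ((M.foldr (fun i L => List.replicate (α i) i ++ L) []).count i) = if i ∈ M then α i else 0 := by
    intro M hM
    induction M with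
    | nil => simp
    | cons a M ih =>
      rw [List.nodup_cons] at hM
      simp only [List.foldr_cons, List.count_append, ih hM.2, List.count_replicate, List.mem_cons]
      by_cases h : a = i
      · subst h; simp [hM.1]
      · simp [h, Ne.symm h]
  rw [multiIdxList, key _ (List.nodup_finRange N)]
  simp

/-- Multi-index of a list of directions. -/
def cntL {N l : ℕ} (L : Fin l → Fin N) : Fin N → ℕ := fun i => (List.ofFn L).count i

lemma sum_cntL {N l : ℕ} (L : Fin l → Fin N) : ∑ i, cntL L i = l := by
  have : (List.ofFn L).length = ∑ i, (List.ofFn L).count i := by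
    have := Multiset.sum_count_eq_card (s := Finset.univ) (m := (↑(List.ofFn L) : Multiset (Fin N)))
      (by simp)
    simpa using this.symm
  unfold cntL
  rw [← this]; simp

lemma iterPD_ofFn {N l : ℕ} (L : Fin l → Fin N) {u : Rn N → ℝ} (hu : ContDiff ℝ (⊤ : ℕ∞) u) :
    iterPD (List.ofFn L) u = multiDeriv (cntL L) u := by
  unfold multiDeriv
  refine iterPD_perm ?_ hu
  rw [List.perm_iff_count]
  intro i
  rw [count_multiIdxList]; rfl

lemma multiDeriv_zero {N : ℕ} (u : Rn N → ℝ) : multiDeriv (0 : Fin N → ℕ) u = u := by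
  have : multiIdxList (0 : Fin N → ℕ) = [] := by
    rw [← List.perm_nil, List.perm_iff_count]
    intro i; rw [count_multiIdxList]; simp
  rw [multiDeriv, this]; rfl

lemma hasDerivAt_line {N : ℕ} {u : Rn N → ℝ} (hu : ContDiff ℝ (⊤ : ℕ∞) u) (z v : Rn N) (t : ℝ) :
    HasDerivAt (fun t : ℝ => u (z + t • v)) (∑ i, v i * partialDeriv i u (z + t • v)) t := by
  have h1 : HasFDerivAt u (fderiv ℝ u (z + t • v)) (z + t • v) :=
    (hu.differentiable (by simp) _).hasFDerivAt
  have h2 : HasDerivAt (fun t : ℝ => z + t • v) v t := by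
    simpa using ((hasDerivAt_id t).smul_const v).const_add z
  have h3 := h1.comp_hasDerivAt t h2
  have e : ∑ i, v i * partialDeriv i u (z + t • v) = (fderiv ℝ u (z + t • v)) v := by
    simp only [partialDeriv]
    generalize fderiv ℝ u (z + t • v) = A
    conv_rhs => rw [← Finset.univ_sum_single v, map_sum]
    refine Finset.sum_congr rfl fun i _ => ?_
    rw [← smul_eq_mul, ← map_smul, ← Pi.single_smul', smul_eq_mul, mul_one]
  rw [e]
  exact h3

lemma iteratedDeriv_line {N : ℕ} {u : Rn N → ℝ} (hu : ContDiff ℝ (⊤ : ℕ∞) u) (z v : Rn N) (k : ℕ) :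
    iteratedDeriv k (fun t : ℝ => u (z + t • v)) = fun t =>
      ∑ L : Fin k → Fin N, (∏ j, v (L j)) * iterPD (List.ofFn L) u (z + t • v) := by
  induction k with
  | zero => funext t; simp [iterPD]
  | succ k ih =>
    rw [iteratedDeriv_succ, ih]
    funext t
    have h : HasDerivAt (fun t : ℝ =>
        ∑ L : Fin k → Fin N, (∏ j, v (L j)) * iterPD (List.ofFn L) u (z + t • v))
        (∑ L : Fin k → Fin N, (∏ j, v (L j)) *
          ∑ i, v i * partialDeriv i (iterPD (List.ofFn L) u) (z + t • v)) t := by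
      refine HasDerivAt.fun_sum fun L _ => ?_
      exact (hasDerivAt_line (iterPD_smooth _ hu) z v t).const_mul _
    rw [h.deriv]
    rw [← (Fin.consEquiv (fun _ : Fin (k + 1) => Fin N)).sum_comp, Fintype.sum_prod_type_right]
    refine Finset.sum_congr rfl fun L _ => ?_
    rw [Finset.mul_sum]
    refine Finset.sum_congr rfl fun i _ => ?_
    simp only [Fin.consEquiv_apply, Fin.prod_univ_succ, Fin.cons_zero, Fin.cons_succ, List.ofFn_succ]
    simp only [iterPD]
    ring

/-- Sum of the absolute values of all order `l` derivatives, computed from a system `D`. -/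
def Gsum {N : ℕ} (l : ℕ) (D : (Fin N → ℕ) → Rn N → ℝ) (z : Rn N) : ℝ≥0∞ :=
  ∑ L : Fin l → Fin N, ‖D (cntL L) z‖ₑ

lemma enorm_iteratedDeriv_line_le {N : ℕ} {u : Rn N → ℝ} (hu : ContDiff ℝ (⊤ : ℕ∞) u)
    (z v : Rn N) (k : ℕ) (t : ℝ) :
    ‖iteratedDeriv k (fun t : ℝ => u (z + t • v)) t‖ₑ ≤
      ‖v‖ₑ ^ k * Gsum k (fun α => multiDeriv α u) (z + t • v) := by
  rw [iteratedDeriv_line hu, Gsum, Finset.mul_sum]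
  refine (enorm_sum_le _ _).trans (Finset.sum_le_sum fun L _ => ?_)
  rw [enorm_mul, iterPD_ofFn L hu]
  refine mul_le_mul_left ?_ _
  rw [show ‖∏ j, v (L j)‖ₑ = ∏ j, ‖v (L j)‖ₑ by
    simp [enorm_eq_nnnorm, nnnorm_prod]]
  refine (Finset.prod_le_prod' (fun j _ => ?_)).trans (b := ∏ _j : Fin k, ‖v‖ₑ) (by simp)
  rw [enorm_eq_nnnorm, enorm_eq_nnnorm, ENNReal.coe_le_coe]
  exact nnnorm_le_pi_nnnorm v (L j)

lemma Gsum_smooth_meas {N : ℕ} {u : Rn N → ℝ} (hu : ContDiff ℝ (⊤ : ℕ∞) u) (k : ℕ) :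
    Measurable (Gsum k (fun α => multiDeriv α u)) := by
  unfold Gsum
  refine Finset.measurable_fun_sum _ fun L _ => ?_
  exact (iterPD_smooth _ hu).continuous.measurable.enorm

/-- Constant `∑ |c_j| = 2^l`. -/
def cofS (l : ℕ) : ℝ≥0∞ := ∑ j ∈ Finset.range (l + 1), ‖cof l j‖ₑ

lemma cofS_ne_top (l : ℕ) : cofS l ≠ ∞ := by
  unfold cofS; exact (ENNReal.sum_lt_top.2 fun j _ => enorm_lt_top).ne

lemma enorm_cof_le (l j : ℕ) (hj : j ∈ Finset.range (l + 1)) : ‖cof l j‖ₑ ≤ cofS l :=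
  Finset.single_le_sum (f := fun j => ‖cof l j‖ₑ) (fun _ _ => zero_le) hj

/-- Bound of the difference by the integral of the `l`-th derivatives on the segment. -/
lemma diffl_le {N : ℕ} {u : Rn N → ℝ} (hu : ContDiff ℝ (⊤ : ℕ∞) u) (l : ℕ) (hl : 0 < l)
    (z v : Rn N) :
    ‖diffl l v u z‖ₑ ≤ cofS l * ‖v‖ₑ ^ l * ∫⁻ t in Set.Ioc (0 : ℝ) l,
        ENNReal.ofReal (t ^ (l - 1)) * Gsum l (fun α => multiDeriv α u) (z + t • v) := by
  have hg : ContDiff ℝ (⊤ : ℕ∞) (fun t : ℝ => u (z + t • v)) :=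
    hu.comp (contDiff_const.add (contDiff_id.smul contDiff_const))
  refine (diff_one_dim l hl (fun t : ℝ => u (z + t • v)) hg).trans ?_
  rw [mul_assoc]
  refine mul_le_mul_right ?_ _
  rw [← lintegral_const_mul' _ _ (by simp)]
  refine lintegral_mono fun t => ?_
  calc _ ≤ ENNReal.ofReal (t ^ (l - 1)) *
      (‖v‖ₑ ^ l * Gsum l (fun α => multiDeriv α u) (z + t • v)) :=
        mul_le_mul_right (enorm_iteratedDeriv_line_le hu z v l t) _
    _ = _ := by ring

lemma append_add_smul {n d : ℕ} (x h : Rn n) (y v : Rn d) (t : ℝ) :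
    (Fin.append x y : Rn (n + d)) + t • (Fin.append h v : Rn (n + d)) =
      Fin.append (x + t • h) (y + t • v) := by
  funext i
  refine Fin.addCases (fun i => ?_) (fun i => ?_) i <;> simp

lemma append_add {n d : ℕ} (x h : Rn n) (y v : Rn d) :
    (Fin.append x y : Rn (n + d)) + (Fin.append h v : Rn (n + d)) =
      Fin.append (x + h) (y + v) := by
  funext i
  refine Fin.addCases (fun i => ?_) (fun i => ?_) i <;> simp

lemma norm_append {n d : ℕ} (x : Rn n) (y : Rn d) :
    ‖(Fin.append x y : Rn (n + d))‖ = max ‖x‖ ‖y‖ := by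
  have h := (Fin.appendIsometry (α := ℝ) n d).dist_eq (x, y) (0, 0)
  have e0 : (Fin.appendIsometry (α := ℝ) n d) (0, 0) = 0 := by
    funext i
    refine Fin.addCases (fun i => ?_) (fun i => ?_) i <;> simp [Fin.appendIsometry, Fin.appendEquiv]
  have e1 : (Fin.appendIsometry (α := ℝ) n d) (x, y) = Fin.append x y := rfl
  rw [e0, e1, dist_zero_right, Prod.dist_eq, dist_zero_right, dist_zero_right] at h
  exact h

lemma continuous_append {n d : ℕ} :
    Continuous (fun q : Rn n × Rn d => (Fin.append q.1 q.2 : Rn (n + d))) :=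
  (Fin.appendHomeomorph (X := ℝ) n d).continuous

lemma measurable_append {n d : ℕ} :
    Measurable (fun q : Rn n × Rn d => (Fin.append q.1 q.2 : Rn (n + d))) :=
  continuous_append.measurable

/-- Measurable equivalence `ℝⁿ × ℝᵈ ≃ ℝⁿ⁺ᵈ`. -/
def appME (n d : ℕ) : Rn n × Rn d ≃ᵐ Rn (n + d) :=
  (Fin.appendHomeomorph (X := ℝ) n d).toMeasurableEquiv

lemma appME_apply {n d : ℕ} (q : Rn n × Rn d) : appME n d q = Fin.append q.1 q.2 := rfl

lemma appME_mp (n d : ℕ) : MeasurePreserving (appME n d) volume volume := by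
  have h1 := (volume_measurePreserving_sumPiEquivProdPi_symm (ι := Fin n) (ι' := Fin d)
    (fun _ => ℝ))
  have h2 := volume_measurePreserving_piCongrLeft (fun _ : Fin (n + d) => ℝ) finSumFinEquiv
  have h3 := h2.comp h1
  convert h3 using 1
  funext q
  funext i
  refine Fin.addCases (fun i => ?_) (fun i => ?_) i
  · simp only [appME_apply, Fin.append_left, Function.comp_apply]
    have : (Fin.castAdd d i) = finSumFinEquiv (Sum.inl i) := by simp
    rw [this]
    exact (Equiv.piCongrLeft_apply_apply (fun _ => ℝ) finSumFinEquiv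
      ((MeasurableEquiv.sumPiEquivProdPi fun _ => ℝ).symm q) (Sum.inl i)).symm
  · simp only [appME_apply, Fin.append_right, Function.comp_apply]
    have : (Fin.natAdd n i) = finSumFinEquiv (Sum.inr i) := by simp
    rw [this]
    exact (Equiv.piCongrLeft_apply_apply (fun _ => ℝ) finSumFinEquiv
      ((MeasurableEquiv.sumPiEquivProdPi fun _ => ℝ).symm q) (Sum.inr i)).symm

lemma lintegral_append {n d : ℕ} (F : Rn (n + d) → ℝ≥0∞) (hF : AEMeasurable F volume) :
    ∫⁻ z, F z = ∫⁻ x : Rn n, ∫⁻ y : Rn d, F (Fin.append x y) := by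
  rw [← (appME_mp n d).lintegral_comp_emb (appME n d).measurableEmbedding]
  rw [Measure.volume_eq_prod, lintegral_prod]
  · rfl
  · rw [← Measure.volume_eq_prod]
    exact hF.comp_quasiMeasurePreserving (appME_mp n d).quasiMeasurePreserving

/-- Jensen's inequality for powers. -/
lemma jensen_rpow {α : Type*} [MeasurableSpace α] (μ : Measure α) (b : α → ℝ≥0∞)
    (hb : AEMeasurable b μ) (r : ℝ) (hr : 1 ≤ r) :
    (∫⁻ t, b t ∂μ) ^ r ≤ μ Set.univ ^ (r - 1) * ∫⁻ t, b t ^ r ∂μ := by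
  have h0 : 0 < r := by linarith
  have h := eLpNorm'_le_eLpNorm'_mul_rpow_measure_univ (p := 1) (q := r) one_pos hr
    (f := b) (μ := μ) hb.aestronglyMeasurable
  simp only [eLpNorm', enorm_eq_self, ENNReal.rpow_one, div_one] at h
  have h2 := ENNReal.rpow_le_rpow h h0.le
  rw [ENNReal.mul_rpow_of_nonneg _ _ h0.le, ← ENNReal.rpow_mul, ← ENNReal.rpow_mul,
    one_div, inv_mul_cancel₀ h0.ne', ENNReal.rpow_one] at h2
  refine h2.trans (le_of_eq ?_)
  rw [mul_comm]
  congr 2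
  field_simp

lemma lintegral_comp_smul_pos {d : ℕ} (F : Rn d → ℝ≥0∞) (t : ℝ) (ht : 0 < t) :
    ∫⁻ y, F (t • y) = ENNReal.ofReal (t ^ (-(d : ℝ))) * ∫⁻ z, F z := by
  have h := Measure.map_addHaar_smul (volume : Measure (Rn d)) ht.ne'
  have e : ∫⁻ y, F (t • y) = ∫⁻ z, F z ∂(Measure.map (fun y : Rn d => t • y) volume) :=
    ((Homeomorph.smulOfNeZero t ht.ne').measurableEmbedding.lintegral_map F).symm
  rw [e, h, lintegral_smul_measure, smul_eq_mul]
  congr 2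
  rw [abs_of_nonneg (by positivity), Real.rpow_neg ht.le]
  simp

lemma measurableSet_openCube {n : ℕ} (x : Rn n) (s : ℝ) : MeasurableSet (openCube x s) := by
  unfold openCube
  simp only [Set.ofPred_forall]
  exact MeasurableSet.iInter fun i => measurableSet_lt (by fun_prop) (by fun_prop)

lemma cubeAt_eq_pi {n : ℕ} (x : Rn n) (s : ℝ) :
    cubeAt x s = Set.pi Set.univ (fun i => Set.Ioo (x i) (x i + s)) := by
  ext y; simp [cubeAt]

lemma measurableSet_cubeAt {n : ℕ} (x : Rn n) (s : ℝ) : MeasurableSet (cubeAt x s) := by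
  rw [cubeAt_eq_pi]
  exact MeasurableSet.univ_pi fun i => measurableSet_Ioo

lemma volume_cubeAt {n : ℕ} (x : Rn n) (s : ℝ) :
    volume (cubeAt x s) = ENNReal.ofReal s ^ n := by
  rw [cubeAt_eq_pi, Real.volume_pi_Ioo]
  simp

lemma openCube_eq_cubeAt {n : ℕ} (x : Rn n) (s : ℝ) :
    openCube x s = cubeAt (fun i => x i - s) (2 * s) := by
  ext y
  simp only [openCube, cubeAt, Set.mem_ofPred_eq, abs_lt]
  refine forall_congr' fun i => ?_
  constructor <;> rintro ⟨h1, h2⟩ <;> constructor <;> linarith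

lemma volume_openCube {n : ℕ} (x : Rn n) (s : ℝ) :
    volume (openCube x s) = ENNReal.ofReal (2 * s) ^ n := by
  rw [openCube_eq_cubeAt, volume_cubeAt]

/-- The averaging cube in the vertical direction. -/
def Yc (d : ℕ) (s : ℝ) : Set (Rn d) := cubeAt (fun _ => s / 2) (s / 2)

lemma Yc_norm {d : ℕ} (hd : 0 < d) {s : ℝ} (hs : 0 < s) {y : Rn d} (hy : y ∈ Yc d s) :
    s / 2 ≤ ‖y‖ ∧ ‖y‖ ≤ s := by
  constructor
  · have h1 := norm_le_pi_norm y ⟨0, hd⟩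
    have h2 := (hy ⟨0, hd⟩).1
    simp only [Real.norm_eq_abs] at h1
    have := le_abs_self (y ⟨0, hd⟩)
    simp only at h2
    linarith
  · rw [pi_norm_le_iff_of_nonneg hs.le]
    intro i
    have h := hy i
    simp only at h
    rw [Real.norm_eq_abs, abs_le]
    constructor <;> linarith [h.1, h.2]

/-- The weight `(‖z‖/s)^θ`. -/
def Wt {d : ℕ} (θ s : ℝ) (z : Rn d) : ℝ≥0∞ := ENNReal.ofReal ((‖z‖ / s) ^ θ)

lemma Wt_meas {d : ℕ} (θ s : ℝ) : Measurable (Wt (d := d) θ s) := by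
  unfold Wt; fun_prop

lemma hardy_inner (θ : ℝ) (hθ : 0 < θ) (a : ℝ) (ha : 0 ≤ a) :
    ∫⁻ t in Set.Icc a (2 * a), ENNReal.ofReal (t ^ (θ - 1)) ≤
      ENNReal.ofReal (2 ^ θ) * ENNReal.ofReal (a ^ θ) := by
  rcases ha.eq_or_lt with rfl | ha
  · simp
  calc ∫⁻ t in Set.Icc a (2 * a), ENNReal.ofReal (t ^ (θ - 1))
      ≤ ∫⁻ t in Set.Icc a (2 * a), ENNReal.ofReal ((2 * a) ^ θ / a) := by
        refine setLIntegral_mono' measurableSet_Icc fun t ht => ENNReal.ofReal_le_ofReal ?_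
        have ht0 : 0 < t := ha.trans_le ht.1
        rw [Real.rpow_sub_one ht0.ne']
        exact div_le_div₀ (by positivity) (Real.rpow_le_rpow ht0.le ht.2 hθ.le) ha ht.1
    _ = ENNReal.ofReal (2 ^ θ) * ENNReal.ofReal (a ^ θ) := by
        rw [setLIntegral_const, Real.volume_Icc, ← ENNReal.ofReal_mul (by positivity),
          ← ENNReal.ofReal_mul (by positivity), Real.mul_rpow (by norm_num) ha.le]
        congr 1
        field_simp
        ring

/-- The gain exponent. -/
def thE (d l : ℕ) (r : ℝ) : ℝ := ((l : ℝ) - d / r) / 2 * (1 + r)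

lemma thE_pos {d l : ℕ} {r : ℝ} (hr : 1 ≤ r) (hk : (d : ℝ) / r < l) : 0 < thE d l r := by
  unfold thE
  have : 0 < (l : ℝ) - d / r := by linarith
  positivity

lemma vert0 {d : ℕ} (hd : 0 < d) (l : ℕ) (hl : 0 < l) (r : ℝ) (hr : 1 ≤ r) (hk : (d : ℝ) / r < l) :
    ∃ C : ℝ≥0∞, C ≠ ∞ ∧ ∀ (s : ℝ), 0 < s → ∀ G : Rn d → ℝ≥0∞, Measurable G →
      ∫⁻ y in Yc d s, (∫⁻ t in Set.Ioc (0 : ℝ) l, ENNReal.ofReal (t ^ (l - 1)) * G (t • y)) ^ r ≤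
        C * ∫⁻ z in Metric.closedBall (0 : Rn d) (l * s), Wt (thE d l r) s z * G z ^ r := by
  have hr0 : 0 < r := by linarith
  set κ : ℝ := (l : ℝ) - d / r with hκ
  have hκ0 : 0 < κ := by rw [hκ]; linarith
  set M : ℝ≥0∞ := ∫⁻ t in Set.Ioc (0 : ℝ) l, ENNReal.ofReal (t ^ (κ / 2 - 1)) with hM
  have hMfin : M ≠ ∞ := by
    have hi : IntervalIntegrable (fun t : ℝ => t ^ (κ / 2 - 1)) volume 0 l :=
      intervalIntegral.intervalIntegrable_rpow' (by linarith)
    rw [intervalIntegrable_iff_integrableOn_Ioc_of_le (Nat.cast_nonneg l)] at hi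
    have := hi.lintegral_lt_top
    exact this.ne
  refine ⟨M ^ (r - 1) * ENNReal.ofReal (2 ^ (thE d l r)), ENNReal.mul_ne_top
    (ENNReal.rpow_ne_top_of_nonneg (by linarith) hMfin) ENNReal.ofReal_ne_top, ?_⟩
  intro s hs G hG
  set θ := thE d l r with hθ
  have hθ0 : 0 < θ := thE_pos hr hk
  -- Jensen
  have step1 : ∀ y : Rn d,
      (∫⁻ t in Set.Ioc (0 : ℝ) l, ENNReal.ofReal (t ^ (l - 1)) * G (t • y)) ^ r ≤
      M ^ (r - 1) * ∫⁻ t in Set.Ioc (0 : ℝ) l,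
        ENNReal.ofReal (t ^ (θ - 1 + d)) * G (t • y) ^ r := by
    intro y
    set μ : Measure ℝ := (volume.restrict (Set.Ioc (0 : ℝ) l)).withDensity
      (fun t => ENNReal.ofReal (t ^ (κ / 2 - 1))) with hμ
    have hm1 : Measurable (fun t : ℝ => ENNReal.ofReal (t ^ (κ / 2 - 1))) := by fun_prop
    have hGy : Measurable (fun t : ℝ => G (t • y)) := hG.comp (by fun_prop)
    have hm2 : Measurable (fun t : ℝ => ENNReal.ofReal (t ^ ((l : ℝ) - κ / 2)) * G (t • y)) := by
      fun_prop
    have J := jensen_rpow μ (fun t : ℝ => ENNReal.ofReal (t ^ ((l : ℝ) - κ / 2)) * G (t • y))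
      hm2.aemeasurable r hr
    rw [hμ, lintegral_withDensity_eq_lintegral_mul _ hm1 hm2,
      lintegral_withDensity_eq_lintegral_mul _ hm1 (hm2.pow_const r),
      withDensity_apply _ MeasurableSet.univ, Measure.restrict_univ] at J
    refine le_trans (le_of_eq ?_) (J.trans (le_of_eq ?_))
    · congr 1
      refine setLIntegral_congr_fun measurableSet_Ioc fun t ht => ?_
      simp only [Pi.mul_apply]
      rw [← mul_assoc, ← ENNReal.ofReal_mul (Real.rpow_nonneg ht.1.le _), ← Real.rpow_add ht.1,
        ← Real.rpow_natCast]
      congr 3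
      rw [Nat.cast_sub hl]; push_cast; ring
    · congr 1
      refine setLIntegral_congr_fun measurableSet_Ioc fun t ht => ?_
      simp only [Pi.mul_apply]
      rw [ENNReal.mul_rpow_of_nonneg _ _ hr0.le, ← mul_assoc,
        ENNReal.ofReal_rpow_of_nonneg (Real.rpow_nonneg ht.1.le _) hr0.le,
        ← ENNReal.ofReal_mul (Real.rpow_nonneg ht.1.le _), ← Real.rpow_mul ht.1.le,
        ← Real.rpow_add ht.1]
      congr 3
      rw [hθ, thE, hκ]
      field_simp
      ring
  have hmW := Wt_meas (d := d) θ s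
  have hYm : MeasurableSet (Yc d s) := measurableSet_cubeAt _ _
  calc ∫⁻ y in Yc d s, (∫⁻ t in Set.Ioc (0 : ℝ) l, ENNReal.ofReal (t ^ (l - 1)) * G (t • y)) ^ r
      ≤ ∫⁻ y in Yc d s, M ^ (r - 1) * ∫⁻ t in Set.Ioc (0 : ℝ) l,
        ENNReal.ofReal (t ^ (θ - 1 + d)) * G (t • y) ^ r := lintegral_mono fun y => step1 y
    _ = M ^ (r - 1) * ∫⁻ y in Yc d s, ∫⁻ t in Set.Ioc (0 : ℝ) l,
        ENNReal.ofReal (t ^ (θ - 1 + d)) * G (t • y) ^ r :=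
        lintegral_const_mul' _ _ (ENNReal.rpow_ne_top_of_nonneg (by linarith) hMfin)
    _ = M ^ (r - 1) * ∫⁻ t in Set.Ioc (0 : ℝ) l, ∫⁻ y in Yc d s,
        ENNReal.ofReal (t ^ (θ - 1 + d)) * G (t • y) ^ r := by
        congr 1
        refine lintegral_lintegral_swap (Measurable.aemeasurable ?_)
        have : Measurable (fun q : Rn d × ℝ => G (q.2 • q.1)) := hG.comp (by fun_prop)
        simp only [Function.uncurry_def]
        fun_prop
    _ = M ^ (r - 1) * ∫⁻ t in Set.Ioc (0 : ℝ) l, ∫⁻ z,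
        ENNReal.ofReal (t ^ (θ - 1)) * ((Yc d s).indicator 1 (t⁻¹ • z) * G z ^ r) := by
        congr 1
        refine setLIntegral_congr_fun measurableSet_Ioc fun t ht => ?_
        rw [← lintegral_indicator hYm]
        have e : ∀ y, (Yc d s).indicator (fun y => ENNReal.ofReal (t ^ (θ - 1 + d)) * G (t • y) ^ r) y
            = (fun z => ENNReal.ofReal (t ^ (θ - 1 + d)) *
              ((Yc d s).indicator 1 (t⁻¹ • z) * G z ^ r)) (t • y) := by
          intro y
          simp only [smul_smul, inv_mul_cancel₀ ht.1.ne', one_smul]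
          by_cases hy : y ∈ Yc d s <;> simp [hy]
        rw [lintegral_congr e]
        rw [lintegral_comp_smul_pos (fun z => ENNReal.ofReal (t ^ (θ - 1 + d)) *
              ((Yc d s).indicator 1 (t⁻¹ • z) * G z ^ r)) t ht.1,
          ← lintegral_const_mul' _ _ ENNReal.ofReal_ne_top]
        refine lintegral_congr fun z => ?_
        rw [← mul_assoc, ← ENNReal.ofReal_mul (Real.rpow_nonneg ht.1.le _), ← Real.rpow_add ht.1]
        congr 3
        ring
    _ = M ^ (r - 1) * ∫⁻ z, ∫⁻ t in Set.Ioc (0 : ℝ) l,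
        ENNReal.ofReal (t ^ (θ - 1)) * ((Yc d s).indicator 1 (t⁻¹ • z) * G z ^ r) := by
        congr 1
        refine lintegral_lintegral_swap (Measurable.aemeasurable ?_)
        have h1 : Measurable ((Yc d s).indicator (1 : Rn d → ℝ≥0∞)) :=
          measurable_one.indicator hYm
        have : Measurable (fun q : ℝ × Rn d => (Yc d s).indicator (1 : Rn d → ℝ≥0∞) (q.1⁻¹ • q.2)) :=
          h1.comp (by fun_prop)
        simp only [Function.uncurry_def]
        fun_prop
    _ ≤ M ^ (r - 1) * ∫⁻ z, (Metric.closedBall (0 : Rn d) (l * s)).indicator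
          (fun z => ENNReal.ofReal (2 ^ θ) * (Wt θ s z * G z ^ r)) z := by
        refine mul_le_mul_right (lintegral_mono fun z => ?_) _
        by_cases hz : z ∈ Metric.closedBall (0 : Rn d) (l * s)
        · simp only [Set.indicator_of_mem hz]
          rw [← mul_assoc]
          have ha : 0 ≤ ‖z‖ / s := by positivity
          refine le_trans ?_ (mul_le_mul_left (hardy_inner θ hθ0 (‖z‖ / s) ha) (G z ^ r))
          rw [← lintegral_mul_const _ (by fun_prop), ← lintegral_indicator measurableSet_Icc,
            ← lintegral_indicator measurableSet_Ioc]
          refine lintegral_mono fun t => ?_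
          by_cases ht : t ∈ Set.Ioc (0 : ℝ) l
          · rw [Set.indicator_of_mem ht]
            by_cases hy : t⁻¹ • z ∈ Yc d s
            · have hn := Yc_norm hd hs hy
              rw [norm_smul, norm_inv, Real.norm_of_nonneg ht.1.le, inv_mul_eq_div] at hn
              have ht0 := ht.1
              have hin : t ∈ Set.Icc (‖z‖ / s) (2 * (‖z‖ / s)) := by
                rw [le_div_iff₀ ht0, div_le_iff₀ ht0] at hn
                constructor
                · rw [div_le_iff₀ hs]; linarith [hn.2]
                · rw [← mul_div_assoc, le_div_iff₀ hs]; linarith [hn.1]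
              rw [Set.indicator_of_mem hin]
              simp [hy]
            · simp [hy]
          · simp [ht]
        · have : ∀ t ∈ Set.Ioc (0 : ℝ) l, ENNReal.ofReal (t ^ (θ - 1)) *
              ((Yc d s).indicator 1 (t⁻¹ • z) * G z ^ r) = 0 := by
            intro t ht
            have hy : t⁻¹ • z ∉ Yc d s := by
              intro hy
              apply hz
              have hn := (Yc_norm hd hs hy).2
              rw [norm_smul, norm_inv, Real.norm_of_nonneg ht.1.le, inv_mul_eq_div,
                div_le_iff₀ ht.1] at hn
              rw [mem_closedBall_zero_iff]
              nlinarith [ht.2]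
            simp [hy]
          rw [setLIntegral_congr_fun measurableSet_Ioc this]
          simp
    _ = _ := by
        rw [lintegral_indicator Metric.isClosed_closedBall.measurableSet,
          lintegral_const_mul' _ _ ENNReal.ofReal_ne_top, mul_assoc]

lemma mem_openCube_add {n : ℕ} {x0 x h : Rn n} {a b : ℝ} (hx : x ∈ openCube x0 a)
    (hh : ∀ i, |h i| ≤ b) : x + h ∈ openCube x0 (a + b) := by
  intro i
  have h1 := hx i
  have h2 := hh i
  simp only [Pi.add_apply]
  rw [abs_lt] at *
  rw [abs_le] at h2
  constructor <;> linarith [h1.1, h1.2, h2.1, h2.2]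

lemma shift_cube {n : ℕ} (x0 : Rn n) (a b : ℝ) (h : Rn n) (hh : ∀ i, |h i| ≤ b)
    (F : Rn n → ℝ≥0∞) :
    ∫⁻ x in openCube x0 a, F (x + h) ≤ ∫⁻ x in openCube x0 (a + b), F x := by
  rw [← lintegral_indicator (measurableSet_openCube _ _),
    ← lintegral_indicator (measurableSet_openCube _ _),
    ← lintegral_add_right_eq_self ((openCube x0 (a + b)).indicator F) h]
  refine lintegral_mono fun x => ?_
  by_cases hx : x ∈ openCube x0 a
  · rw [Set.indicator_of_mem hx, Set.indicator_of_mem (mem_openCube_add hx hh)]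
  · simp [hx]

lemma hor0 {n : ℕ} (l : ℕ) (hl : 0 < l) (r : ℝ) (hr : 1 ≤ r) (x0 : Rn n) (s : ℝ) (hs : 0 < s)
    (h : Rn n) (hh : h ∈ openCube (0 : Rn n) (2 * s)) (G : Rn n → ℝ≥0∞) (hG : Measurable G) :
    ∫⁻ x in openCube x0 s, (∫⁻ t in Set.Ioc (0 : ℝ) l,
        ENNReal.ofReal (t ^ (l - 1)) * G (x + t • h)) ^ r ≤
      (ENNReal.ofReal ((l : ℝ) ^ (l - 1)) ^ r * (l : ℝ≥0∞) ^ r) *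
        ∫⁻ x in openCube x0 ((2 * l + 1) * s), G x ^ r := by
  have hr0 : 0 < r := by linarith
  set A := ENNReal.ofReal ((l : ℝ) ^ (l - 1)) with hA
  have hv : (volume.restrict (Set.Ioc (0 : ℝ) l)) Set.univ = l := by simp
  have hl0 : (l : ℝ≥0∞) ≠ 0 := by simpa using hl.ne'
  have step : ∀ x : Rn n, (∫⁻ t in Set.Ioc (0 : ℝ) l,
        ENNReal.ofReal (t ^ (l - 1)) * G (x + t • h)) ^ r ≤
      A ^ r * (l : ℝ≥0∞) ^ (r - 1) * ∫⁻ t in Set.Ioc (0 : ℝ) l, G (x + t • h) ^ r := by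
    intro x
    have hm : Measurable (fun t : ℝ => G (x + t • h)) := hG.comp (by fun_prop)
    have h1 : ∫⁻ t in Set.Ioc (0 : ℝ) l, ENNReal.ofReal (t ^ (l - 1)) * G (x + t • h) ≤
        A * ∫⁻ t in Set.Ioc (0 : ℝ) l, G (x + t • h) := by
      rw [← lintegral_const_mul' _ _ ENNReal.ofReal_ne_top]
      refine setLIntegral_mono' measurableSet_Ioc fun t ht => mul_le_mul_left ?_ _
      exact ENNReal.ofReal_le_ofReal (pow_le_pow_left₀ ht.1.le ht.2 _)
    refine (ENNReal.rpow_le_rpow h1 hr0.le).trans ?_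
    rw [ENNReal.mul_rpow_of_nonneg _ _ hr0.le, mul_assoc]
    refine mul_le_mul_right ?_ _
    have J := jensen_rpow (volume.restrict (Set.Ioc (0 : ℝ) l)) _ hm.aemeasurable r hr
    rwa [hv] at J
  have hc : A ^ r * (l : ℝ≥0∞) ^ (r - 1) ≠ ∞ :=
    ENNReal.mul_ne_top (ENNReal.rpow_ne_top_of_nonneg hr0.le ENNReal.ofReal_ne_top)
      (ENNReal.rpow_ne_top_of_nonneg (by linarith) (by simp))
  calc _ ≤ ∫⁻ x in openCube x0 s, A ^ r * (l : ℝ≥0∞) ^ (r - 1) *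
        ∫⁻ t in Set.Ioc (0 : ℝ) l, G (x + t • h) ^ r := lintegral_mono fun x => step x
    _ = A ^ r * (l : ℝ≥0∞) ^ (r - 1) * ∫⁻ t in Set.Ioc (0 : ℝ) l,
        ∫⁻ x in openCube x0 s, G (x + t • h) ^ r := by
        rw [lintegral_const_mul' _ _ hc]
        congr 1
        refine lintegral_lintegral_swap (Measurable.aemeasurable ?_)
        have : Measurable (fun q : Rn n × ℝ => G (q.1 + q.2 • h)) := hG.comp (by fun_prop)
        simp only [Function.uncurry_def]
        fun_prop
    _ ≤ A ^ r * (l : ℝ≥0∞) ^ (r - 1) * ∫⁻ t in Set.Ioc (0 : ℝ) l,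
        ∫⁻ x in openCube x0 ((2 * l + 1) * s), G x ^ r := by
        refine mul_le_mul_right (setLIntegral_mono' measurableSet_Ioc fun t ht => ?_) _
        have := shift_cube x0 s (2 * l * s) (t • h) (fun i => ?_) (fun x => G x ^ r)
        · rwa [show s + 2 * l * s = (2 * l + 1) * s by ring] at this
        · have h1 := hh i
          simp only [Pi.zero_apply, sub_zero] at h1
          rw [Pi.smul_apply, smul_eq_mul, abs_mul, abs_of_pos ht.1]
          have := ht.2
          have := ht.1
          have := abs_nonneg (h i)
          nlinarith
    _ = _ := by
        rw [lintegral_const, hv]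
        rw [show (l : ℝ≥0∞) ^ r = (l : ℝ≥0∞) ^ (r - 1) * l by
          conv_rhs => rw [← ENNReal.rpow_one (l : ℝ≥0∞), ← ENNReal.rpow_mul, one_mul]
          rw [← ENNReal.rpow_add _ _ hl0 (by simp)]; congr 1; ring]
        ring

lemma scaleY {d : ℕ} (hd : 0 < d) (l j : ℕ) (hj : 1 ≤ j) (hjl : j ≤ l) (s : ℝ) (hs : 0 < s)
    (θ : ℝ) (hθ : 0 < θ) (F : Rn d → ℝ≥0∞) :
    ∫⁻ y in Yc d s, F ((j : ℝ) • y) ≤ ENNReal.ofReal (2 ^ θ) *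
      ∫⁻ z in Metric.closedBall (0 : Rn d) (l * s), Wt θ s z * F z := by
  have hYm : MeasurableSet (Yc d s) := measurableSet_cubeAt _ _
  have hjr : (1 : ℝ) ≤ j := by exact_mod_cast hj
  have hjlr : (j : ℝ) ≤ l := by exact_mod_cast hjl
  have hj0 : (0 : ℝ) < j := by linarith
  rw [← lintegral_indicator hYm, ← lintegral_const_mul' _ _ ENNReal.ofReal_ne_top,
    ← lintegral_indicator Metric.isClosed_closedBall.measurableSet]
  set H : Rn d → ℝ≥0∞ := (Metric.closedBall (0 : Rn d) (l * s)).indicator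
    (fun z => ENNReal.ofReal (2 ^ θ) * (Wt θ s z * F z)) with hH
  calc _ ≤ ∫⁻ y, H ((j : ℝ) • y) := by
        refine lintegral_mono fun y => ?_
        by_cases hy : y ∈ Yc d s
        · have hn := Yc_norm hd hs hy
          have hmem : (j : ℝ) • y ∈ Metric.closedBall (0 : Rn d) (l * s) := by
            rw [mem_closedBall_zero_iff, norm_smul, Real.norm_of_nonneg hj0.le]
            nlinarith [norm_nonneg y]
          rw [Set.indicator_of_mem hy, hH, Set.indicator_of_mem hmem, ← mul_assoc]
          refine le_mul_of_one_le_left zero_le ?_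
          rw [Wt, ← ENNReal.ofReal_mul (by positivity), ENNReal.one_le_ofReal,
            ← Real.mul_rpow (by norm_num) (by positivity)]
          refine Real.one_le_rpow ?_ hθ.le
          rw [norm_smul, Real.norm_of_nonneg hj0.le, ← mul_div_assoc, le_div_iff₀ hs]
          nlinarith [norm_nonneg y]
        · simp [hy]
    _ = ENNReal.ofReal ((j : ℝ) ^ (-(d : ℝ))) * ∫⁻ z, H z := lintegral_comp_smul_pos _ _ hj0
    _ ≤ 1 * ∫⁻ z, H z := by
        refine mul_le_mul_left ?_ _
        rw [ENNReal.ofReal_le_one]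
        exact Real.rpow_le_one_of_one_le_of_nonpos hjr (by simp)
    _ = _ := one_mul _

/-- Weighted integral along a segment. -/
def segA {N : ℕ} (l : ℕ) (G : Rn N → ℝ≥0∞) (z v : Rn N) : ℝ≥0∞ :=
  ∫⁻ t in Set.Ioc (0 : ℝ) l, ENNReal.ofReal (t ^ (l - 1)) * G (z + t • v)

lemma segA_meas {N : ℕ} (l : ℕ) (G : Rn N → ℝ≥0∞) (hG : Measurable G) :
    Measurable (fun q : Rn N × Rn N => segA l G q.1 q.2) := by
  unfold segA
  refine Measurable.lintegral_prod_right' (f := fun q : (Rn N × Rn N) × ℝ =>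
    ENNReal.ofReal (q.2 ^ (l - 1)) * G (q.1.1 + q.2 • q.1.2)) ?_
  have : Measurable (fun q : (Rn N × Rn N) × ℝ => G (q.1.1 + q.2 • q.1.2)) := hG.comp (by fun_prop)
  fun_prop

lemma segA_meas_comp {β : Type*} [MeasurableSpace β] {N : ℕ} (l : ℕ) (G : Rn N → ℝ≥0∞)
    (hG : Measurable G) {a b : β → Rn N} (ha : Measurable a) (hb : Measurable b) :
    Measurable (fun q => segA l G (a q) (b q)) :=
  (segA_meas l G hG).comp (ha.prodMk hb)

lemma rpow_sum_le {ι : Type*} (S : Finset ι) (a : ι → ℝ≥0∞) (r : ℝ) (hr : 1 ≤ r) :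
    (∑ i ∈ S, a i) ^ r ≤ (S.card : ℝ≥0∞) ^ (r - 1) * ∑ i ∈ S, a i ^ r :=
  ENNReal.rpow_sum_le_const_mul_sum_rpow S a hr

lemma diffl_rec {N : ℕ} (l : ℕ) (u : Rn N → ℝ) (z v : Rn N) :
    u z = (-1) ^ l * (diffl l v u z -
      ∑ j ∈ Finset.range l, cof l (j + 1) * u (z + ((j + 1 : ℕ) : ℝ) • v)) := by
  rw [diffl_eq_cof, Finset.sum_range_succ']
  have : cof l 0 = (-1) ^ l := by simp [cof]
  rw [this]
  have h2 : ((-1 : ℝ) ^ l) * (-1) ^ l = 1 := by rw [← mul_pow]; simp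
  simp only [Nat.cast_zero, zero_smul, add_zero]
  linear_combination (-u z) * h2

lemma diffl_trace_rec {n d : ℕ} (l : ℕ) (u : Rn (n + d) → ℝ) (x h : Rn n) (y : Rn d) :
    diffl l h (fun x => u (Fin.append x 0)) x = (-1) ^ l *
      ((∑ i ∈ Finset.range (l + 1), cof l i *
          diffl l (Fin.append 0 y) u (Fin.append (x + (i : ℝ) • h) 0)) -
       ∑ j ∈ Finset.range l, cof l (j + 1) *
          diffl l (Fin.append h 0) u (Fin.append x (((j + 1 : ℕ) : ℝ) • y))) := by
  conv_lhs => rw [diffl_eq_cof]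
  have e : ∀ i : ℕ, u (Fin.append (x + (i : ℝ) • h) 0) = (-1) ^ l *
      (diffl l (Fin.append 0 y) u (Fin.append (x + (i : ℝ) • h) 0) -
      ∑ j ∈ Finset.range l, cof l (j + 1) *
        u (Fin.append (x + (i : ℝ) • h) (((j + 1 : ℕ) : ℝ) • y))) := by
    intro i
    conv_lhs => rw [diffl_rec l u _ (Fin.append 0 y)]
    simp only [append_add_smul, smul_zero, add_zero, zero_add]
  have e2 : ∀ j : ℕ, diffl l (Fin.append h 0) u (Fin.append x (((j + 1 : ℕ) : ℝ) • y)) =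
      ∑ i ∈ Finset.range (l + 1), cof l i *
        u (Fin.append (x + (i : ℝ) • h) (((j + 1 : ℕ) : ℝ) • y)) := by
    intro j
    rw [diffl_eq_cof]
    simp only [append_add_smul, smul_zero, add_zero]
  rw [Finset.sum_congr rfl (fun i _ => by rw [e i]), mul_sub, Finset.mul_sum, Finset.mul_sum]
  simp only [e2]
  simp only [Finset.mul_sum, mul_sub]
  rw [Finset.sum_sub_distrib]
  congr 1
  · refine Finset.sum_congr rfl fun i _ => by ring
  · rw [Finset.sum_comm]
    refine Finset.sum_congr rfl fun i _ => Finset.sum_congr rfl fun j _ => by ring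

lemma enorm_neg_one_pow (l : ℕ) : ‖((-1 : ℝ)) ^ l‖ₑ = 1 := by
  rw [enorm_pow]; simp

lemma enorm_le_ofReal_of {N : ℕ} {v : Rn N} {s : ℝ} (h : ‖v‖ ≤ s) : ‖v‖ₑ ≤ ENNReal.ofReal s := by
  rw [← ofReal_norm]; exact ENNReal.ofReal_le_ofReal h

lemma norm_openCube_le {n : ℕ} {h : Rn n} {s : ℝ} (hs : 0 < s) (hh : h ∈ openCube (0 : Rn n) s) :
    ‖h‖ ≤ s := by
  rw [pi_norm_le_iff_of_nonneg hs.le]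
  intro i
  have := hh i
  simp only [Pi.zero_apply, sub_zero] at this
  exact this.le

/-- Pointwise bound. -/
lemma diffl_trace_le {n d : ℕ} (hd : 0 < d) {u : Rn (n + d) → ℝ} (hu : ContDiff ℝ (⊤ : ℕ∞) u) (l : ℕ)
    (hl : 0 < l) (s : ℝ) (hs : 0 < s) (x h : Rn n) (hh : h ∈ openCube (0 : Rn n) (2 * s))
    (y : Rn d) (hy : y ∈ Yc d s) :
    ‖diffl l h (fun x => u (Fin.append x 0)) x‖ₑ ≤
      (cofS l * cofS l * 2 ^ l) * ENNReal.ofReal s ^ l *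
      ((∑ i ∈ Finset.range (l + 1), segA l (Gsum l (fun α => multiDeriv α u))
          (Fin.append (x + (i : ℝ) • h) 0) (Fin.append 0 y)) +
       ∑ j ∈ Finset.range l, segA l (Gsum l (fun α => multiDeriv α u))
          (Fin.append x (((j + 1 : ℕ) : ℝ) • y)) (Fin.append h 0)) := by
  set G := Gsum l (fun α => multiDeriv α u)
  rw [diffl_trace_rec l u x h y, enorm_mul, enorm_neg_one_pow, one_mul]
  refine (enorm_sub_le).trans ?_
  rw [mul_add]
  have two : (ENNReal.ofReal (2 * s)) ^ l = 2 ^ l * ENNReal.ofReal s ^ l := by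
    rw [ENNReal.ofReal_mul (by norm_num), mul_pow]; norm_num
  have hv : ‖(Fin.append (0 : Rn n) y : Rn (n + d))‖ₑ ^ l ≤ 2 ^ l * ENNReal.ofReal s ^ l := by
    rw [← two]
    refine pow_le_pow_left' (enorm_le_ofReal_of ?_) _
    rw [norm_append, norm_zero]
    have := (Yc_norm hd hs hy).2
    exact max_le (by linarith) (by linarith)
  have hw : ‖(Fin.append h (0 : Rn d) : Rn (n + d))‖ₑ ^ l ≤ 2 ^ l * ENNReal.ofReal s ^ l := by
    rw [← two]
    refine pow_le_pow_left' (enorm_le_ofReal_of ?_) _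
    rw [norm_append, norm_zero]
    exact max_le (norm_openCube_le (by linarith) hh) (by linarith)
  have key : ∀ j ∈ Finset.range (l + 1), ∀ z v : Rn (n + d),
      ‖v‖ₑ ^ l ≤ 2 ^ l * ENNReal.ofReal s ^ l →
      ‖cof l j * diffl l v u z‖ₑ ≤ (cofS l * cofS l * 2 ^ l) * ENNReal.ofReal s ^ l * segA l G z v := by
    intro j hj z v hv
    rw [enorm_mul]
    calc _ ≤ cofS l * (cofS l * (2 ^ l * ENNReal.ofReal s ^ l) * segA l G z v) :=
          mul_le_mul' (enorm_cof_le l j hj) ((diffl_le hu l hl z v).trans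
            (mul_le_mul' (mul_le_mul' le_rfl hv) le_rfl))
      _ = _ := by ring
  refine add_le_add ?_ ?_
  · rw [Finset.mul_sum]
    refine (enorm_sum_le _ _).trans (Finset.sum_le_sum fun i hi => key i hi _ _ hv)
  · rw [Finset.mul_sum]
    refine (enorm_sum_le _ _).trans (Finset.sum_le_sum fun i hi => key (i + 1) ?_ _ _ hw)
    simp at hi ⊢; omega

/-- The local integral dominating the differences of the trace. -/
def Jint {n d : ℕ} (l : ℕ) (r s : ℝ) (G : Rn (n + d) → ℝ≥0∞) (x0 : Rn n) : ℝ≥0∞ :=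
  ∫⁻ x in openCube x0 ((2 * l + 1) * s), ∫⁻ z in Metric.closedBall (0 : Rn d) (l * s),
    Wt (thE d l r) s z * G (Fin.append x z) ^ r

lemma segA_vert {n d : ℕ} (l : ℕ) (G : Rn (n + d) → ℝ≥0∞) (x : Rn n) (y0 y : Rn d) :
    segA l G (Fin.append x y0) (Fin.append 0 y) = ∫⁻ t in Set.Ioc (0 : ℝ) l,
      ENNReal.ofReal (t ^ (l - 1)) * (fun z => G (Fin.append x (y0 + z))) (t • y) := by
  simp only [segA, append_add_smul, smul_zero, add_zero]

lemma segA_hor {n d : ℕ} (l : ℕ) (G : Rn (n + d) → ℝ≥0∞) (x h : Rn n) (y : Rn d) :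
    segA l G (Fin.append x y) (Fin.append h 0) = ∫⁻ t in Set.Ioc (0 : ℝ) l,
      ENNReal.ofReal (t ^ (l - 1)) * (fun x => G (Fin.append x y)) (x + t • h) := by
  simp only [segA, append_add_smul, smul_zero, add_zero]

lemma meas_app {β : Type*} [MeasurableSpace β] {n d : ℕ} {a : β → Rn n} {b : β → Rn d}
    (ha : Measurable a) (hb : Measurable b) :
    Measurable (fun q => (Fin.append (a q) (b q) : Rn (n + d))) :=
  measurable_append.comp (ha.prodMk hb)

lemma M1 {n d : ℕ} (hd : 0 < d) (l : ℕ) (hl : 0 < l) (r : ℝ) (hr : 1 ≤ r) (hk : (d : ℝ) / r < l) :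
    ∃ C : ℝ≥0∞, C ≠ ∞ ∧ ∀ (s : ℝ), 0 < s → ∀ u : Rn (n + d) → ℝ, ContDiff ℝ (⊤ : ℕ∞) u →
      ∀ x0 : Rn n, ENNReal.ofReal (s / 2) ^ d *
      (∫⁻ h in openCube (0 : Rn n) (2 * s), ∫⁻ x in openCube x0 s,
        ‖diffl l h (fun x => u (Fin.append x 0)) x‖ₑ ^ r) ≤
        C * (ENNReal.ofReal s ^ l) ^ r * ENNReal.ofReal (4 * s) ^ n *
        Jint l r s (Gsum l (fun α => multiDeriv α u)) x0 := by
  have hr0 : 0 < r := by linarith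
  obtain ⟨C1, hC1, H1⟩ := vert0 hd l hl r hr hk
  set θ := thE d l r with hθ
  have hθ0 : 0 < θ := thE_pos hr hk
  set C2 : ℝ≥0∞ := ENNReal.ofReal ((l : ℝ) ^ (l - 1)) ^ r * (l : ℝ≥0∞) ^ r with hC2
  have hC2t : C2 ≠ ∞ := ENNReal.mul_ne_top (ENNReal.rpow_ne_top_of_nonneg hr0.le ENNReal.ofReal_ne_top)
      (ENNReal.rpow_ne_top_of_nonneg hr0.le (by simp))
  set K : ℝ≥0∞ := cofS l * cofS l * 2 ^ l with hK
  have hKt : K ≠ ∞ := ENNReal.mul_ne_top (ENNReal.mul_ne_top (cofS_ne_top l) (cofS_ne_top l)) (by simp)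
  set c0 : ℝ≥0∞ := 2 ^ (r - 1) * (((l + 1 : ℕ) : ℝ≥0∞) ^ (r - 1)) with hc0
  have hc0t : c0 ≠ ∞ := ENNReal.mul_ne_top (ENNReal.rpow_ne_top_of_nonneg (by linarith) (by simp))
      (ENNReal.rpow_ne_top_of_nonneg (by linarith) (by simp))
  set C3 : ℝ≥0∞ := ((l + 1 : ℕ) : ℝ≥0∞) * C1 + (l : ℝ≥0∞) * (C2 * ENNReal.ofReal (2 ^ θ)) with hC3
  have hC3t : C3 ≠ ∞ := by
    rw [hC3]
    exact ENNReal.add_ne_top.2 ⟨ENNReal.mul_ne_top (by simp) hC1,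
      ENNReal.mul_ne_top (by simp) (ENNReal.mul_ne_top hC2t ENNReal.ofReal_ne_top)⟩
  refine ⟨K ^ r * c0 * C3, ENNReal.mul_ne_top (ENNReal.mul_ne_top
    (ENNReal.rpow_ne_top_of_nonneg hr0.le hKt) hc0t) hC3t, ?_⟩
  intro s hs u hu x0
  set G := Gsum l (fun α => multiDeriv α u) with hGdef
  have hG : Measurable G := Gsum_smooth_meas hu l
  have hYm : MeasurableSet (Yc d s) := measurableSet_cubeAt _ _
  have hYv : volume (Yc d s) = ENNReal.ofReal (s / 2) ^ d := volume_cubeAt _ _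
  set P : ℝ≥0∞ := K ^ r * (ENNReal.ofReal s ^ l) ^ r * c0 with hP
  have hPt : P ≠ ∞ := ENNReal.mul_ne_top (ENNReal.mul_ne_top (ENNReal.rpow_ne_top_of_nonneg hr0.le hKt)
    (ENNReal.rpow_ne_top_of_nonneg hr0.le (by simp))) hc0t
  set A : ℕ → Rn n → Rn n → Rn d → ℝ≥0∞ := fun i h x y =>
    segA l G (Fin.append (x + (i : ℝ) • h) 0) (Fin.append 0 y) with hA
  set B : ℕ → Rn n → Rn n → Rn d → ℝ≥0∞ := fun j h x y =>
    segA l G (Fin.append x (((j + 1 : ℕ) : ℝ) • y)) (Fin.append h 0) with hB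
  have hAm : ∀ i h, Measurable (fun q : Rn n × Rn d => A i h q.1 q.2) := fun i h =>
    segA_meas_comp l G hG (meas_app (by fun_prop) (by fun_prop)) (meas_app (by fun_prop) (by fun_prop))
  have hBm : ∀ j h, Measurable (fun q : Rn n × Rn d => B j h q.1 q.2) := fun j h =>
    segA_meas_comp l G hG (meas_app (by fun_prop) (by fun_prop)) (meas_app (by fun_prop) (by fun_prop))
  have pw : ∀ h ∈ openCube (0 : Rn n) (2 * s), ∀ x, ∀ y ∈ Yc d s,
      ‖diffl l h (fun x => u (Fin.append x 0)) x‖ₑ ^ r ≤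
        P * ((∑ i ∈ Finset.range (l + 1), A i h x y ^ r) + ∑ j ∈ Finset.range l, B j h x y ^ r) := by
    intro h hh x y hy
    refine (ENNReal.rpow_le_rpow (diffl_trace_le hd hu l hl s hs x h hh y hy) hr0.le).trans ?_
    rw [ENNReal.mul_rpow_of_nonneg _ _ hr0.le, ENNReal.mul_rpow_of_nonneg _ _ hr0.le, hP, mul_assoc _ c0]
    refine mul_le_mul_right ?_ _
    refine (ENNReal.rpow_add_le_mul_rpow_add_rpow _ _ hr).trans ?_
    rw [hc0, mul_assoc]
    refine mul_le_mul_right ?_ _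
    rw [mul_add]
    refine add_le_add ?_ ?_
    · refine (rpow_sum_le _ _ r hr).trans ?_
      simp only [Finset.card_range]
      exact le_rfl
    · refine (rpow_sum_le _ _ r hr).trans ?_
      simp only [Finset.card_range]
      refine mul_le_mul_left (ENNReal.rpow_le_rpow (by simp) (by linarith)) _
  have bA : ∀ h ∈ openCube (0 : Rn n) (2 * s), ∀ i ∈ Finset.range (l + 1),
      ∫⁻ x in openCube x0 s, ∫⁻ y in Yc d s, A i h x y ^ r ≤ C1 * Jint l r s G x0 := by
    intro h hh i hi
    have hi' : (i : ℝ) ≤ l := by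
      have : i ≤ l := by simpa [Nat.lt_succ_iff] using hi
      exact_mod_cast this
    calc _ ≤ ∫⁻ x in openCube x0 s, C1 * (fun x => ∫⁻ z in Metric.closedBall (0 : Rn d) (l * s),
          Wt θ s z * G (Fin.append x z) ^ r) (x + (i : ℝ) • h) := by
          refine lintegral_mono fun x => ?_
          have := H1 s hs (fun z => G (Fin.append (x + (i : ℝ) • h) (0 + z)))
            (hG.comp (meas_app (by fun_prop) (by fun_prop)))
          simp only [hA, segA_vert]
          refine this.trans ?_
          simp only [zero_add]
          exact le_rfl
      _ = C1 * ∫⁻ x in openCube x0 s, (fun x => ∫⁻ z in Metric.closedBall (0 : Rn d) (l * s),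
          Wt θ s z * G (Fin.append x z) ^ r) (x + (i : ℝ) • h) := lintegral_const_mul' _ _ hC1
      _ ≤ _ := by
          refine mul_le_mul_right ?_ _
          refine (shift_cube x0 s (2 * l * s) ((i : ℝ) • h) (fun k => ?_) (fun x =>
            ∫⁻ z in Metric.closedBall (0 : Rn d) (l * s), Wt θ s z * G (Fin.append x z) ^ r)).trans ?_
          · have h1 := hh k
            simp only [Pi.zero_apply, sub_zero] at h1
            rw [Pi.smul_apply, smul_eq_mul, abs_mul, abs_of_nonneg (Nat.cast_nonneg i)]
            have := abs_nonneg (h k)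
            have h0 : (0 : ℝ) ≤ i := Nat.cast_nonneg i
            nlinarith
          · rw [show s + 2 * l * s = (2 * l + 1) * s by ring]
            exact le_rfl
  have bB : ∀ h ∈ openCube (0 : Rn n) (2 * s), ∀ j ∈ Finset.range l,
      ∫⁻ x in openCube x0 s, ∫⁻ y in Yc d s, B j h x y ^ r ≤
        (C2 * ENNReal.ofReal (2 ^ θ)) * Jint l r s G x0 := by
    intro h hh j hj
    have hjl : j + 1 ≤ l := by simpa using hj
    calc _ = ∫⁻ y in Yc d s, ∫⁻ x in openCube x0 s, B j h x y ^ r :=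
          lintegral_lintegral_swap ((hBm j h).pow_const r).aemeasurable
      _ ≤ ∫⁻ y in Yc d s, C2 * ∫⁻ x in openCube x0 ((2 * l + 1) * s),
            G (Fin.append x (((j + 1 : ℕ) : ℝ) • y)) ^ r := by
          refine lintegral_mono fun y => ?_
          have := hor0 l hl r hr x0 s hs h hh (fun x => G (Fin.append x (((j + 1 : ℕ) : ℝ) • y)))
            (hG.comp (meas_app (by fun_prop) (by fun_prop)))
          simp only [hB, segA_hor]
          exact this
      _ = C2 * ∫⁻ x in openCube x0 ((2 * l + 1) * s), ∫⁻ y in Yc d s,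
            G (Fin.append x (((j + 1 : ℕ) : ℝ) • y)) ^ r := by
          rw [lintegral_const_mul' _ _ hC2t]
          congr 1
          refine lintegral_lintegral_swap (Measurable.aemeasurable ?_)
          exact (hG.comp (meas_app (by fun_prop) (by fun_prop))).pow_const r
      _ ≤ C2 * ∫⁻ x in openCube x0 ((2 * l + 1) * s), ENNReal.ofReal (2 ^ θ) *
          ∫⁻ z in Metric.closedBall (0 : Rn d) (l * s), Wt θ s z * G (Fin.append x z) ^ r := by
          refine mul_le_mul_right (lintegral_mono fun x => ?_) _
          exact scaleY hd l (j + 1) (by omega) hjl s hs θ hθ0 (fun z => G (Fin.append x z) ^ r)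
      _ = _ := by
          rw [lintegral_const_mul' _ _ ENNReal.ofReal_ne_top, ← mul_assoc]; rfl
  have main : ∀ h ∈ openCube (0 : Rn n) (2 * s), volume (Yc d s) *
      ∫⁻ x in openCube x0 s, ‖diffl l h (fun x => u (Fin.append x 0)) x‖ₑ ^ r ≤
        P * (C3 * Jint l r s G x0) := by
    intro h hh
    calc _ = ∫⁻ x in openCube x0 s, ∫⁻ y in Yc d s,
          ‖diffl l h (fun x => u (Fin.append x 0)) x‖ₑ ^ r := by
          rw [mul_comm, ← lintegral_mul_const' _ _ (by rw [hYv]; simp)]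
          refine lintegral_congr fun x => ?_
          rw [setLIntegral_const]
      _ ≤ ∫⁻ x in openCube x0 s, ∫⁻ y in Yc d s, P * ((∑ i ∈ Finset.range (l + 1), A i h x y ^ r)
            + ∑ j ∈ Finset.range l, B j h x y ^ r) :=
          lintegral_mono fun x => setLIntegral_mono' hYm fun y hy => pw h hh x y hy
      _ = P * ∫⁻ x in openCube x0 s, ∫⁻ y in Yc d s, ((∑ i ∈ Finset.range (l + 1), A i h x y ^ r)
            + ∑ j ∈ Finset.range l, B j h x y ^ r) := by
          rw [← lintegral_const_mul' _ _ hPt]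
          refine lintegral_congr fun x => ?_
          rw [lintegral_const_mul' _ _ hPt]
      _ = P * ((∑ i ∈ Finset.range (l + 1), ∫⁻ x in openCube x0 s, ∫⁻ y in Yc d s, A i h x y ^ r)
            + ∑ j ∈ Finset.range l, ∫⁻ x in openCube x0 s, ∫⁻ y in Yc d s, B j h x y ^ r) := by
          congr 1
          have a1 : ∀ i x, Measurable (fun y => A i h x y ^ r) := fun i x =>
            ((hAm i h).comp measurable_prodMk_left).pow_const r
          have b1 : ∀ j x, Measurable (fun y => B j h x y ^ r) := fun j x =>
            ((hBm j h).comp measurable_prodMk_left).pow_const r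
          have a2 : ∀ i, Measurable (fun x => ∫⁻ y in Yc d s, A i h x y ^ r) := fun i =>
            Measurable.lintegral_prod_right' ((hAm i h).pow_const r)
          have b2 : ∀ j, Measurable (fun x => ∫⁻ y in Yc d s, B j h x y ^ r) := fun j =>
            Measurable.lintegral_prod_right' ((hBm j h).pow_const r)
          rw [← lintegral_finsetSum _ (fun i _ => a2 i), ← lintegral_finsetSum _ (fun j _ => b2 j),
            ← lintegral_add_left (Finset.measurable_fun_sum _ fun i _ => a2 i)]
          refine lintegral_congr fun x => ?_
          rw [lintegral_add_left (Finset.measurable_fun_sum _ fun i _ => a1 i x),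
            lintegral_finsetSum _ (fun i _ => a1 i x), lintegral_finsetSum _ (fun j _ => b1 j x)]
      _ ≤ P * ((∑ i ∈ Finset.range (l + 1), C1 * Jint l r s G x0)
            + ∑ j ∈ Finset.range l, (C2 * ENNReal.ofReal (2 ^ θ)) * Jint l r s G x0) := by
          refine mul_le_mul_right (add_le_add (Finset.sum_le_sum (bA h hh))
            (Finset.sum_le_sum (bB h hh))) _
      _ = _ := by
          simp only [Finset.sum_const, Finset.card_range, nsmul_eq_mul, hC3]
          ring
  rw [← hYv, ← lintegral_const_mul' _ _ (by rw [hYv]; simp)]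
  calc _ ≤ ∫⁻ h in openCube (0 : Rn n) (2 * s), P * (C3 * Jint l r s G x0) :=
        setLIntegral_mono' (measurableSet_openCube _ _) main
    _ = _ := by
        rw [setLIntegral_const, volume_openCube, hP, show 2 * (2 * s) = 4 * s by ring]
        ring

lemma M2 {n d : ℕ} (hd : 0 < d) (l : ℕ) (hl : 0 < l) (r : ℝ) (hr : 1 ≤ r) (hk : (d : ℝ) / r < l) :
    ∃ C : ℝ≥0∞, C ≠ ∞ ∧ ∀ u : Rn (n + d) → ℝ, ContDiff ℝ (⊤ : ℕ∞) u →
      ∀ (x : Rn n) (y0 : Rn d), ‖u (Fin.append x y0)‖ₑ ^ r ≤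
        C * ∫⁻ z in Metric.closedBall (0 : Rn d) l, (‖u (Fin.append x (y0 + z))‖ₑ ^ r +
          Gsum l (fun α => multiDeriv α u) (Fin.append x (y0 + z)) ^ r) := by
  have hr0 : 0 < r := by linarith
  obtain ⟨C1, hC1, H1⟩ := vert0 hd l hl r hr hk
  set θ := thE d l r with hθ
  have hθ0 : 0 < θ := thE_pos hr hk
  set K : ℝ≥0∞ := 1 + cofS l with hK
  have hKt : K ≠ ∞ := by simp [hK, cofS_ne_top]
  set c0 : ℝ≥0∞ := 2 ^ (r - 1) * (((l + 1 : ℕ) : ℝ≥0∞) ^ (r - 1)) with hc0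
  have hc0t : c0 ≠ ∞ := ENNReal.mul_ne_top (ENNReal.rpow_ne_top_of_nonneg (by linarith) (by simp))
      (ENNReal.rpow_ne_top_of_nonneg (by linarith) (by simp))
  set T : ℝ≥0∞ := ENNReal.ofReal ((l : ℝ) ^ θ) with hT
  set C3 : ℝ≥0∞ := (C1 + (l : ℝ≥0∞) * (ENNReal.ofReal (2 ^ θ))) * T with hC3
  have hC3t : C3 ≠ ∞ := ENNReal.mul_ne_top (ENNReal.add_ne_top.2 ⟨hC1,
      ENNReal.mul_ne_top (by simp) ENNReal.ofReal_ne_top⟩) ENNReal.ofReal_ne_top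
  have hYm : MeasurableSet (Yc d 1) := measurableSet_cubeAt _ _
  have hYv : volume (Yc d 1) = ENNReal.ofReal (1 / 2) ^ d := volume_cubeAt _ _
  have hv0 : volume (Yc d 1) ≠ 0 := by rw [hYv]; simp
  have hvt : volume (Yc d 1) ≠ ∞ := by rw [hYv]; simp
  refine ⟨(volume (Yc d 1))⁻¹ * (K ^ r * c0 * C3), ENNReal.mul_ne_top (ENNReal.inv_ne_top.2 hv0)
    (ENNReal.mul_ne_top (ENNReal.mul_ne_top (ENNReal.rpow_ne_top_of_nonneg hr0.le hKt) hc0t) hC3t), ?_⟩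
  intro u hu x y0
  set G := Gsum l (fun α => multiDeriv α u) with hGdef
  have hG : Measurable G := Gsum_smooth_meas hu l
  set A : Rn d → ℝ≥0∞ := fun y => segA l G (Fin.append x y0) (Fin.append 0 y) with hA
  set B : ℕ → Rn d → ℝ≥0∞ := fun j y => ‖u (Fin.append x (y0 + ((j + 1 : ℕ) : ℝ) • y))‖ₑ with hB
  have hAm : Measurable A := segA_meas_comp l G hG measurable_const (meas_app (by fun_prop) (by fun_prop))
  have hBm : ∀ j, Measurable (B j) := fun j =>
    (hu.continuous.measurable.comp (meas_app (by fun_prop) (by fun_prop))).enorm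
  set I := ∫⁻ z in Metric.closedBall (0 : Rn d) l, (‖u (Fin.append x (y0 + z))‖ₑ ^ r +
          G (Fin.append x (y0 + z)) ^ r) with hI
  have WtT : ∀ z ∈ Metric.closedBall (0 : Rn d) (l * 1), Wt θ 1 z ≤ T := by
    intro z hz
    rw [mem_closedBall_zero_iff] at hz
    refine ENNReal.ofReal_le_ofReal (Real.rpow_le_rpow (by positivity) (by simpa using hz) hθ0.le)
  have red : ∀ F : Rn d → ℝ≥0∞, (∀ z, F z ≤ (‖u (Fin.append x (y0 + z))‖ₑ ^ r +
          G (Fin.append x (y0 + z)) ^ r)) →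
      ∫⁻ z in Metric.closedBall (0 : Rn d) (l * 1), Wt θ 1 z * F z ≤ T * I := by
    intro F hF
    rw [hI, ← lintegral_const_mul' _ _ ENNReal.ofReal_ne_top]
    rw [mul_one] at WtT ⊢
    exact setLIntegral_mono' Metric.isClosed_closedBall.measurableSet
      fun z hz => mul_le_mul' (WtT z hz) (hF z)
  have bA : ∫⁻ y in Yc d 1, A y ^ r ≤ C1 * (T * I) := by
    have := H1 1 one_pos (fun z => G (Fin.append x (y0 + z)))
            (hG.comp (meas_app (by fun_prop) (by fun_prop)))
    simp only [hA, segA_vert]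
    exact this.trans (mul_le_mul_right (red _ fun z => le_add_self) _)
  have bB : ∀ j ∈ Finset.range l, ∫⁻ y in Yc d 1, B j y ^ r ≤ ENNReal.ofReal (2 ^ θ) * (T * I) := by
    intro j hj
    have hjl : j + 1 ≤ l := by simpa using hj
    have := scaleY hd l (j + 1) (by omega) hjl 1 one_pos θ hθ0
      (fun z => ‖u (Fin.append x (y0 + z))‖ₑ ^ r)
    exact this.trans (mul_le_mul_right (red _ fun z => le_self_add) _)
  have pw : ∀ y ∈ Yc d 1, ‖u (Fin.append x y0)‖ₑ ^ r ≤ K ^ r * c0 *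
      (A y ^ r + ∑ j ∈ Finset.range l, B j y ^ r) := by
    intro y hy
    have h1 : ‖u (Fin.append x y0)‖ₑ ≤ K * (A y + ∑ j ∈ Finset.range l, B j y) := by
      rw [diffl_rec l u (Fin.append x y0) (Fin.append 0 y), enorm_mul, enorm_neg_one_pow, one_mul]
      refine (enorm_sub_le).trans ?_
      rw [mul_add]
      refine add_le_add ?_ ?_
      · refine (diffl_le hu l hl _ _).trans (mul_le_mul_left ?_ _)
        have : ‖(Fin.append (0 : Rn n) y : Rn (n + d))‖ₑ ^ l ≤ 1 := by
          refine pow_le_one' ?_ _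
          have := enorm_le_ofReal_of (v := (Fin.append (0 : Rn n) y : Rn (n + d))) (s := 1) (by
            rw [norm_append, norm_zero]
            exact max_le zero_le_one (Yc_norm hd one_pos hy).2)
          simpa using this
        calc _ ≤ cofS l * 1 := mul_le_mul_right this _
          _ ≤ K := by rw [mul_one, hK]; exact le_add_self
      · refine (enorm_sum_le _ _).trans ?_
        rw [Finset.mul_sum]
        refine Finset.sum_le_sum fun j hj => ?_
        rw [enorm_mul]
        simp only [append_add_smul, smul_zero, add_zero]
        refine mul_le_mul_left ((enorm_cof_le l (j + 1) ?_).trans ?_) _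
        · simp at hj ⊢; omega
        · rw [hK]; exact le_add_self
    refine (ENNReal.rpow_le_rpow h1 hr0.le).trans ?_
    rw [ENNReal.mul_rpow_of_nonneg _ _ hr0.le, mul_assoc]
    refine mul_le_mul_right ?_ _
    refine (ENNReal.rpow_add_le_mul_rpow_add_rpow _ _ hr).trans ?_
    rw [hc0, mul_assoc]
    refine mul_le_mul_right ?_ _
    rw [mul_add]
    refine add_le_add ?_ ?_
    · refine le_mul_of_one_le_left zero_le ?_
      have h1l : (1 : ℝ≥0∞) ≤ ((l + 1 : ℕ) : ℝ≥0∞) := by simp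
      simpa using ENNReal.rpow_le_rpow h1l (show 0 ≤ r - 1 by linarith)
    · refine (rpow_sum_le _ _ r hr).trans ?_
      simp only [Finset.card_range]
      refine mul_le_mul_left (ENNReal.rpow_le_rpow (by simp) (by linarith)) _
  have main : volume (Yc d 1) * ‖u (Fin.append x y0)‖ₑ ^ r ≤ K ^ r * c0 * C3 * I := by
    calc _ = ∫⁻ y in Yc d 1, ‖u (Fin.append x y0)‖ₑ ^ r := by rw [setLIntegral_const, mul_comm]
      _ ≤ ∫⁻ y in Yc d 1, K ^ r * c0 * (A y ^ r + ∑ j ∈ Finset.range l, B j y ^ r) :=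
        setLIntegral_mono' hYm pw
      _ = K ^ r * c0 * ((∫⁻ y in Yc d 1, A y ^ r) + ∑ j ∈ Finset.range l, ∫⁻ y in Yc d 1, B j y ^ r) := by
        rw [lintegral_const_mul' _ _ (ENNReal.mul_ne_top (ENNReal.rpow_ne_top_of_nonneg hr0.le hKt) hc0t),
          lintegral_add_left (hAm.pow_const r), lintegral_finsetSum _ (fun j _ => (hBm j).pow_const r)]
      _ ≤ K ^ r * c0 * (C1 * (T * I) + ∑ j ∈ Finset.range l, ENNReal.ofReal (2 ^ θ) * (T * I)) :=
        mul_le_mul_right (add_le_add bA (Finset.sum_le_sum bB)) _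
      _ = _ := by
        simp only [Finset.sum_const, Finset.card_range, nsmul_eq_mul, hC3]
        ring
  calc _ = (volume (Yc d 1))⁻¹ * (volume (Yc d 1) * ‖u (Fin.append x y0)‖ₑ ^ r) := by
        rw [← mul_assoc, ENNReal.inv_mul_cancel hv0 hvt, one_mul]
    _ ≤ _ := by
        rw [mul_assoc]
        exact mul_le_mul_right main _

lemma rpow_one_div_le' {a b : ℝ≥0∞} {q : ℝ} (hq : 0 < q) : a ^ (1 / q) ≤ b ↔ a ≤ b ^ q := by
  rw [one_div, ← ENNReal.rpow_le_rpow_iff hq, ← ENNReal.rpow_mul, inv_mul_cancel₀ hq.ne', ENNReal.rpow_one]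

/-- Convolution of `f` with a kernel. -/
def cv {N : ℕ} (f η : Rn N → ℝ) : Rn N → ℝ :=
  convolution f η (ContinuousLinearMap.mul ℝ ℝ) volume

lemma cv_apply {N : ℕ} (f η : Rn N → ℝ) (z : Rn N) : cv f η z = ∫ t, f t * η (z - t) := rfl

lemma iterPD_compact {N : ℕ} (L : List (Fin N)) {η : Rn N → ℝ} (hc : HasCompactSupport η) :
    HasCompactSupport (iterPD L η) := by
  induction L with
  | nil => exact hc
  | cons i L ih => exact ih.fderiv_apply ℝ _

lemma cv_smooth {N : ℕ} {f η : Rn N → ℝ} (hf : LocallyIntegrable f volume)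
    (hη : ContDiff ℝ (⊤ : ℕ∞) η) (hc : HasCompactSupport η) : ContDiff ℝ (⊤ : ℕ∞) (cv f η) :=
  hc.contDiff_convolution_right _ hf hη

lemma partialDeriv_cv {N : ℕ} (i : Fin N) {f η : Rn N → ℝ} (hf : LocallyIntegrable f volume)
    (hη : ContDiff ℝ (⊤ : ℕ∞) η) (hc : HasCompactSupport η) :
    partialDeriv i (cv f η) = cv f (partialDeriv i η) := by
  funext z
  have h1 : ContDiff ℝ 1 η := hη.of_le (by exact_mod_cast le_top)
  have h := hc.hasFDerivAt_convolution_right (ContinuousLinearMap.mul ℝ ℝ) hf h1 z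
  unfold partialDeriv cv
  rw [h.fderiv, convolution_precompR_apply _ hf (hc.fderiv ℝ) (h1.continuous_fderiv one_ne_zero)]

lemma iterPD_cv {N : ℕ} (L : List (Fin N)) {f η : Rn N → ℝ} (hf : LocallyIntegrable f volume)
    (hη : ContDiff ℝ (⊤ : ℕ∞) η) (hc : HasCompactSupport η) :
    iterPD L (cv f η) = cv f (iterPD L η) := by
  induction L with
  | nil => rfl
  | cons i L ih =>
    simp only [iterPD]
    rw [ih, partialDeriv_cv i hf (iterPD_smooth L hη) (iterPD_compact L hc)]

lemma iterPD_refl {N : ℕ} (L : List (Fin N)) {η : Rn N → ℝ} (hη : ContDiff ℝ (⊤ : ℕ∞) η) (z : Rn N) :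
    iterPD L (fun t => η (z - t)) = fun t => (-1) ^ L.length * iterPD L η (z - t) := by
  induction L with
  | nil => simp [iterPD]
  | cons i L ih =>
    simp only [iterPD]
    rw [ih]
    funext t
    unfold partialDeriv
    have hd : HasFDerivAt (iterPD L η) (fderiv ℝ (iterPD L η) (z - t)) (z - t) :=
      ((iterPD_smooth L hη).differentiable (by simp)).differentiableAt.hasFDerivAt
    have h2 : HasFDerivAt (fun t : Rn N => z - t) (-ContinuousLinearMap.id ℝ (Rn N)) t :=
      (hasFDerivAt_id t).const_sub z
    have h3 := (hd.comp t h2).const_mul ((-1 : ℝ) ^ L.length)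
    have h4 : fderiv ℝ (fun t => (-1 : ℝ) ^ L.length * iterPD L η (z - t)) t = _ := h3.fderiv
    rw [h4]
    simp [pow_succ]

lemma length_multiIdxList {N : ℕ} (α : Fin N → ℕ) : (multiIdxList α).length = ∑ i, α i := by
  unfold multiIdxList
  rw [← List.sum_ofFn, List.ofFn_eq_map]
  induction (List.finRange N) with
  | nil => rfl
  | cons i L ih =>
    rw [List.foldr_cons, List.length_append, List.length_replicate, ih, List.map_cons, List.sum_cons]

lemma multiDeriv_cv {N : ℕ} (α : Fin N → ℕ) {f g η : Rn N → ℝ} (hf : LocallyIntegrable f volume)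
    (hw : IsWeakDeriv α f g) (hη : ContDiff ℝ (⊤ : ℕ∞) η) (hc : HasCompactSupport η) :
    multiDeriv α (cv f η) = cv g η := by
  funext z
  rw [multiDeriv, iterPD_cv _ hf hη hc, cv_apply, cv_apply]
  have h := hw (fun t => η (z - t)) (hη.comp (contDiff_const.sub contDiff_id))
    (hc.comp_homeomorph (Homeomorph.subLeft z))
  rw [multiDeriv, iterPD_refl _ hη, length_multiIdxList] at h
  have e : ∫ x, f x * ((-1) ^ (∑ i, α i) * iterPD (multiIdxList α) η (z - x)) =
      (-1) ^ (∑ i, α i) * ∫ x, f x * iterPD (multiIdxList α) η (z - x) := by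
    rw [← integral_const_mul]
    congr 1; funext x; ring
  rw [e] at h
  exact mul_left_cancel₀ (pow_ne_zero _ (by norm_num)) h

lemma transl_cont {N : ℕ} (r : ℝ≥0∞) (hr1 : 1 ≤ r) (hrt : r ≠ ∞) (g : Rn N → ℝ)
    (hg : MemLp g r volume) :
    Tendsto (fun t : Rn N => eLpNorm (fun z => g (z - t) - g z) r volume) (nhds 0) (nhds 0) := by
  have : Fact (1 ≤ r) := ⟨hr1⟩
  have : Fact (r ≠ ∞) := ⟨hrt⟩
  have hcont : Continuous (fun t : Rn N => DomAddAct.mk (-t) +ᵥ hg.toLp g) := by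
    have h1 : Continuous (fun t : Rn N => DomAddAct.mk (-t)) :=
      DomAddAct.mkHomeomorph.continuous.comp continuous_neg
    exact h1.vadd continuous_const
  have h2 := (hcont.tendsto 0).edist (tendsto_const_nhds (x := hg.toLp g))
  have e : ∀ t : Rn N, edist (DomAddAct.mk (-t) +ᵥ hg.toLp g) (hg.toLp g) =
      eLpNorm (fun z => g (z - t) - g z) r volume := by
    intro t
    rw [DomAddAct.mk_vadd_toLp, Lp.edist_toLp_toLp]
    congr 1
    funext z
    simp [sub_eq_neg_add]
  simp only [e] at h2
  convert h2 using 2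
  simp

/-- `L_r` convergence of mollifications. -/
lemma moll_Lp {N : ℕ} (r : ℝ≥0∞) (hr1 : 1 ≤ r) (hrt : r ≠ ∞) (g : Rn N → ℝ)
    (hg : MemLp g r volume) (δ : ℝ≥0∞) (hδ : 0 < δ) :
    ∃ ε : ℝ, 0 < ε ∧ ∀ η : ContDiffBump (0 : Rn N), η.rOut ≤ ε →
      eLpNorm (fun z => cv g (η.normed volume) z - g z) r volume ≤ δ := by
  have hr0 : 0 < r.toReal := ENNReal.toReal_pos (by positivity) hrt
  have hrr : 1 ≤ r.toReal := by
    rw [← ENNReal.toReal_one]; exact ENNReal.toReal_mono hrt hr1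
  have ht := transl_cont r hr1 hrt g hg
  obtain ⟨ε, hε, H⟩ := Metric.eventually_nhds_iff.1 (ht.eventually_le_const hδ)
  refine ⟨ε, hε, fun η hη => ?_⟩
  set k := η.normed (volume : Measure (Rn N)) with hk
  have hkc : Continuous k := η.continuous_normed
  have hk0 : ∀ t, 0 ≤ k t := η.nonneg_normed
  have hkcs : HasCompactSupport k := η.hasCompactSupport_normed
  have hki : Integrable k := hkc.integrable_of_hasCompactSupport hkcs
  have hk1 : ∫ t, k t = 1 := η.integral_normed
  have hkl : ∫⁻ t, ‖k t‖ₑ = 1 := by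
    have := ofReal_integral_eq_lintegral_ofReal hki (ae_of_all _ hk0)
    rw [hk1, ENNReal.ofReal_one] at this
    rw [this]
    exact lintegral_congr fun t => Real.enorm_of_nonneg (hk0 t)
  have hgl : LocallyIntegrable g volume := hg.locallyIntegrable hr1
  have rw1 : ∀ z, cv g k z - g z = ∫ t, k t * (g (z - t) - g z) := by
    intro z
    have hi1 : Integrable (fun t => k t * g (z - t)) := by
      have h := hkcs.convolutionExists_right (ContinuousLinearMap.mul ℝ ℝ) hgl hkc z
      have h' : Integrable (fun t => g t * k (z - t)) := h
      have := h'.comp_sub_left z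
      simp only [_root_.sub_sub_cancel] at this
      simpa only [mul_comm] using this
    have e1 : cv g k z = ∫ t, k t * g (z - t) := by
      rw [cv_apply, ← integral_sub_left_eq_self _ volume z]
      simp only [_root_.sub_sub_cancel]
      simp only [mul_comm]
    have e2 : g z = ∫ t, k t * g z := by rw [integral_mul_const, hk1, one_mul]
    rw [e1]
    conv_lhs => rw [e2]
    rw [← integral_sub hi1 (hki.mul_const _)]
    congr 1; funext t; ring
  have hkm : Measurable (fun t => ‖k t‖ₑ) := hkc.measurable.enorm
  have hpm : AEMeasurable (fun q : Rn N × Rn N => ‖g (q.1 - q.2) - g q.1‖ₑ) (volume.prod volume) := by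
    refine AEMeasurable.enorm (AEMeasurable.sub ?_ ?_)
    · exact hg.1.aemeasurable.comp_quasiMeasurePreserving (quasiMeasurePreserving_sub volume volume)
    · exact hg.1.aemeasurable.comp_quasiMeasurePreserving Measure.quasiMeasurePreserving_fst
  have pw : ∀ z, ‖cv g k z - g z‖ₑ ^ r.toReal ≤ ∫⁻ t, ‖k t‖ₑ * ‖g (z - t) - g z‖ₑ ^ r.toReal := by
    intro z
    have hm : AEMeasurable (fun t => ‖g (z - t) - g z‖ₑ) volume := by
      refine AEMeasurable.enorm (AEMeasurable.sub ?_ aemeasurable_const)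
      exact hg.1.aemeasurable.comp_quasiMeasurePreserving (quasiMeasurePreserving_sub_left volume z)
    have hj := jensen_rpow (volume.withDensity (fun t => ‖k t‖ₑ)) (fun t => ‖g (z - t) - g z‖ₑ)
      (hm.mono_ac (withDensity_absolutelyContinuous _ _)) r.toReal hrr
    rw [lintegral_withDensity_eq_lintegral_mul₀ hkm.aemeasurable hm,
      lintegral_withDensity_eq_lintegral_mul₀ hkm.aemeasurable (hm.pow_const _),
      withDensity_apply _ MeasurableSet.univ, Measure.restrict_univ, hkl] at hj
    simp only [ENNReal.one_rpow, one_mul, Pi.mul_apply] at hj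
    refine le_trans (ENNReal.rpow_le_rpow ?_ hr0.le) hj
    rw [rw1 z]
    refine (enorm_integral_le_lintegral_enorm _).trans (le_of_eq ?_)
    exact lintegral_congr fun t => enorm_mul _ _
  have pw2 : ∀ t, ‖k t‖ₑ * ∫⁻ z, ‖g (z - t) - g z‖ₑ ^ r.toReal ≤ ‖k t‖ₑ * δ ^ r.toReal := by
    intro t
    by_cases hkt : k t = 0
    · simp [hkt]
    refine mul_le_mul_right ?_ _
    have hts : t ∈ Function.support k := hkt
    rw [hk, ContDiffBump.support_normed_eq] at hts
    have := H (lt_of_lt_of_le (Metric.mem_ball.1 hts) hη)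
    rw [eLpNorm_eq_lintegral_rpow_enorm_toReal (by positivity) hrt,
      rpow_one_div_le' hr0] at this
    exact this
  rw [eLpNorm_eq_lintegral_rpow_enorm_toReal (by positivity) hrt, rpow_one_div_le' hr0]
  calc ∫⁻ z, ‖cv g k z - g z‖ₑ ^ r.toReal
      ≤ ∫⁻ z, ∫⁻ t, ‖k t‖ₑ * ‖g (z - t) - g z‖ₑ ^ r.toReal := lintegral_mono pw
    _ = ∫⁻ t, ∫⁻ z, ‖k t‖ₑ * ‖g (z - t) - g z‖ₑ ^ r.toReal := by
        apply lintegral_lintegral_swap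
        exact (hkm.comp measurable_snd).aemeasurable.mul (hpm.pow_const _)
    _ = ∫⁻ t, ‖k t‖ₑ * ∫⁻ z, ‖g (z - t) - g z‖ₑ ^ r.toReal := by
        refine lintegral_congr fun t => ?_
        exact lintegral_const_mul' _ _ enorm_ne_top
    _ ≤ ∫⁻ t, ‖k t‖ₑ * δ ^ r.toReal := lintegral_mono pw2
    _ = δ ^ r.toReal := by rw [lintegral_mul_const _ hkm, hkl, one_mul]

/-- Local approximation by smooth functions of a function and finitely many weak derivatives. -/
lemma moll_local {N : ℕ} (r : ℝ≥0∞) (hr1 : 1 ≤ r) (hrt : r ≠ ∞) (f : Rn N → ℝ)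
    (D : (Fin N → ℕ) → Rn N → ℝ) (A : Finset (Fin N → ℕ)) (hf : LocallyIntegrable f volume)
    (hD : ∀ α ∈ A, LocallyIntegrable (D α) volume ∧ IsWeakDeriv α f (D α) ∧
      ∀ R : ℝ, eLpNorm (D α) r (volume.restrict (Metric.ball 0 R)) < ∞)
    (R : ℝ) (δ : ℝ≥0∞) (hδ : 0 < δ) :
    ∃ u : Rn N → ℝ, ContDiff ℝ (⊤ : ℕ∞) u ∧ ∀ α ∈ A,
      eLpNorm (fun z => multiDeriv α u z - D α z) r (volume.restrict (Metric.ball 0 R)) ≤ δ := by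
  have key : ∀ α ∈ A, ∃ ε : ℝ, 0 < ε ∧ ∀ η : ContDiffBump (0 : Rn N), η.rOut ≤ ε →
      eLpNorm (fun z => cv (D α) (η.normed volume) z - D α z) r
        (volume.restrict (Metric.ball 0 R)) ≤ δ := by
    intro α hα
    obtain ⟨h1, -, h3⟩ := hD α hα
    set g := (Metric.ball (0 : Rn N) (R + 1)).indicator (D α) with hg
    have hgm : MemLp g r volume := by
      rw [hg, memLp_indicator_iff_restrict measurableSet_ball]
      exact ⟨h1.aestronglyMeasurable.restrict, h3 _⟩
    obtain ⟨ε, hε, H⟩ := moll_Lp r hr1 hrt g hgm δ hδ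
    refine ⟨min ε 1, by positivity, fun η hη => ?_⟩
    refine le_trans (le_of_eq ?_) ((eLpNorm_restrict_le _ _ _ (Metric.ball 0 R)).trans
      (H η (hη.trans (min_le_left _ _))))
    refine eLpNorm_congr_ae ?_
    filter_upwards [ae_restrict_mem measurableSet_ball] with z hz
    have hz' : ‖z‖ < R := by simpa using hz
    have e1 : g z = D α z := Set.indicator_of_mem (by simp; linarith) _
    have e2 : cv (D α) (η.normed volume) z = cv g (η.normed volume) z := by
      rw [cv_apply, cv_apply]
      congr 1
      funext t
      by_cases ht : ‖t‖ < R + 1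
      · rw [hg, Set.indicator_of_mem (by simpa using ht)]
      · have : η.normed volume (z - t) = 0 := by
          have : z - t ∉ Function.support (η.normed volume) := by
            rw [ContDiffBump.support_normed_eq]
            intro h
            have h1 : ‖z - t‖ < η.rOut := by simpa using h
            have h2 := hη.trans (min_le_right _ _)
            have h3 : ‖t‖ ≤ ‖z‖ + ‖z - t‖ := by
              have := norm_sub_le z (z - t)
              rwa [_root_.sub_sub_cancel] at this
            linarith
          simpa using this
        rw [this, mul_zero, mul_zero]
    rw [e1, e2]
  choose! ε hε H using key
  obtain ⟨e, he, hle⟩ : ∃ e : ℝ, 0 < e ∧ ∀ α ∈ A, e ≤ ε α := by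
    rcases A.eq_empty_or_nonempty with h | h
    · exact ⟨1, one_pos, by simp [h]⟩
    · obtain ⟨a, ha, h⟩ := A.exists_min_image ε h
      exact ⟨ε a, hε a ha, h⟩
  let η : ContDiffBump (0 : Rn N) := ⟨e / 2, e, by linarith, by linarith⟩
  refine ⟨cv f (η.normed volume), cv_smooth hf η.contDiff_normed η.hasCompactSupport_normed, fun α hα => ?_⟩
  rw [multiDeriv_cv α hf (hD α hα).2.1 η.contDiff_normed η.hasCompactSupport_normed]
  exact H α hα η (hle α hα)

/-- Weighted averaging property on cubes of side at most `L`. -/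
def WP (N : ℕ) (w : Rn N → ℝ≥0∞) (q L : ℝ) (C : ℝ≥0∞) : Prop :=
  ∀ (c : Rn N) (s : ℝ), 0 < s → s ≤ L → ∀ g : Rn N → ℝ≥0∞, AEMeasurable g volume →
    (∫⁻ x in cubeAt c s, w x) * (∫⁻ x in cubeAt c s, g x) ^ q ≤
      C * volume (cubeAt c s) ^ q * ∫⁻ x in cubeAt c s, g x ^ q * w x

lemma volume_cubeAt_pos {N : ℕ} (c : Rn N) {s : ℝ} (hs : 0 < s) : volume (cubeAt c s) ≠ 0 := by
  rw [volume_cubeAt]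
  exact pow_ne_zero _ (by simpa using hs)

lemma volume_cubeAt_ne_top {N : ℕ} (c : Rn N) (s : ℝ) : volume (cubeAt c s) ≠ ∞ := by
  rw [volume_cubeAt]
  exact ENNReal.pow_ne_top ENNReal.ofReal_ne_top

lemma WP_base {N : ℕ} {q : ℝ} (hq : 1 < q) {w : Rn N → ℝ} (hwm : Measurable w) (hw : ∀ x, 0 < w x)
    (hA : MemAlocGt N q w) : ∃ C : ℝ≥0∞, C ≠ ∞ ∧ WP N (fun x => ENNReal.ofReal (w x)) q 1 C := by
  obtain ⟨C, hC, H⟩ := hA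
  refine ⟨C, hC.ne, fun c s hs hs1 g hg => ?_⟩
  have hAp := H c s hs hs1
  set Q := cubeAt c s
  set V := volume Q
  have hV0 : V ≠ 0 := volume_cubeAt_pos c hs
  have hVt : V ≠ ∞ := volume_cubeAt_ne_top c s
  have hq0 : 0 < q := by linarith
  have hq1 : 0 < q - 1 := by linarith
  set W : Rn N → ℝ≥0∞ := fun x => ENNReal.ofReal (w x)
  have hWm : Measurable W := hwm.ennreal_ofReal
  have hW0 : ∀ x, W x ≠ 0 := fun x => by simpa [W] using hw x
  have hWt : ∀ x, W x ≠ ∞ := fun _ => ENNReal.ofReal_ne_top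
  set σ := ∫⁻ y in Q, W y ^ (-(1 : ℝ) / (q - 1))
  have hol := ENNReal.lintegral_mul_le_Lp_mul_Lq (volume.restrict Q)
    (Real.HolderConjugate.conjExponent hq) (f := fun x => g x * W x ^ (1 / q))
    (g := fun x => W x ^ (-(1 / q))) (hg.restrict.mul (hWm.pow_const _).aemeasurable)
    (hWm.pow_const _).aemeasurable
  have e1 : ∀ x, ((fun x => g x * W x ^ (1 / q)) * fun x => W x ^ (-(1 / q))) x = g x := by
    intro x
    simp only [Pi.mul_apply]
    rw [mul_assoc, ← ENNReal.rpow_add _ _ (hW0 x) (hWt x)]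
    simp
  have e2 : ∀ x, (g x * W x ^ (1 / q)) ^ q = g x ^ q * W x := by
    intro x
    rw [ENNReal.mul_rpow_of_nonneg _ _ hq0.le, ← ENNReal.rpow_mul, one_div_mul_cancel hq0.ne',
      ENNReal.rpow_one]
  have e3 : ∀ x, (W x ^ (-(1 / q))) ^ q.conjExponent = W x ^ (-(1 : ℝ) / (q - 1)) := by
    intro x
    rw [← ENNReal.rpow_mul, Real.conjExponent]
    congr 1
    field_simp
  simp only [e1, e2, e3] at hol
  have h2 := ENNReal.rpow_le_rpow hol hq0.le
  rw [ENNReal.mul_rpow_of_nonneg _ _ hq0.le, ← ENNReal.rpow_mul, one_div_mul_cancel hq0.ne',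
    ENNReal.rpow_one, ← ENNReal.rpow_mul] at h2
  have e4 : 1 / q.conjExponent * q = q - 1 := by
    rw [Real.conjExponent]; field_simp
  rw [e4] at h2
  have h3 : (∫⁻ x in Q, W x) * σ ^ (q - 1) ≤ C * V ^ q := by
    have e5 : V ^ q = V * V ^ (q - 1) := by
      conv_rhs => rw [← ENNReal.rpow_one V, ← ENNReal.rpow_mul, ← ENNReal.rpow_add _ _ hV0 hVt]
      congr 1; ring
    have e6 : (V * V ^ (q - 1)) * ((V⁻¹ * ∫⁻ x in Q, W x) * (V⁻¹ * σ) ^ (q - 1)) =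
        (∫⁻ x in Q, W x) * σ ^ (q - 1) := by
      rw [ENNReal.mul_rpow_of_nonneg _ _ hq1.le, ENNReal.inv_rpow]
      have a1 : V * V⁻¹ = 1 := ENNReal.mul_inv_cancel hV0 hVt
      have a2 : V ^ (q - 1) * (V ^ (q - 1))⁻¹ = 1 :=
        ENNReal.mul_inv_cancel (by simp [hV0, hVt]) (by simp [hV0, hVt])
      calc _ = (V * V⁻¹) * (V ^ (q - 1) * (V ^ (q - 1))⁻¹) * ((∫⁻ x in Q, W x) * σ ^ (q - 1)) := by ring
        _ = _ := by rw [a1, a2, one_mul, one_mul]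
    rw [← e6, e5, mul_comm C]
    exact mul_le_mul_right hAp _
  calc (∫⁻ x in Q, W x) * (∫⁻ x in Q, g x) ^ q
      ≤ (∫⁻ x in Q, W x) * ((∫⁻ x in Q, g x ^ q * W x) * σ ^ (q - 1)) := mul_le_mul_right h2 _
    _ = ((∫⁻ x in Q, W x) * σ ^ (q - 1)) * ∫⁻ x in Q, g x ^ q * W x := by ring
    _ ≤ _ := mul_le_mul_left h3 _

lemma cubeAt_sub {N : ℕ} {c c' : Rn N} {s s' : ℝ} (h : ∀ i, c i ≤ c' i ∧ c' i + s' ≤ c i + s) :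
    cubeAt c' s' ⊆ cubeAt c s := fun x hx i =>
  ⟨(h i).1.trans_lt (hx i).1, (hx i).2.trans_le (h i).2⟩

lemma WP_sub {N : ℕ} {q L : ℝ} (hq : 0 < q) {w : Rn N → ℝ≥0∞} {C : ℝ≥0∞} (H : WP N w q L C)
    (c : Rn N) (s : ℝ) (hs : 0 < s) (hsL : s ≤ L) (E : Set (Rn N)) (hE : MeasurableSet E)
    (hEs : E ⊆ cubeAt c s) :
    (∫⁻ x in cubeAt c s, w x) * volume E ^ q ≤ C * volume (cubeAt c s) ^ q * ∫⁻ x in E, w x := by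
  have h := H c s hs hsL (E.indicator 1) (measurable_one.indicator hE).aemeasurable
  rw [lintegral_indicator_one hE, Measure.restrict_apply hE, Set.inter_eq_left.2 hEs] at h
  refine h.trans (mul_le_mul_right ?_ _)
  rw [← lintegral_indicator hE]
  refine (setLIntegral_le_lintegral _ _).trans (lintegral_mono fun x => ?_)
  by_cases hx : x ∈ E
  · simp [hx]
  · simp [hx, hq]

lemma WP_step {N : ℕ} {q L : ℝ} (hq : 1 ≤ q) {w : Rn N → ℝ≥0∞} (hwm : Measurable w) {C : ℝ≥0∞}
    (hC : C ≠ ∞) (H : WP N w q L C) :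
    ∃ C' : ℝ≥0∞, C' ≠ ∞ ∧ WP N w q (3 / 2 * L) C' := by
  have hq0 : 0 < q := by linarith
  let M : ℝ≥0∞ := (Fintype.card (Fin N → Bool) : ℝ≥0∞)
  have hM : M ≠ ∞ := ENNReal.natCast_ne_top _
  refine ⟨M * (M ^ (q - 1) * (C * (2 ^ N) ^ q * (M * C))), ?_, fun c s hs hsL g hg => ?_⟩
  · have : M ^ (q - 1) ≠ ∞ := ENNReal.rpow_ne_top_of_nonneg (by linarith) hM
    have : ((2 : ℝ≥0∞) ^ N) ^ q ≠ ∞ := ENNReal.rpow_ne_top_of_nonneg hq0.le (by simp)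
    finiteness
  let cc : (Fin N → Bool) → Rn N := fun b i => if b i then c i + s / 3 else c i
  let Q : (Fin N → Bool) → Set (Rn N) := fun b => cubeAt (cc b) (2 * s / 3)
  let E : Set (Rn N) := cubeAt (fun i => c i + s / 3) (s / 3)
  set Q0 := cubeAt c s with hQ0
  have hQQ : ∀ b, Q b ⊆ Q0 := fun b => cubeAt_sub fun i => by
    simp only [cc]; split_ifs <;> constructor <;> linarith
  have hEQ : ∀ b, E ⊆ Q b := fun b => cubeAt_sub fun i => by
    simp only [cc]; split_ifs <;> constructor <;> linarith
  have hcov : Q0 ⊆ ⋃ b, Q b := by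
    intro x hx
    refine Set.mem_iUnion.2 ⟨fun i => decide (c i + 2 * s / 3 ≤ x i), fun i => ?_⟩
    have := hx i
    simp only [cc]
    split_ifs with h
    · simp only [decide_eq_true_eq] at h; constructor <;> linarith
    · simp only [decide_eq_true_eq, not_le] at h; constructor <;> linarith
  have hs2 : 0 < 2 * s / 3 := by linarith
  have hsL2 : 2 * s / 3 ≤ L := by linarith
  have hvE : ∀ b, volume (Q b) = 2 ^ N * volume E := by
    intro b
    simp only [Q, E, volume_cubeAt]
    rw [← mul_pow]
    congr 1
    rw [← ENNReal.ofReal_ofNat 2, ← ENNReal.ofReal_mul (by norm_num)]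
    congr 1; ring
  have hE0 : volume E ≠ 0 := volume_cubeAt_pos _ (by linarith)
  have hEt : volume E ≠ ∞ := volume_cubeAt_ne_top _ _
  have hQE : ∀ b, ∫⁻ x in Q b, w x ≤ C * (2 ^ N) ^ q * ∫⁻ x in E, w x := by
    intro b
    have h := WP_sub hq0 H (cc b) (2 * s / 3) hs2 hsL2 E (measurableSet_cubeAt _ _) (hEQ b)
    have hv := hvE b
    simp only [Q] at hv ⊢
    rw [hv, ENNReal.mul_rpow_of_nonneg _ _ hq0.le] at h
    have a0 : volume E ^ q ≠ 0 := by simp [hE0, hEt]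
    have at' : volume E ^ q ≠ ∞ := by simp [hE0, hEt]
    rw [← ENNReal.mul_le_mul_iff_left a0 at']
    refine h.trans (le_of_eq (by ring))
  have hij : ∀ b b', ∫⁻ x in Q b, w x ≤ C * (2 ^ N) ^ q * ∫⁻ x in Q b', w x := fun b b' =>
    (hQE b).trans (mul_le_mul_right (lintegral_mono_set (hEQ b')) _)
  have hsum : ∀ h : Rn N → ℝ≥0∞, ∫⁻ x in Q0, h x ≤ ∑ b, ∫⁻ x in Q b, h x := by
    intro h
    refine (lintegral_mono_set hcov).trans ((lintegral_iUnion_le _ _).trans (le_of_eq (tsum_fintype _)))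
  have hV : ∀ b, volume (Q b) ≤ volume Q0 := fun b => measure_mono (hQQ b)
  have hQ2 : ∀ b, (∫⁻ x in Q0, w x) ≤ M * (C * (2 ^ N) ^ q * ∫⁻ x in Q b, w x) := by
    intro b
    refine (hsum w).trans ((Finset.sum_le_sum fun b' _ => hij b' b).trans (le_of_eq ?_))
    simp [M]
  have hg2 : (∫⁻ x in Q0, g x) ^ q ≤ M ^ (q - 1) * ∑ b, (∫⁻ x in Q b, g x) ^ q := by
    refine (ENNReal.rpow_le_rpow (hsum g) hq0.le).trans ?_
    exact rpow_sum_le Finset.univ _ q hq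
  calc (∫⁻ x in Q0, w x) * (∫⁻ x in Q0, g x) ^ q
      ≤ (∫⁻ x in Q0, w x) * (M ^ (q - 1) * ∑ b, (∫⁻ x in Q b, g x) ^ q) := mul_le_mul_right hg2 _
    _ = M ^ (q - 1) * ∑ b, (∫⁻ x in Q0, w x) * (∫⁻ x in Q b, g x) ^ q := by
        rw [← Finset.mul_sum]; ring
    _ ≤ M ^ (q - 1) * ∑ b, (M * (C * (2 ^ N) ^ q * ∫⁻ x in Q b, w x)) * (∫⁻ x in Q b, g x) ^ q := by
        refine mul_le_mul_right (Finset.sum_le_sum fun b _ => mul_le_mul_left (hQ2 b) _) _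
    _ ≤ M ^ (q - 1) * ∑ b : Fin N → Bool, (M * (C * (2 ^ N) ^ q) * (C * volume Q0 ^ q * ∫⁻ x in Q0, g x ^ q * w x)) := by
        refine mul_le_mul_right (Finset.sum_le_sum fun b _ => ?_) _
        calc _ = M * (C * (2 ^ N) ^ q) * ((∫⁻ x in Q b, w x) * (∫⁻ x in Q b, g x) ^ q) := by ring
          _ ≤ _ := by
            refine mul_le_mul_right ((H (cc b) (2 * s / 3) hs2 hsL2 g hg).trans ?_) _
            refine mul_le_mul' (mul_le_mul_right (ENNReal.rpow_le_rpow (hV b) hq0.le) _)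
              (lintegral_mono_set (hQQ b))
    _ = _ := by
        rw [Finset.sum_const, Finset.card_univ, nsmul_eq_mul]
        ring

lemma WP_mono {N : ℕ} {q L L' : ℝ} {w : Rn N → ℝ≥0∞} {C : ℝ≥0∞} (H : WP N w q L C) (h : L' ≤ L) :
    WP N w q L' C := fun c s hs hsL => H c s hs (hsL.trans h)

lemma WP_all {N : ℕ} {q : ℝ} (hq : 1 < q) {w : Rn N → ℝ} (hwm : Measurable w) (hw : ∀ x, 0 < w x)
    (hA : MemAlocGt N q w) (L : ℝ) :
    ∃ C : ℝ≥0∞, C ≠ ∞ ∧ WP N (fun x => ENNReal.ofReal (w x)) q L C := by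
  have h : ∀ j : ℕ, ∃ C : ℝ≥0∞, C ≠ ∞ ∧ WP N (fun x => ENNReal.ofReal (w x)) q ((3 / 2) ^ j) C := by
    intro j
    induction j with
    | zero => simpa using WP_base hq hwm hw hA
    | succ j ih =>
      obtain ⟨C, hC, H⟩ := ih
      rw [pow_succ, mul_comm]
      exact WP_step hq.le hwm.ennreal_ofReal hC H
  obtain ⟨j, hj⟩ := pow_unbounded_of_one_lt L (by norm_num : (1 : ℝ) < 3 / 2)
  obtain ⟨C, hC, H⟩ := h j
  exact ⟨C, hC, WP_mono H hj.le⟩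

lemma iterPD_sub {N : ℕ} (L : List (Fin N)) {u v : Rn N → ℝ} (hu : ContDiff ℝ (⊤ : ℕ∞) u)
    (hv : ContDiff ℝ (⊤ : ℕ∞) v) :
    iterPD L (fun z => u z - v z) = fun z => iterPD L u z - iterPD L v z := by
  induction L with
  | nil => rfl
  | cons i L ih =>
    simp only [iterPD]
    rw [ih]
    funext z
    unfold partialDeriv
    have h1 := ((iterPD_smooth L hu).differentiable (by simp)).differentiableAt (x := z)
    have h2 := ((iterPD_smooth L hv).differentiable (by simp)).differentiableAt (x := z)
    rw [fderiv_fun_sub h1 h2]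
    rfl

/-- The relevant multi-indices: zero and all those of order `l`. -/
def ix {N : ℕ} (l : ℕ) : Option (Fin l → Fin N) → (Fin N → ℕ)
  | none => 0
  | some L => cntL L

lemma ix_sum {N l : ℕ} (o : Option (Fin l → Fin N)) : ∑ i, ix l o i ≤ l := by
  cases o with
  | none => simp [ix]
  | some L => exact (sum_cntL L).le

/-- Number of relevant multi-indices. -/
def cK (N l : ℕ) : ℝ≥0∞ := (Fintype.card (Option (Fin l → Fin N)) : ℝ≥0∞)

lemma cK_ne_top (N l : ℕ) : cK N l ≠ ∞ := ENNReal.natCast_ne_top _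

lemma card_le_cK (N l : ℕ) : ((Finset.univ : Finset (Fin l → Fin N)).card : ℝ≥0∞) ≤ cK N l := by
  unfold cK
  rw [Fintype.card_option, Finset.card_univ]
  exact_mod_cast Nat.le_succ _

lemma one_le_cK (N l : ℕ) : 1 ≤ cK N l := by
  unfold cK
  rw [Fintype.card_option]
  exact_mod_cast Nat.le_add_left _ _

/-- Sum over the relevant multi-indices dominates. -/
lemma ix_pow_le {N l : ℕ} (r : ℝ) (hr : 1 ≤ r) (D : (Fin N → ℕ) → Rn N → ℝ) (z : Rn N) :
    ‖D 0 z‖ₑ ^ r + Gsum l D z ^ r ≤ cK N l ^ (r - 1) * ∑ o, ‖D (ix l o) z‖ₑ ^ r := by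
  rw [Fintype.sum_option, mul_add]
  refine add_le_add ?_ ?_
  · refine le_mul_of_one_le_left' ?_
    have := ENNReal.rpow_le_rpow (one_le_cK N l) (by linarith : (0 : ℝ) ≤ r - 1)
    rwa [ENNReal.one_rpow] at this
  · refine (rpow_sum_le _ _ r hr).trans ?_
    exact mul_le_mul_left (ENNReal.rpow_le_rpow (card_le_cK N l) (by linarith)) _

lemma lint_app_le {n d : ℕ} (F : Rn (n + d) → ℝ≥0∞) (hF : AEMeasurable F volume) (S : Set (Rn n))
    (T : Set (Rn d)) (hS : MeasurableSet S) (hT : MeasurableSet T) (R : ℝ)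
    (hST : ∀ x ∈ S, ∀ y ∈ T, ‖x‖ < R ∧ ‖y‖ < R) :
    ∫⁻ x in S, ∫⁻ y in T, F (Fin.append x y) ≤ ∫⁻ z in Metric.ball 0 R, F z := by
  rw [← lintegral_indicator measurableSet_ball, lintegral_append _ (hF.indicator measurableSet_ball),
    ← lintegral_indicator hS]
  refine lintegral_mono fun x => ?_
  by_cases hx : x ∈ S
  · rw [Set.indicator_of_mem hx, ← lintegral_indicator hT]
    refine lintegral_mono fun y => ?_
    by_cases hy : y ∈ T
    · rw [Set.indicator_of_mem hy, Set.indicator_of_mem]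
      rw [mem_ball_zero_iff, norm_append]
      exact max_lt (hST x hx y hy).1 (hST x hx y hy).2
    · simp [hy]
  · simp [hx]

lemma mem_openCube_norm {n : ℕ} {x x0 : Rn n} {s : ℝ} (hs : 0 < s) :
    x ∈ openCube x0 s ↔ ‖x - x0‖ < s := by
  rw [pi_norm_lt_iff hs]; rfl

lemma openCube_eq_ball {n : ℕ} {s : ℝ} (hs : 0 < s) : openCube (0 : Rn n) s = Metric.ball 0 s := by
  ext x; rw [mem_openCube_norm hs]; simp

/-- Trace inequality on horizontal slices. -/
lemma trace_slice {n d : ℕ} (hd : 0 < d) (l : ℕ) (hl : 0 < l) (r : ℝ≥0∞) (hr1 : 1 ≤ r)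
    (hrt : r ≠ ∞) (hk : (d : ℝ) / r.toReal < l) :
    ∃ C : ℝ≥0∞, C ≠ ∞ ∧ ∀ v : Rn (n + d) → ℝ, ContDiff ℝ (⊤ : ℕ∞) v → ∀ R : ℝ, 0 < R →
      ∀ y : Rn d, ‖y‖ ≤ 1 → ∀ δ : ℝ≥0∞,
        (∀ o, eLpNorm (multiDeriv (ix l o) v) r (volume.restrict (Metric.ball 0 (R + l + 2))) ≤ δ) →
        eLpNorm (fun x : Rn n => v (Fin.append x y)) r (volume.restrict (openCube 0 R)) ≤ C * δ := by
  have hr0 : 0 < r.toReal := ENNReal.toReal_pos (by positivity) hrt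
  have hrr : 1 ≤ r.toReal := by
    rw [← ENNReal.toReal_one]; exact ENNReal.toReal_mono hrt hr1
  obtain ⟨C, hC, H⟩ := M2 (n := n) hd l hl r.toReal hrr hk
  have hcK := cK_ne_top (n + d) l
  have hcK2 : cK (n + d) l ^ (r.toReal - 1) ≠ ∞ := ENNReal.rpow_ne_top_of_nonneg (by linarith) hcK
  refine ⟨(C * (cK (n + d) l ^ (r.toReal - 1) * cK (n + d) l)) ^ (1 / r.toReal), ?_, ?_⟩
  · exact ENNReal.rpow_ne_top_of_nonneg (by positivity) (by finiteness)
  intro v hv R hR y hy δ hδ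
  rw [eLpNorm_eq_lintegral_rpow_enorm_toReal (by positivity) hrt, rpow_one_div_le' hr0,
    ENNReal.mul_rpow_of_nonneg _ _ hr0.le, ← ENNReal.rpow_mul, one_div_mul_cancel hr0.ne',
    ENNReal.rpow_one]
  set Φ : Rn (n + d) → ℝ≥0∞ := fun z => ∑ o, ‖multiDeriv (ix l o) v z‖ₑ ^ r.toReal
  have hm : ∀ o, Measurable (fun z => ‖multiDeriv (ix l o) v z‖ₑ ^ r.toReal) := fun o =>
    ((iterPD_smooth _ hv).continuous.measurable.enorm).pow_const _
  have hΦ : Measurable Φ := Finset.measurable_fun_sum _ fun o _ => hm o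
  set c := cK (n + d) l ^ (r.toReal - 1)
  have hpt : ∀ x : Rn n, ‖v (Fin.append x y)‖ₑ ^ r.toReal ≤
      C * (c * ∫⁻ z in Metric.ball (0 : Rn d) (l + 2), Φ (Fin.append x z)) := by
    intro x
    refine (H v hv x y).trans (mul_le_mul_right ?_ _)
    calc _ ≤ ∫⁻ z in Metric.closedBall (0 : Rn d) l, c * Φ (Fin.append x (y + z)) := by
          refine lintegral_mono fun z => ?_
          have := ix_pow_le (l := l) r.toReal hrr (fun α => multiDeriv α v) (Fin.append x (y + z))
          simpa only [multiDeriv_zero] using this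
      _ = c * ∫⁻ z in Metric.closedBall (0 : Rn d) l, Φ (Fin.append x (y + z)) :=
          lintegral_const_mul' _ _ hcK2
      _ ≤ _ := by
          refine mul_le_mul_right ?_ _
          rw [← lintegral_indicator measurableSet_closedBall, ← lintegral_indicator measurableSet_ball]
          rw [← lintegral_add_left_eq_self ((Metric.ball (0 : Rn d) (l + 2)).indicator _) y]
          refine lintegral_mono fun z => ?_
          by_cases hz : z ∈ Metric.closedBall (0 : Rn d) l
          · rw [Set.indicator_of_mem hz, Set.indicator_of_mem]
            rw [mem_ball_zero_iff]
            rw [mem_closedBall_zero_iff] at hz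
            have := norm_add_le y z
            linarith
          · simp [hz]
  calc ∫⁻ x in openCube 0 R, ‖v (Fin.append x y)‖ₑ ^ r.toReal
      ≤ ∫⁻ x in openCube 0 R, (C * c) * ∫⁻ z in Metric.ball (0 : Rn d) (l + 2), Φ (Fin.append x z) :=
        lintegral_mono fun x => (hpt x).trans (le_of_eq (by ring))
    _ = (C * c) * ∫⁻ x in openCube 0 R, ∫⁻ z in Metric.ball (0 : Rn d) (l + 2), Φ (Fin.append x z) :=
        lintegral_const_mul' _ _ (by finiteness)
    _ ≤ (C * c) * ∫⁻ z in Metric.ball 0 (R + l + 2), Φ z := by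
        refine mul_le_mul_right (lint_app_le Φ hΦ.aemeasurable _ _ (measurableSet_openCube _ _)
          measurableSet_ball _ fun x hx y hy => ?_) _
        rw [mem_openCube_norm hR] at hx
        rw [mem_ball_zero_iff] at hy
        have : (0 : ℝ) ≤ l := Nat.cast_nonneg _
        rw [sub_zero] at hx
        constructor <;> linarith
    _ = (C * c) * ∑ o, ∫⁻ z in Metric.ball 0 (R + l + 2), ‖multiDeriv (ix l o) v z‖ₑ ^ r.toReal := by
        rw [lintegral_finsetSum _ fun o _ => hm o]
    _ ≤ (C * c) * ∑ o : Option (Fin l → Fin (n + d)), δ ^ r.toReal := by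
        refine mul_le_mul_right (Finset.sum_le_sum fun o _ => ?_) _
        have := hδ o
        rwa [eLpNorm_eq_lintegral_rpow_enorm_toReal (by positivity) hrt, rpow_one_div_le' hr0] at this
    _ = _ := by
        rw [Finset.sum_const, Finset.card_univ, nsmul_eq_mul]
        simp only [cK]; ring

/-- Limits of fast Cauchy sequences. -/
lemma lim_exists {n : ℕ} (r : ℝ≥0∞) (hr1 : 1 ≤ r) (g : ℕ → Rn n → ℝ) (hg : ∀ m, Measurable (g m))
    (K : ℝ≥0∞) (hK : K ≠ ∞) (l0 : ℕ)
    (h : ∀ R m k : ℕ, 0 < R → R + l0 ≤ m → m ≤ k →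
      eLpNorm (fun x => g m x - g k x) r (volume.restrict (openCube 0 R)) ≤ K * 2⁻¹ ^ m) :
    ∃ φ : Rn n → ℝ, Measurable φ ∧ (∀ᵐ x, Tendsto (fun m => g m x) atTop (nhds (φ x))) := by
  refine measurable_limit_of_tendsto_metrizable_ae (fun m => (hg m).aemeasurable) ?_
  have hR : ∀ R : ℕ, ∀ᵐ x, x ∈ openCube (0 : Rn n) ((R + 1 : ℕ) : ℝ) →
      ∃ l : ℝ, Tendsto (fun m => g m x) atTop (nhds l) := by
    intro R
    rw [← ae_restrict_iff' (measurableSet_openCube _ _)]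
    set M := R + 1 + l0
    have hc := Lp.ae_tendsto_of_cauchy_eLpNorm (μ := volume.restrict (openCube (0 : Rn n) ((R + 1 : ℕ) : ℝ)))
      (f := fun m => g (m + M)) (p := r) (fun m => (hg _).aestronglyMeasurable) hr1
      (B := fun i => (K + 1) * 2⁻¹ ^ i) ?_ ?_
    · filter_upwards [hc] with x hx
      obtain ⟨l, hl⟩ := hx
      exact ⟨l, (tendsto_add_atTop_iff_nat (f := fun m => g m x) M).1 hl⟩
    · rw [ENNReal.tsum_mul_left, ENNReal.tsum_geometric, ENNReal.one_sub_inv_two, inv_inv]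
      finiteness
    · have key : ∀ N a b : ℕ, N ≤ a → a ≤ b → eLpNorm (g (a + M) - g (b + M)) r
          (volume.restrict (openCube (0 : Rn n) ((R + 1 : ℕ) : ℝ))) < (K + 1) * 2⁻¹ ^ N := by
        intro N a b hNa hab
        refine lt_of_le_of_lt (h (R + 1) (a + M) (b + M) (by omega) (by omega) (by omega)) ?_
        have h1 : (2⁻¹ : ℝ≥0∞) ^ (a + M) ≤ 2⁻¹ ^ N :=
          pow_le_pow_right_of_le_one' (by simp) (by omega)
        refine lt_of_le_of_lt (mul_le_mul_right h1 _) ?_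
        have h0 : (2⁻¹ : ℝ≥0∞) ^ N ≠ 0 := by simp
        have ht : (2⁻¹ : ℝ≥0∞) ^ N ≠ ∞ := by finiteness
        rw [ENNReal.mul_lt_mul_iff_left h0 ht]
        exact ENNReal.lt_add_right hK one_ne_zero
      intro N a b ha hb
      rcases le_total a b with hab | hab
      · exact key N a b ha hab
      · rw [← eLpNorm_neg, neg_sub]; exact key N b a hb hab
  filter_upwards [ae_all_iff.2 hR] with x hx
  obtain ⟨R, hR⟩ := exists_nat_gt ‖x‖
  refine hx R ?_
  rw [mem_openCube_norm (by positivity), sub_zero]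
  push_cast; linarith

lemma lim_bound {n : ℕ} (r : ℝ≥0∞) (g : ℕ → Rn n → ℝ) (hg : ∀ m, Measurable (g m))
    (δ : ℝ≥0∞) (S : Set (Rn n)) (m : ℕ)
    (h : ∀ k : ℕ, m ≤ k → eLpNorm (fun x => g m x - g k x) r (volume.restrict S) ≤ δ)
    (φ : Rn n → ℝ) (hφ : ∀ᵐ x, Tendsto (fun m => g m x) atTop (nhds (φ x))) :
    eLpNorm (fun x => g m x - φ x) r (volume.restrict S) ≤ δ := by
  refine (Lp.eLpNorm_lim_le_liminf_eLpNorm (f := fun k x => g m x - g k x)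
    (fun k => ((hg m).sub (hg k)).aestronglyMeasurable) _ ?_).trans ?_
  · filter_upwards [ae_restrict_of_ae hφ] with x hx
    exact hx.const_sub _
  · refine liminf_le_of_frequently_le' (Eventually.frequently ?_)
    filter_upwards [eventually_ge_atTop m] with k hk
    exact h k hk

/-- A smooth approximating sequence. -/
def Approx {N : ℕ} (l : ℕ) (r : ℝ≥0∞) (u : ℕ → Rn N → ℝ) (D : (Fin N → ℕ) → Rn N → ℝ) : Prop :=
  (∀ m, ContDiff ℝ (⊤ : ℕ∞) (u m)) ∧ ∀ m o,
    eLpNorm (fun z => multiDeriv (ix l o) (u m) z - D (ix l o) z) r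
      (volume.restrict (Metric.ball 0 m)) ≤ 2⁻¹ ^ m

lemma approx_exists {N : ℕ} (l : ℕ) (r : ℝ≥0∞) (hr1 : 1 ≤ r) (hrt : r ≠ ∞) (f : Rn N → ℝ)
    (D : (Fin N → ℕ) → Rn N → ℝ) (hf : LocallyIntegrable f volume)
    (hD : ∀ o, LocallyIntegrable (D (ix l o)) volume ∧ IsWeakDeriv (ix l o) f (D (ix l o)) ∧
      ∀ R : ℝ, eLpNorm (D (ix l o)) r (volume.restrict (Metric.ball 0 R)) < ∞) :
    ∃ u, Approx l r u D := by
  have h : ∀ m : ℕ, ∃ u : Rn N → ℝ, ContDiff ℝ (⊤ : ℕ∞) u ∧ ∀ α ∈ Finset.univ.image (ix (N := N) l),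
      eLpNorm (fun z => multiDeriv α u z - D α z) r (volume.restrict (Metric.ball 0 (m : ℝ))) ≤ 2⁻¹ ^ m := by
    intro m
    refine moll_local r hr1 hrt f D _ hf ?_ m _ (ENNReal.pow_pos (by simp) _)
    intro α hα
    obtain ⟨o, -, rfl⟩ := Finset.mem_image.1 hα
    exact hD o
  choose u hu1 hu2 using h
  exact ⟨u, hu1, fun m o => hu2 m _ (Finset.mem_image_of_mem _ (Finset.mem_univ o))⟩

lemma approx_diff {N : ℕ} {l : ℕ} {r : ℝ≥0∞} (hr1 : 1 ≤ r) {u : ℕ → Rn N → ℝ}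
    {D : (Fin N → ℕ) → Rn N → ℝ} (hu : Approx l r u D) (hDm : ∀ o, Measurable (D (ix l o)))
    (R : ℝ) (m k : ℕ) (hR : R ≤ m) (hmk : m ≤ k) (o) :
    eLpNorm (multiDeriv (ix l o) (fun z => u m z - u k z)) r
      (volume.restrict (Metric.ball 0 R)) ≤ 2 * 2⁻¹ ^ m := by
  have e : multiDeriv (ix l o) (fun z => u m z - u k z) =
      (fun z => multiDeriv (ix l o) (u m) z - D (ix l o) z) -
      (fun z => multiDeriv (ix l o) (u k) z - D (ix l o) z) := by
    unfold multiDeriv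
    rw [iterPD_sub _ (hu.1 m) (hu.1 k)]
    funext z; simp
  have hm : ∀ m, Measurable (fun z => multiDeriv (ix l o) (u m) z - D (ix l o) z) := fun m =>
    (iterPD_smooth _ (hu.1 m)).continuous.measurable.sub (hDm o)
  have hb : ∀ j : ℕ, m ≤ j → eLpNorm (fun z => multiDeriv (ix l o) (u j) z - D (ix l o) z) r
      (volume.restrict (Metric.ball 0 R)) ≤ 2⁻¹ ^ m := by
    intro j hj
    refine (eLpNorm_mono_measure _ (Measure.restrict_mono (Metric.ball_subset_ball ?_) le_rfl)).trans
      ((hu.2 j o).trans (pow_le_pow_right_of_le_one' (by simp) hj))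
    exact hR.trans (by exact_mod_cast hj)
  rw [e, two_mul]
  exact (eLpNorm_sub_le (hm m).aestronglyMeasurable (hm k).aestronglyMeasurable hr1).trans
    (add_le_add (hb m le_rfl) (hb k hmk))

lemma full_lim {N : ℕ} {l : ℕ} {r : ℝ≥0∞} (hr1 : 1 ≤ r) {u : ℕ → Rn N → ℝ}
    {D : (Fin N → ℕ) → Rn N → ℝ} (hu : Approx l r u D) (hDm : ∀ o, Measurable (D (ix l o))) :
    ∀ᵐ z, Tendsto (fun m => u m z) atTop (nhds (D 0 z)) := by
  have hum : ∀ m, Measurable (u m) := fun m => (hu.1 m).continuous.measurable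
  have hc : ∀ R m k : ℕ, 0 < R → R ≤ m → m ≤ k →
      eLpNorm (fun x => u m x - u k x) r (volume.restrict (openCube 0 R)) ≤ 2 * 2⁻¹ ^ m := by
    intro R m k hR0 hR hmk
    have := approx_diff hr1 hu hDm R m k (by exact_mod_cast hR) hmk none
    simp only [ix, multiDeriv_zero] at this
    rwa [openCube_eq_ball (by exact_mod_cast hR0)]
  obtain ⟨ψ, hψm, hψ⟩ := lim_exists r hr1 u hum 2 (by simp) 0 hc
  have hb : ∀ R : ℕ, ∀ᵐ z, z ∈ openCube (0 : Rn N) ((R + 1 : ℕ) : ℝ) → ψ z = D 0 z := by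
    intro R
    rw [← ae_restrict_iff' (measurableSet_openCube _ _)]
    have hD0 : Measurable (D 0) := hDm none
    have h3 : ∀ m : ℕ, R + 1 ≤ m → eLpNorm (fun z => ψ z - D 0 z) r
        (volume.restrict (openCube (0 : Rn N) ((R + 1 : ℕ) : ℝ))) ≤ 3 * 2⁻¹ ^ m := by
      intro m hm
      have h1 := lim_bound r u hum (2 * 2⁻¹ ^ m) (openCube (0 : Rn N) ((R + 1 : ℕ) : ℝ)) m
        (fun k hk => hc (R + 1) m k (by omega) hm hk) ψ hψ
      have h2 := hu.2 m none
      simp only [ix, multiDeriv_zero] at h2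
      have h2' := (eLpNorm_mono_measure (fun z => u m z - D 0 z) (p := r)
        (Measure.restrict_mono (s := openCube (0 : Rn N) ((R + 1 : ℕ) : ℝ)) (s' := Metric.ball 0 (m : ℝ)) (by
          rw [openCube_eq_ball (by positivity)]
          exact Metric.ball_subset_ball (by exact_mod_cast hm)) (le_refl volume))).trans h2
      have e : (fun z => ψ z - D 0 z) = (fun z => u m z - D 0 z) - (fun z => u m z - ψ z) := by
        funext z; simp
      rw [e]
      refine (eLpNorm_sub_le ((hum m).sub hD0).aestronglyMeasurable
        ((hum m).sub hψm).aestronglyMeasurable hr1).trans ((add_le_add h2' h1).trans (le_of_eq ?_))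
      ring
    have h4 : eLpNorm (fun z => ψ z - D 0 z) r
        (volume.restrict (openCube (0 : Rn N) ((R + 1 : ℕ) : ℝ))) = 0 := by
      refine le_antisymm (ge_of_tendsto' (x := atTop) (f := fun m : ℕ => (3 : ℝ≥0∞) * 2⁻¹ ^ (m + (R + 1)))
        ?_ fun m => h3 _ (by omega)) bot_le
      have : Tendsto (fun m : ℕ => (2⁻¹ : ℝ≥0∞) ^ (m + (R + 1))) atTop (nhds 0) :=
        (tendsto_add_atTop_iff_nat (f := fun m : ℕ => (2⁻¹ : ℝ≥0∞) ^ m) (R + 1)).2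
          (ENNReal.tendsto_pow_atTop_nhds_zero_of_lt_one (by simp))
      simpa using ENNReal.Tendsto.const_mul this (Or.inr (by simp : (3 : ℝ≥0∞) ≠ ∞))
    replace h4 := (eLpNorm_eq_zero_iff (hψm.sub hD0).aestronglyMeasurable (by positivity)).1 h4
    filter_upwards [h4] with z hz
    simpa [sub_eq_zero] using hz
  filter_upwards [hψ, ae_all_iff.2 hb] with z hz hz2
  obtain ⟨R, hR⟩ := exists_nat_gt ‖z‖
  rw [← hz2 R ?_]
  · exact hz
  rw [mem_openCube_norm (by positivity), sub_zero]
  push_cast; linarith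

lemma cont_slice {n d : ℕ} (u : Rn (n + d) → ℝ) (hu : Continuous u) (R : ℝ) (h : 0 < R) :
    Tendsto (fun y : Rn d => ∫⁻ x in openCube (0 : Rn n) R, ‖u (Fin.append x y) - u (Fin.append x 0)‖ₑ)
      (nhds 0) (nhds 0) := by
  have hcont : Continuous (Function.uncurry fun (y : Rn d) (x : Rn n) =>
      ‖u (Fin.append x y) - u (Fin.append x 0)‖) := by
    have h1 : Continuous (fun q : Rn d × Rn n => u (Fin.append q.2 q.1)) :=
      hu.comp (continuous_append.comp (continuous_snd.prodMk continuous_fst))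
    have h2 : Continuous (fun q : Rn d × Rn n => u (Fin.append q.2 0)) :=
      hu.comp (continuous_append.comp (continuous_snd.prodMk continuous_const))
    exact (h1.sub h2).norm
  have hF := continuous_parametric_integral_of_continuous (μ := (volume : Measure (Rn n))) hcont
    (isCompact_closedBall (0 : Rn n) R)
  have hF0 := hF.tendsto 0
  simp only [sub_self, norm_zero, integral_zero] at hF0
  have hF1 := (ENNReal.continuous_ofReal.tendsto 0).comp hF0
  rw [ENNReal.ofReal_zero] at hF1
  refine tendsto_of_tendsto_of_tendsto_of_le_of_le tendsto_const_nhds hF1 (fun _ => bot_le) fun y => ?_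
  have hcy : Continuous (fun x : Rn n => u (Fin.append x y) - u (Fin.append x 0)) :=
    (hu.comp (continuous_append.comp (continuous_id.prodMk continuous_const))).sub
      (hu.comp (continuous_append.comp (continuous_id.prodMk continuous_const)))
  simp only [Function.comp]
  rw [ofReal_integral_norm_eq_lintegral_enorm
    (hcy.continuousOn.integrableOn_compact (isCompact_closedBall (0 : Rn n) R))]
  refine lintegral_mono_set ?_
  intro x hx
  rw [mem_openCube_norm h, sub_zero] at hx
  exact mem_closedBall_zero_iff.2 hx.le

lemma slice_cauchy {n d : ℕ} (hd : 0 < d) (l : ℕ) (hl : 0 < l) (r : ℝ≥0∞) (hr1 : 1 ≤ r)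
    (hrt : r ≠ ∞) (hk : (d : ℝ) / r.toReal < l) :
    ∃ K : ℝ≥0∞, K ≠ ∞ ∧ ∀ (u : ℕ → Rn (n + d) → ℝ) (D : (Fin (n + d) → ℕ) → Rn (n + d) → ℝ),
      Approx l r u D → (∀ o, Measurable (D (ix l o))) → ∀ y : Rn d, ‖y‖ ≤ 1 → ∀ R m k : ℕ, 0 < R →
      R + (l + 2) ≤ m → m ≤ k →
      eLpNorm (fun x : Rn n => u m (Fin.append x y) - u k (Fin.append x y)) r
        (volume.restrict (openCube 0 R)) ≤ K * 2⁻¹ ^ m := by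
  obtain ⟨C, hC, H⟩ := trace_slice (n := n) hd l hl r hr1 hrt hk
  refine ⟨C * 2, by finiteness, fun u D hu hDm y hy R m k hR hRm hmk => ?_⟩
  rw [mul_assoc]
  refine H (fun z => u m z - u k z) ((hu.1 m).sub (hu.1 k)) R (by exact_mod_cast hR) y hy _ fun o => ?_
  refine approx_diff hr1 hu hDm _ m k ?_ hmk o
  have : ((R + (l + 2) : ℕ) : ℝ) ≤ m := by exact_mod_cast hRm
  push_cast at this
  linarith

lemma exists_nat_openCube {n : ℕ} {S : Set (Rn n)} (hS : Bornology.IsBounded S) :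
    ∃ R : ℕ, 0 < R ∧ S ⊆ openCube 0 (R : ℝ) := by
  obtain ⟨R, hR⟩ := hS.subset_ball 0
  obtain ⟨k, hk⟩ := exists_nat_gt R
  refine ⟨k + 1, by omega, fun x hx => ?_⟩
  rw [openCube_eq_ball (by positivity)]
  refine Metric.ball_subset_ball ?_ (hR hx)
  push_cast; linarith

lemma trace_exists {n d : ℕ} (hd : 0 < d) (l : ℕ) (hl : 0 < l) (r : ℝ≥0∞) (hr1 : 1 ≤ r)
    (hrt : r ≠ ∞) (hk : (d : ℝ) / r.toReal < l) (u : ℕ → Rn (n + d) → ℝ)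
    (D : (Fin (n + d) → ℕ) → Rn (n + d) → ℝ) (hu : Approx l r u D)
    (hDm : ∀ o, Measurable (D (ix l o))) (f : Rn (n + d) → ℝ) (hf : D 0 =ᵐ[volume] f) :
    ∃ φ : Rn n → ℝ, MemLrLoc n r φ ∧ IsTraceSob f φ ∧
      ∀ᵐ x, Tendsto (fun m => u m (Fin.append x 0)) atTop (nhds (φ x)) := by
  obtain ⟨K, hK, hc⟩ := slice_cauchy (n := n) hd l hl r hr1 hrt hk
  have hcon : ∀ m (y : Rn d), Continuous (fun x : Rn n => u m (Fin.append x y)) := fun m y =>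
    (hu.1 m).continuous.comp (continuous_append.comp (continuous_id.prodMk continuous_const))
  have hum : ∀ (y : Rn d) m, Measurable (fun x : Rn n => u m (Fin.append x y)) := fun y m =>
    (hcon m y).measurable
  have hsl : ∀ y : Rn d, ‖y‖ ≤ 1 → ∃ ψ : Rn n → ℝ, Measurable ψ ∧
      ∀ᵐ x, Tendsto (fun m => u m (Fin.append x y)) atTop (nhds (ψ x)) := fun y hy =>
    lim_exists r hr1 _ (hum y) K hK (l + 2) (hc u D hu hDm y hy)
  obtain ⟨φ, hφm, hφ⟩ := hsl 0 (by simp)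
  have hb : ∀ (y : Rn d), ‖y‖ ≤ 1 → ∀ ψ : Rn n → ℝ,
      (∀ᵐ x, Tendsto (fun m => u m (Fin.append x y)) atTop (nhds (ψ x))) → ∀ R m : ℕ, 0 < R →
      R + (l + 2) ≤ m → eLpNorm (fun x => u m (Fin.append x y) - ψ x) r
        (volume.restrict (openCube 0 R)) ≤ K * 2⁻¹ ^ m := fun y hy ψ hψ R m hR hRm =>
    lim_bound r (fun m x => u m (Fin.append x y)) (hum y) _ _ m
      (fun k hmk => hc u D hu hDm y hy R m k hR hRm hmk) ψ hψ
  refine ⟨φ, ⟨hφm, fun S hS => ?_⟩, ?_, hφ⟩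
  · obtain ⟨R, hR, hSR⟩ := exists_nat_openCube hS.isBounded
    set m := R + (l + 2)
    have h1 := hb 0 (by simp) φ hφ R m hR le_rfl
    have h2 : eLpNorm (fun x : Rn n => u m (Fin.append x 0)) r (volume.restrict S) < ∞ := by
      have : MemLp (fun x : Rn n => u m (Fin.append x 0)) r (volume.restrict S) := by
        have : IsFiniteMeasure (volume.restrict S) := ⟨by simpa using hS.measure_lt_top⟩
        obtain ⟨B, hB⟩ := hS.exists_bound_of_continuousOn (hcon m 0).continuousOn
        refine MemLp.of_bound (hum 0 m).aestronglyMeasurable B ?_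
        filter_upwards [ae_restrict_mem hS.measurableSet] with x hx using hB x hx
      exact this.2
    have e : φ = (fun x => u m (Fin.append x 0)) - (fun x => u m (Fin.append x 0) - φ x) := by
      funext x; simp
    rw [e]
    refine (eLpNorm_sub_le (hum 0 m).aestronglyMeasurable
      ((hum 0 m).sub hφm).aestronglyMeasurable hr1).trans_lt (ENNReal.add_lt_top.2 ⟨h2, ?_⟩)
    refine ((eLpNorm_mono_measure _ (Measure.restrict_mono hSR le_rfl)).trans h1).trans_lt ?_
    finiteness
  · let f' : Rn (n + d) → ℝ := fun z => limUnder atTop (fun m => u m z)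
    have hf' : ∀ y : Rn d, ‖y‖ ≤ 1 →
        ∀ᵐ x : Rn n, Tendsto (fun m => u m (Fin.append x y)) atTop (nhds (f' (Fin.append x y))) := by
      intro y hy
      obtain ⟨ψ, -, hψ⟩ := hsl y hy
      filter_upwards [hψ] with x hx
      exact tendsto_nhds_limUnder ⟨_, hx⟩
    refine ⟨f', ?_, fun c s hs => ?_⟩
    · filter_upwards [full_lim hr1 hu hDm, hf] with z hz hz2
      rw [← hz2]
      exact hz.limUnder_eq
    have hbd : Bornology.IsBounded (cubeAt c s) := by
      rw [cubeAt_eq_pi]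
      exact Bornology.IsBounded.pi fun i => Metric.isBounded_Ioo _ _
    obtain ⟨R, hR, hSR⟩ := exists_nat_openCube hbd
    rw [tendsto_zero_iff_enorm_tendsto_zero, ENNReal.tendsto_nhds_zero]
    intro ε hε
    set B := openCube (0 : Rn n) (R : ℝ)
    set cQ : ℝ≥0∞ := volume B ^ (1 / (1 : ℝ≥0∞).toReal - 1 / r.toReal)
    have hrr : 1 ≤ r.toReal := by
      rw [← ENNReal.toReal_one]; exact ENNReal.toReal_mono hrt hr1
    have hcQ : cQ ≠ ∞ := by
      refine ENNReal.rpow_ne_top_of_nonneg ?_ ?_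
      · rw [ENNReal.toReal_one, div_one, sub_nonneg]
        exact div_le_one_of_le₀ hrr (by linarith)
      · simp only [B]; rw [volume_openCube]; finiteness
    have hL1 : ∀ (y : Rn d), ‖y‖ ≤ 1 → ∀ ψ : Rn n → ℝ, 
        (∀ᵐ x, Tendsto (fun m => u m (Fin.append x y)) atTop (nhds (ψ x))) → ∀ m : ℕ,
        R + (l + 2) ≤ m → ∫⁻ x in B, ‖u m (Fin.append x y) - ψ x‖ₑ ≤ K * cQ * 2⁻¹ ^ m := by
      intro y hy ψ hψ m hm
      have hψm : AEMeasurable ψ volume := aemeasurable_of_tendsto_metrizable_ae atTop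
        (fun m => (hum y m).aemeasurable) hψ
      rw [← eLpNorm_one_eq_lintegral_enorm]
      refine (eLpNorm_le_eLpNorm_mul_rpow_measure_univ hr1
        ((hum y m).aemeasurable.sub hψm).restrict.aestronglyMeasurable).trans ?_
      rw [Measure.restrict_apply_univ]
      refine (mul_le_mul_left (hb y hy ψ hψ R m hR hm) _).trans (le_of_eq ?_)
      simp only [cQ]; ring
    obtain ⟨m, hmR, hm⟩ : ∃ m : ℕ, R + (l + 2) ≤ m ∧ 2 * (K * cQ * 2⁻¹ ^ m) ≤ ε / 2 := by
      have h1 : Tendsto (fun m : ℕ => 2 * (K * cQ * 2⁻¹ ^ m)) atTop (nhds 0) := by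
        have := ENNReal.Tendsto.const_mul (ENNReal.tendsto_pow_atTop_nhds_zero_of_lt_one
          (by simp : (2⁻¹ : ℝ≥0∞) < 1)) (Or.inr (by finiteness : 2 * (K * cQ) ≠ ∞))
        simpa [mul_assoc] using this
      have h2 := ENNReal.tendsto_nhds_zero.1 h1 (ε / 2) (ENNReal.half_pos hε.ne')
      obtain ⟨m, h3, h4⟩ := (h2.and (eventually_ge_atTop (R + (l + 2)))).exists
      exact ⟨m, h4, h3⟩
    have hcs := ENNReal.tendsto_nhds_zero.1 (cont_slice (u m) (hu.1 m).continuous R (by exact_mod_cast hR))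
      (ε / 2) (ENNReal.half_pos hε.ne')
    filter_upwards [hcs, Metric.closedBall_mem_nhds (0 : Rn d) one_pos] with y hy1 hy2
    have hy : ‖y‖ ≤ 1 := mem_closedBall_zero_iff.1 hy2
    refine (enorm_integral_le_lintegral_enorm _).trans ?_
    have hfm : AEMeasurable (fun x : Rn n => f' (Fin.append x y)) volume :=
      aemeasurable_of_tendsto_metrizable_ae atTop (fun m => (hum y m).aemeasurable) (hf' y hy)
    calc ∫⁻ x in cubeAt c s, ‖|f' (Fin.append x y) - φ x|‖ₑ
        ≤ ∫⁻ x in B, ‖|f' (Fin.append x y) - φ x|‖ₑ := lintegral_mono_set hSR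
      _ ≤ ∫⁻ x in B, (‖u m (Fin.append x y) - f' (Fin.append x y)‖ₑ +
          (‖u m (Fin.append x y) - u m (Fin.append x 0)‖ₑ + ‖u m (Fin.append x 0) - φ x‖ₑ)) := by
          refine lintegral_mono fun x => ?_
          rw [Real.enorm_abs]
          have e : f' (Fin.append x y) - φ x = -(u m (Fin.append x y) - f' (Fin.append x y)) +
            ((u m (Fin.append x y) - u m (Fin.append x 0)) + (u m (Fin.append x 0) - φ x)) := by ring
          rw [e]
          refine (enorm_add_le _ _).trans ?_
          rw [enorm_neg]
          exact add_le_add le_rfl (enorm_add_le _ _)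
      _ = (∫⁻ x in B, ‖u m (Fin.append x y) - f' (Fin.append x y)‖ₑ) +
          ((∫⁻ x in B, ‖u m (Fin.append x y) - u m (Fin.append x 0)‖ₑ) +
            ∫⁻ x in B, ‖u m (Fin.append x 0) - φ x‖ₑ) := by
          have a1 : AEMeasurable (fun x : Rn n => ‖u m (Fin.append x y) - f' (Fin.append x y)‖ₑ)
              (volume.restrict B) := ((hum y m).aemeasurable.sub hfm).enorm.restrict
          have a2 : Measurable (fun x : Rn n => ‖u m (Fin.append x y) - u m (Fin.append x 0)‖ₑ) :=
            ((hum y m).sub (hum 0 m)).enorm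
          rw [lintegral_add_left' a1, lintegral_add_left a2]
      _ ≤ K * cQ * 2⁻¹ ^ m + (ε / 2 + K * cQ * 2⁻¹ ^ m) :=
          add_le_add (hL1 y hy _ (hf' y hy) m hmR) (add_le_add hy1 (hL1 0 (by simp) φ hφ m hmR))
      _ = 2 * (K * cQ * 2⁻¹ ^ m) + ε / 2 := by ring
      _ ≤ ε / 2 + ε / 2 := add_le_add hm le_rfl
      _ = ε := ENNReal.add_halves ε

/-- Projection to the vertical coordinates. -/
def yp {n d : ℕ} (z : Rn (n + d)) : Rn d := fun i => z (Fin.natAdd n i)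

lemma yp_append {n d : ℕ} (x : Rn n) (y : Rn d) : yp (Fin.append x y) = y := by
  funext i; simp [yp]

lemma yp_meas {n d : ℕ} : Measurable (yp : Rn (n + d) → Rn d) := by
  unfold yp; fun_prop

lemma yp_norm_lt {n d : ℕ} {x0 : Rn n} {t : ℝ} (ht : 0 < t) {z : Rn (n + d)}
    (hz : z ∈ openCube (Fin.append x0 (0 : Rn d)) t) : ‖yp z‖ < t := by
  rw [pi_norm_lt_iff ht]
  intro i
  have := hz (Fin.natAdd n i)
  simpa [yp] using this

lemma append_mem_openCube {n d : ℕ} {x0 x : Rn n} {y : Rn d} {t : ℝ} (hx : x ∈ openCube x0 t)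
    (hy : ‖y‖ < t) : Fin.append x y ∈ openCube (Fin.append x0 (0 : Rn d)) t := by
  intro i
  refine Fin.addCases (fun j => ?_) (fun j => ?_) i
  · simpa using hx j
  · simpa using (norm_le_pi_norm y j).trans_lt hy

lemma app_le_cube {n d : ℕ} (F : Rn (n + d) → ℝ≥0∞) (hF : AEMeasurable F volume) (x0 : Rn n)
    (t t' : ℝ) (htt : t' < t) :
    ∫⁻ x in openCube x0 t, ∫⁻ y in Metric.closedBall (0 : Rn d) t', F (Fin.append x y) ≤
      ∫⁻ z in openCube (Fin.append x0 (0 : Rn d)) t, F z := by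
  have mU := measurableSet_openCube (Fin.append x0 (0 : Rn d)) t
  rw [← lintegral_indicator mU, lintegral_append _ (hF.indicator mU),
    ← lintegral_indicator (measurableSet_openCube _ _)]
  refine lintegral_mono fun x => ?_
  by_cases hx : x ∈ openCube x0 t
  · rw [Set.indicator_of_mem hx, ← lintegral_indicator measurableSet_closedBall]
    refine lintegral_mono fun y => ?_
    by_cases hy : y ∈ Metric.closedBall (0 : Rn d) t'
    · rw [Set.indicator_of_mem hy, Set.indicator_of_mem]
      exact append_mem_openCube hx ((mem_closedBall_zero_iff.1 hy).trans_lt htt)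
    · simp [hy]
  · simp [hx]

lemma fatou_le {α : Type*} [MeasurableSpace α] (μ : Measure α) (F : ℕ → α → ℝ≥0∞) (G : α → ℝ≥0∞)
    (hF : ∀ m, AEMeasurable (F m) μ) (hG : ∀ᵐ x ∂μ, Tendsto (fun m => F m x) atTop (nhds (G x)))
    (a b : ℝ≥0∞) (ha : a ≠ ∞) (e : ℕ → ℝ≥0∞) (he : Tendsto e atTop (nhds 0))
    (h : ∀ m, ∫⁻ x, F m x ∂μ ≤ a * (b + e m)) : ∫⁻ x, G x ∂μ ≤ a * b := by
  have h1 : ∫⁻ x, G x ∂μ = ∫⁻ x, liminf (fun m => F m x) atTop ∂μ :=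
    lintegral_congr_ae (hG.mono fun x hx => hx.liminf_eq.symm)
  rw [h1]
  refine (lintegral_liminf_le' hF).trans ?_
  refine (liminf_le_liminf (Eventually.of_forall h)).trans ?_
  have : Tendsto (fun m => a * (b + e m)) atTop (nhds (a * b)) := by
    have h2 : Tendsto (fun m => b + e m) atTop (nhds (b + 0)) := tendsto_const_nhds.add he
    rw [add_zero] at h2
    exact ENNReal.Tendsto.const_mul h2 (Or.inr ha)
  rw [this.liminf_eq]

lemma Gsum_meas {N l : ℕ} {D : (Fin N → ℕ) → Rn N → ℝ} (hDm : ∀ o, Measurable (D (ix l o))) :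
    Measurable (Gsum l D) := by
  unfold Gsum
  exact Finset.measurable_fun_sum _ fun L _ => (hDm (some L)).enorm

/-- The error system. -/
def Er {N : ℕ} (u : Rn N → ℝ) (D : (Fin N → ℕ) → Rn N → ℝ) : (Fin N → ℕ) → Rn N → ℝ :=
  fun α z => multiDeriv α u z - D α z

lemma Er_meas {N l : ℕ} {u : Rn N → ℝ} (hu : ContDiff ℝ (⊤ : ℕ∞) u) {D : (Fin N → ℕ) → Rn N → ℝ}
    (hDm : ∀ o, Measurable (D (ix l o))) (o) : Measurable (Er u D (ix l o)) :=
  (iterPD_smooth _ hu).continuous.measurable.sub (hDm o)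

lemma Gsum_le_Er {N l : ℕ} (u : Rn N → ℝ) (D : (Fin N → ℕ) → Rn N → ℝ) (z : Rn N) (r : ℝ)
    (hr : 1 ≤ r) : Gsum l (fun α => multiDeriv α u) z ^ r ≤
      2 ^ (r - 1) * (Gsum l D z ^ r + Gsum l (Er u D) z ^ r) := by
  refine le_trans (ENNReal.rpow_le_rpow ?_ (by linarith))
    (ENNReal.rpow_add_le_mul_rpow_add_rpow _ _ hr)
  unfold Gsum
  rw [← Finset.sum_add_distrib]
  refine Finset.sum_le_sum fun L _ => ?_
  have : multiDeriv (cntL L) u z = D (cntL L) z + Er u D (cntL L) z := by simp [Er]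
  show ‖multiDeriv (cntL L) u z‖ₑ ≤ _
  rw [this]
  exact enorm_add_le _ _

lemma zero_le_Er {N : ℕ} (u : Rn N → ℝ) (D : (Fin N → ℕ) → Rn N → ℝ) (z : Rn N) (r : ℝ)
    (hr : 1 ≤ r) : ‖u z‖ₑ ^ r ≤ 2 ^ (r - 1) * (‖D 0 z‖ₑ ^ r + ‖Er u D 0 z‖ₑ ^ r) := by
  refine le_trans (ENNReal.rpow_le_rpow ?_ (by linarith))
    (ENNReal.rpow_add_le_mul_rpow_add_rpow _ _ hr)
  have : u z = D 0 z + Er u D 0 z := by simp [Er, multiDeriv_zero]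
  rw [this]
  exact enorm_add_le _ _

lemma err_tend {N l : ℕ} {r : ℝ≥0∞} (hr1 : 1 ≤ r) (hrt : r ≠ ∞) {u : ℕ → Rn N → ℝ}
    {D : (Fin N → ℕ) → Rn N → ℝ} (hu : Approx l r u D) (hDm : ∀ o, Measurable (D (ix l o)))
    (c : Rn N) (t : ℝ) :
    Tendsto (fun m => ∫⁻ z in openCube c t, (‖Er (u m) D 0 z‖ₑ ^ r.toReal +
      Gsum l (Er (u m) D) z ^ r.toReal)) atTop (nhds 0) := by
  have hr : 1 ≤ r.toReal := by
    have := ENNReal.toReal_mono hrt hr1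
    simpa using this
  have h0 : r ≠ 0 := (lt_of_lt_of_le one_pos hr1).ne'
  obtain ⟨R, hR, hRS⟩ : ∃ R : ℕ, 0 < R ∧ openCube c t ⊆ openCube 0 (R : ℝ) := by
    apply exists_nat_openCube
    refine (Metric.isBounded_closedBall (x := c) (r := |t|)).subset fun x hx => ?_
    rw [mem_closedBall_iff_norm, pi_norm_le_iff_of_nonneg (abs_nonneg t)]
    intro i
    exact (hx i).le.trans (le_abs_self t)
  rw [openCube_eq_ball (by exact_mod_cast hR)] at hRS
  have key : ∀ m : ℕ, R ≤ m → ∫⁻ z in openCube c t, (‖Er (u m) D 0 z‖ₑ ^ r.toReal +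
      Gsum l (Er (u m) D) z ^ r.toReal) ≤ cK N l ^ (r.toReal - 1) * cK N l * 2⁻¹ ^ m := by
    intro m hm
    have hb : ∀ o, ∫⁻ z in openCube c t, ‖Er (u m) D (ix l o) z‖ₑ ^ r.toReal ≤ 2⁻¹ ^ m := by
      intro o
      have h1 := hu.2 m o
      rw [eLpNorm_eq_lintegral_rpow_enorm_toReal h0 hrt, rpow_one_div_le' (by linarith)] at h1
      refine (lintegral_mono_set (hRS.trans (Metric.ball_subset_ball (by exact_mod_cast hm)))).trans
        (h1.trans ?_)
      have h2 : (2⁻¹ ^ m : ℝ≥0∞) ≤ 1 := pow_le_one₀ bot_le (by simp)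
      exact (ENNReal.rpow_le_rpow_of_exponent_ge h2 hr).trans (by rw [ENNReal.rpow_one])
    calc ∫⁻ z in openCube c t, (‖Er (u m) D 0 z‖ₑ ^ r.toReal + Gsum l (Er (u m) D) z ^ r.toReal)
        ≤ ∫⁻ z in openCube c t, cK N l ^ (r.toReal - 1) *
            ∑ o, ‖Er (u m) D (ix l o) z‖ₑ ^ r.toReal :=
          lintegral_mono fun z => ix_pow_le _ hr _ z
      _ = cK N l ^ (r.toReal - 1) *
            ∑ o, ∫⁻ z in openCube c t, ‖Er (u m) D (ix l o) z‖ₑ ^ r.toReal := by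
          rw [lintegral_const_mul' _ _ (ENNReal.rpow_ne_top_of_nonneg (by linarith) (cK_ne_top N l)),
            lintegral_finsetSum]
          exact fun o _ => (Er_meas (hu.1 m) hDm o).enorm.pow_const _
      _ ≤ cK N l ^ (r.toReal - 1) * ∑ o : Option (Fin l → Fin N), 2⁻¹ ^ m := by
          gcongr with o; exact hb o
      _ = _ := by
          rw [Finset.sum_const, nsmul_eq_mul, mul_assoc]; rfl
  have hlim : Tendsto (fun m : ℕ => cK N l ^ (r.toReal - 1) * cK N l * 2⁻¹ ^ m) atTop (nhds 0) := by
    have := ENNReal.Tendsto.const_mul (ENNReal.tendsto_pow_atTop_nhds_zero_of_lt_one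
      (by simp : (2⁻¹ : ℝ≥0∞) < 1)) (Or.inr (ENNReal.mul_ne_top
        (ENNReal.rpow_ne_top_of_nonneg (by linarith) (cK_ne_top N l)) (cK_ne_top N l) :
          cK N l ^ (r.toReal - 1) * cK N l ≠ ∞))
    simpa using this
  refine tendsto_of_tendsto_of_tendsto_of_le_of_le' tendsto_const_nhds hlim
    (Eventually.of_forall fun _ => bot_le) ((eventually_ge_atTop R).mono key)

lemma shift_ae {n : ℕ} {P : Rn n → Prop} (hP : ∀ᵐ x, P x) (a : ℝ) (S T : Set (Rn n)) :
    ∀ᵐ hx : Rn n × Rn n ∂((volume.restrict S).prod (volume.restrict T)), P (hx.2 + a • hx.1) := by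
  have h1 : MeasurePreserving (fun q : Rn n × Rn n => (q.1, q.2 + a • q.1))
      ((volume : Measure (Rn n)).prod volume) ((volume : Measure (Rn n)).prod volume) := by
    refine (MeasurePreserving.id volume).skew_product (g := fun h x => x + a • h) ?_ ?_
    · unfold Function.uncurry; fun_prop
    · exact ae_of_all _ fun h => map_add_right_eq_self _ _
  have h2 := (Measure.quasiMeasurePreserving_snd (μ := (volume : Measure (Rn n)))
    (ν := (volume : Measure (Rn n)))).comp h1.quasiMeasurePreserving
  have h3 := h2.ae hP
  rw [Measure.prod_restrict]
  exact ae_restrict_of_ae h3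

/-- Weighted integral of `G^r` over a cube. -/
def Kint {n d : ℕ} (l : ℕ) (r s : ℝ) (G : Rn (n + d) → ℝ≥0∞) (x0 : Rn n) : ℝ≥0∞ :=
  ∫⁻ z in openCube (Fin.append x0 (0 : Rn d)) ((2 * l + 1) * s),
    Wt (thE d l r) s (yp z) * G z ^ r

lemma B1 {n d : ℕ} (hd : 0 < d) (l : ℕ) (hl : 0 < l) (r : ℝ≥0∞) (hr1 : 1 ≤ r)
    (hrt : r ≠ ∞) (hk : (d : ℝ) / r.toReal < l) :
    ∃ C : ℝ≥0∞, C ≠ ∞ ∧ ∀ (u : ℕ → Rn (n + d) → ℝ)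
    (D : (Fin (n + d) → ℕ) → Rn (n + d) → ℝ), Approx l r u D →
    (∀ o, Measurable (D (ix l o))) → ∀ φ : Rn n → ℝ,
    (∀ᵐ x, Tendsto (fun m => u m (Fin.append x 0)) atTop (nhds (φ x))) →
    ∀ (s : ℝ), 0 < s → ∀ x0 : Rn n, ENNReal.ofReal (s / 2) ^ d *
      (∫⁻ hx, ‖diffl l hx.1 φ hx.2‖ₑ ^ r.toReal
        ∂((volume.restrict (openCube (0 : Rn n) (2 * s))).prod (volume.restrict (openCube x0 s)))) ≤
        C * (ENNReal.ofReal s ^ l) ^ r.toReal * ENNReal.ofReal (4 * s) ^ n *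
        Kint l r.toReal s (Gsum l D) x0 := by
  have hr : 1 ≤ r.toReal := by
    have := ENNReal.toReal_mono hrt hr1
    simpa using this
  have h2t : (2 : ℝ≥0∞) ^ (r.toReal - 1) ≠ ∞ := ENNReal.rpow_ne_top_of_nonneg (by linarith) (by simp)
  obtain ⟨C, hC, H⟩ := M1 (n := n) hd l hl r.toReal hr hk
  refine ⟨C * 2 ^ (r.toReal - 1), by finiteness, fun u D hu hDm φ hφ s hs x0 => ?_⟩
  have hls : (l : ℝ) * s < (2 * l + 1) * s := by nlinarith [(Nat.cast_nonneg l : (0 : ℝ) ≤ l)]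
  have ht : 0 < (2 * (l : ℝ) + 1) * s := by positivity
  set θ := thE d l r.toReal with hθ
  have hθ0 : 0 < θ := thE_pos hr hk
  set μ := (volume.restrict (openCube (0 : Rn n) (2 * s))).prod (volume.restrict (openCube x0 s))
  set U := openCube (Fin.append x0 (0 : Rn d)) ((2 * l + 1) * s) with hU
  set W := ENNReal.ofReal ((2 * (l : ℝ) + 1) ^ θ) with hW
  have hum : ∀ m, Measurable (fun x : Rn n => u m (Fin.append x 0)) := fun m =>
    ((hu.1 m).continuous.comp
      (continuous_append.comp (continuous_id.prodMk continuous_const))).measurable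
  have hdm : ∀ m, Measurable (fun hx : Rn n × Rn n =>
      ‖diffl l hx.1 (fun x => u m (Fin.append x 0)) hx.2‖ₑ ^ r.toReal) := by
    intro m
    refine Measurable.pow_const (Measurable.enorm ?_) _
    unfold diffl
    refine Finset.measurable_fun_sum _ fun j _ => ?_
    exact ((hum m).comp (by fun_prop : Measurable fun hx : Rn n × Rn n => hx.2 + (j : ℝ) • hx.1)).const_mul _
  have hconv : ∀ᵐ hx ∂μ, Tendsto (fun m => ‖diffl l hx.1 (fun x => u m (Fin.append x 0)) hx.2‖ₑ ^ r.toReal)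
      atTop (nhds (‖diffl l hx.1 φ hx.2‖ₑ ^ r.toReal)) := by
    have h1 : ∀ᵐ hx ∂μ, ∀ j : ℕ, Tendsto (fun m => u m (Fin.append (hx.2 + (j : ℝ) • hx.1) 0)) atTop
        (nhds (φ (hx.2 + (j : ℝ) • hx.1))) := ae_all_iff.2 fun j => shift_ae hφ j _ _
    filter_upwards [h1] with hx h2
    refine Tendsto.ennrpow_const _ (Tendsto.enorm ?_)
    unfold diffl
    exact tendsto_finsetSum _ fun j _ => (h2 j).const_mul _
  set E : ℕ → ℝ≥0∞ := fun m => ∫⁻ z in U, (‖Er (u m) D 0 z‖ₑ ^ r.toReal +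
      Gsum l (Er (u m) D) z ^ r.toReal) with hE
  have hEt : Tendsto (fun m => W * E m) atTop (nhds 0) := by
    have := ENNReal.Tendsto.const_mul (err_tend hr1 hrt hu hDm (Fin.append x0 (0 : Rn d)) ((2 * l + 1) * s))
      (Or.inr (by finiteness : W ≠ ∞))
    simpa using this
  have hwm : Measurable fun z : Rn (n + d) => Wt θ s (yp z) := (Wt_meas _ _).comp yp_meas
  have hJ : ∀ m, Jint l r.toReal s (Gsum l (fun α => multiDeriv α (u m))) x0 ≤
      2 ^ (r.toReal - 1) * (Kint l r.toReal s (Gsum l D) x0 + W * E m) := by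
    intro m
    calc Jint l r.toReal s (Gsum l (fun α => multiDeriv α (u m))) x0
        = ∫⁻ x in openCube x0 ((2 * l + 1) * s), ∫⁻ y in Metric.closedBall (0 : Rn d) (l * s),
          (fun z => Wt θ s (yp z) * Gsum l (fun α => multiDeriv α (u m)) z ^ r.toReal)
            (Fin.append x y) := by
          simp only [yp_append]; rfl
      _ ≤ ∫⁻ z in U, Wt θ s (yp z) * Gsum l (fun α => multiDeriv α (u m)) z ^ r.toReal :=
          app_le_cube _ (hwm.mul ((Gsum_smooth_meas (hu.1 m) l).pow_const _)).aemeasurable _ _ _ hls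
      _ ≤ ∫⁻ z in U, 2 ^ (r.toReal - 1) * (Wt θ s (yp z) * Gsum l D z ^ r.toReal +
            W * (‖Er (u m) D 0 z‖ₑ ^ r.toReal + Gsum l (Er (u m) D) z ^ r.toReal)) := by
          refine setLIntegral_mono' (measurableSet_openCube _ _) fun z hz => ?_
          have hz' := yp_norm_lt ht hz
          have hWz : Wt θ s (yp z) ≤ W := by
            unfold Wt
            refine ENNReal.ofReal_le_ofReal (Real.rpow_le_rpow (by positivity) ?_ hθ0.le)
            rw [div_le_iff₀ hs]; exact hz'.le
          calc _ ≤ Wt θ s (yp z) * (2 ^ (r.toReal - 1) * (Gsum l D z ^ r.toReal +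
                Gsum l (Er (u m) D) z ^ r.toReal)) := mul_le_mul_right (Gsum_le_Er _ _ _ _ hr) _
            _ = 2 ^ (r.toReal - 1) * (Wt θ s (yp z) * Gsum l D z ^ r.toReal +
                Wt θ s (yp z) * Gsum l (Er (u m) D) z ^ r.toReal) := by ring
            _ ≤ _ := by
                gcongr
                exact le_add_self
      _ = _ := by
          have a1 : Measurable fun z => Wt θ s (yp z) * Gsum l D z ^ r.toReal :=
            hwm.mul ((Gsum_meas hDm).pow_const _)
          rw [lintegral_const_mul' _ _ h2t, lintegral_add_left a1, lintegral_const_mul' _ _ (by finiteness)]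
          rfl
  have hc0 : ENNReal.ofReal (s / 2) ^ d ≠ ∞ := by finiteness
  rw [← lintegral_const_mul' _ _ hc0]
  refine (fatou_le μ (fun m hx => ENNReal.ofReal (s / 2) ^ d *
    ‖diffl l hx.1 (fun x => u m (Fin.append x 0)) hx.2‖ₑ ^ r.toReal) _
    (fun m => ((hdm m).const_mul _).aemeasurable)
    (hconv.mono fun hx h => ENNReal.Tendsto.const_mul h (Or.inr hc0))
    (C * (ENNReal.ofReal s ^ l) ^ r.toReal * ENNReal.ofReal (4 * s) ^ n * 2 ^ (r.toReal - 1))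
    (Kint l r.toReal s (Gsum l D) x0) ?_ (fun m => W * E m) hEt ?_).trans (le_of_eq (by ring))
  · have : (ENNReal.ofReal s ^ l) ^ r.toReal ≠ ∞ :=
      ENNReal.rpow_ne_top_of_nonneg (by linarith) (by finiteness)
    finiteness
  · intro m
    rw [lintegral_const_mul' _ _ hc0, lintegral_prod _ (hdm m).aemeasurable]
    refine (H s hs (u m) (hu.1 m) x0).trans ?_
    rw [mul_assoc (C * (ENNReal.ofReal s ^ l) ^ r.toReal * ENNReal.ofReal (4 * s) ^ n)]
    exact mul_le_mul_right (hJ m) _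

lemma B2 {n d : ℕ} (hd : 0 < d) (l : ℕ) (hl : 0 < l) (r : ℝ≥0∞) (hr1 : 1 ≤ r)
    (hrt : r ≠ ∞) (hk : (d : ℝ) / r.toReal < l) :
    ∃ C : ℝ≥0∞, C ≠ ∞ ∧ ∀ (u : ℕ → Rn (n + d) → ℝ)
    (D : (Fin (n + d) → ℕ) → Rn (n + d) → ℝ), Approx l r u D →
    (∀ o, Measurable (D (ix l o))) → ∀ φ : Rn n → ℝ,
    (∀ᵐ x, Tendsto (fun m => u m (Fin.append x 0)) atTop (nhds (φ x))) →
    ∀ x0 : Rn n, ∫⁻ x in openCube x0 1, ‖φ x‖ₑ ^ r.toReal ≤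
      C * ∫⁻ z in openCube (Fin.append x0 (0 : Rn d)) (2 * l + 1),
        (‖D 0 z‖ₑ ^ r.toReal + Gsum l D z ^ r.toReal) := by
  have hr : 1 ≤ r.toReal := by
    have := ENNReal.toReal_mono hrt hr1
    simpa using this
  have h2t : (2 : ℝ≥0∞) ^ (r.toReal - 1) ≠ ∞ := ENNReal.rpow_ne_top_of_nonneg (by linarith) (by simp)
  obtain ⟨C, hC, H⟩ := M2 (n := n) hd l hl r.toReal hr hk
  refine ⟨C * 2 ^ (r.toReal - 1), by finiteness, fun u D hu hDm φ hφ x0 => ?_⟩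
  set U := openCube (Fin.append x0 (0 : Rn d)) (2 * l + 1) with hU
  have hum : ∀ m, Measurable (fun x : Rn n => u m (Fin.append x 0)) := fun m =>
    ((hu.1 m).continuous.comp
      (continuous_append.comp (continuous_id.prodMk continuous_const))).measurable
  have hD0 : Measurable (D 0) := hDm none
  refine fatou_le _ (fun m x => ‖u m (Fin.append x 0)‖ₑ ^ r.toReal) _
    (fun m => ((hum m).enorm.pow_const _).aemeasurable)
    (ae_restrict_of_ae (hφ.mono fun x h => Tendsto.ennrpow_const _ h.enorm))
    (C * 2 ^ (r.toReal - 1)) _ (by finiteness) _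
    (err_tend hr1 hrt hu hDm (Fin.append x0 (0 : Rn d)) (2 * l + 1)) fun m => ?_
  set F : Rn (n + d) → ℝ≥0∞ := fun z => ‖u m z‖ₑ ^ r.toReal +
    Gsum l (fun α => multiDeriv α (u m)) z ^ r.toReal with hF
  have hFm : Measurable F := ((hu.1 m).continuous.measurable.enorm.pow_const _).add
    ((Gsum_smooth_meas (hu.1 m) l).pow_const _)
  calc ∫⁻ x in openCube x0 1, ‖u m (Fin.append x 0)‖ₑ ^ r.toReal
      ≤ ∫⁻ x in openCube x0 1, C * ∫⁻ z in Metric.closedBall (0 : Rn d) l, F (Fin.append x z) := by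
        refine lintegral_mono fun x => ?_
        have := H (u m) (hu.1 m) x 0
        simpa only [zero_add] using this
    _ = C * ∫⁻ x in openCube x0 1, ∫⁻ z in Metric.closedBall (0 : Rn d) l, F (Fin.append x z) :=
        lintegral_const_mul' _ _ hC
    _ ≤ C * ∫⁻ x in openCube x0 (2 * l + 1), ∫⁻ z in Metric.closedBall (0 : Rn d) l,
          F (Fin.append x z) := by
        refine mul_le_mul_right (lintegral_mono_set fun x hx i => (hx i).trans_le ?_) _
        have : (0 : ℝ) ≤ l := Nat.cast_nonneg l
        linarith
    _ ≤ C * ∫⁻ z in U, F z := by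
        refine mul_le_mul_right (app_le_cube _ hFm.aemeasurable _ _ _ ?_) _
        have : (0 : ℝ) ≤ l := Nat.cast_nonneg l
        linarith
    _ ≤ C * ∫⁻ z in U, 2 ^ (r.toReal - 1) * ((‖D 0 z‖ₑ ^ r.toReal + Gsum l D z ^ r.toReal) +
          (‖Er (u m) D 0 z‖ₑ ^ r.toReal + Gsum l (Er (u m) D) z ^ r.toReal)) := by
        refine mul_le_mul_right (lintegral_mono fun z => ?_) _
        refine (add_le_add (zero_le_Er (u m) D z _ hr) (Gsum_le_Er (u m) D z _ hr)).trans (le_of_eq ?_)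
        ring
    _ = _ := by
        have a1 : Measurable fun z => ‖D 0 z‖ₑ ^ r.toReal + Gsum l D z ^ r.toReal :=
          (hD0.enorm.pow_const _).add ((Gsum_meas hDm).pow_const _)
        rw [lintegral_const_mul' _ _ h2t, lintegral_add_left a1, mul_assoc]

lemma geom_real (τ c : ℝ) (hτ : 0 < τ) (hc : 0 ≤ c) (a : ℝ) (ha : 0 ≤ a) (N : ℕ) :
    ∑ k ∈ Finset.range N, (if a * 2 ^ k < c then (a * 2 ^ k) ^ τ else 0) ≤
      (1 - (1 / 2 : ℝ) ^ τ)⁻¹ * (min (a * 2 ^ N / 2) c) ^ τ := by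
  have h1 : (1 / 2 : ℝ) ^ τ < 1 := Real.rpow_lt_one (by norm_num) (by norm_num) hτ
  have hA : 0 < (1 - (1 / 2 : ℝ) ^ τ)⁻¹ := inv_pos.2 (by linarith)
  set A := (1 - (1 / 2 : ℝ) ^ τ)⁻¹ with hAd
  have hA1 : A * (1 - (1 / 2 : ℝ) ^ τ) = 1 := inv_mul_cancel₀ (by linarith)
  induction N with
  | zero =>
    simp only [Finset.range_zero, Finset.sum_empty]
    have : 0 ≤ min (a * 2 ^ 0 / 2) c := le_min (by positivity) hc
    positivity
  | succ N ih =>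
    rw [Finset.sum_range_succ]
    have e : a * 2 ^ (N + 1) / 2 = a * 2 ^ N := by ring
    rw [e]
    set b := a * 2 ^ N with hb
    have hb0 : 0 ≤ b := by positivity
    split_ifs with h
    · rw [min_eq_left (by linarith : b / 2 ≤ c)] at ih
      rw [min_eq_left h.le]
      have e2 : (b / 2) ^ τ = b ^ τ * (1 / 2 : ℝ) ^ τ := by
        rw [← Real.mul_rpow hb0 (by norm_num)]; congr 1; ring
      rw [e2] at ih
      have : A * b ^ τ = b ^ τ + A * (b ^ τ * (1 / 2 : ℝ) ^ τ) := by
        linear_combination (b ^ τ) * hA1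
      linarith
    · rw [add_zero]
      refine ih.trans (mul_le_mul_of_nonneg_left (Real.rpow_le_rpow (le_min (by positivity) hc) ?_ hτ.le) hA.le)
      exact min_le_min (by linarith) le_rfl

lemma geom_enn (τ c : ℝ) (hτ : 0 < τ) (hc : 0 ≤ c) (a : ℝ) (ha : 0 ≤ a) :
    ∑' k : ℕ, (if a * 2 ^ k < c then ENNReal.ofReal ((a * 2 ^ k) ^ τ) else 0) ≤
      ENNReal.ofReal ((1 - (1 / 2 : ℝ) ^ τ)⁻¹ * c ^ τ) := by
  have h1 : (1 / 2 : ℝ) ^ τ < 1 := Real.rpow_lt_one (by norm_num) (by norm_num) hτ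
  have hA : 0 < (1 - (1 / 2 : ℝ) ^ τ)⁻¹ := inv_pos.2 (by linarith)
  rw [ENNReal.tsum_eq_iSup_nat]
  refine iSup_le fun N => ?_
  have e : ∀ k, (if a * 2 ^ k < c then ENNReal.ofReal ((a * 2 ^ k) ^ τ) else 0) =
      ENNReal.ofReal (if a * 2 ^ k < c then (a * 2 ^ k) ^ τ else 0) := by
    intro k; split_ifs <;> simp
  simp only [e]
  rw [← ENNReal.ofReal_sum_of_nonneg]
  · refine ENNReal.ofReal_le_ofReal ((geom_real τ c hτ hc a ha N).trans ?_)
    exact mul_le_mul_of_nonneg_left (Real.rpow_le_rpow (le_min (by positivity) hc)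
      (min_le_right _ _) hτ.le) hA.le
  · intro k _; split_ifs <;> positivity

/-- Projection to the horizontal coordinates. -/
def xp {n d : ℕ} (z : Rn (n + d)) : Rn n := fun i => z (Fin.castAdd d i)

lemma tonelli_cube {n d : ℕ} (Φ : Rn (n + d) → ℝ≥0∞) (hΦ : Measurable Φ) (t : ℝ) (ht : 0 < t) :
    ∫⁻ x : Rn n, ∫⁻ z in openCube (Fin.append x (0 : Rn d)) t, Φ z ≤
      ENNReal.ofReal (2 * t) ^ n * ∫⁻ z, (if ‖yp z‖ < t then Φ z else 0) := by
  have hS : MeasurableSet {q : Rn n × Rn (n + d) | ∀ i, |q.2 i - (Fin.append q.1 (0 : Rn d) : Rn (n + d)) i| < t} := by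
    have hm : Measurable fun q : Rn n × Rn (n + d) => (Fin.append q.1 (0 : Rn d) : Rn (n + d)) :=
      meas_app measurable_fst measurable_const
    have : {q : Rn n × Rn (n + d) | ∀ i, |q.2 i - (Fin.append q.1 (0 : Rn d) : Rn (n + d)) i| < t} =
        ⋂ i, {q | |q.2 i - (Fin.append q.1 (0 : Rn d) : Rn (n + d)) i| < t} := by
      ext q; simp
    rw [this]
    refine MeasurableSet.iInter fun i => measurableSet_lt ?_ measurable_const
    have h1 : Measurable fun q : Rn n × Rn (n + d) => (Fin.append q.1 (0 : Rn d) : Rn (n + d)) i :=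
      (measurable_pi_apply i).comp hm
    have h2 : Measurable fun q : Rn n × Rn (n + d) => q.2 i := by fun_prop
    exact (continuous_abs.measurable).comp (h2.sub h1)
  have e : ∀ x : Rn n, ∫⁻ z in openCube (Fin.append x (0 : Rn d)) t, Φ z =
      ∫⁻ z, {q : Rn n × Rn (n + d) | ∀ i, |q.2 i - (Fin.append q.1 (0 : Rn d) : Rn (n + d)) i| < t}.indicator
        (fun q => Φ q.2) (x, z) := by
    intro x
    rw [← lintegral_indicator (measurableSet_openCube _ _)]
    rfl
  simp only [e]
  rw [lintegral_lintegral_swap]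
  swap
  · exact ((hΦ.comp measurable_snd).indicator hS).aemeasurable
  rw [← lintegral_const_mul' _ _ (by finiteness)]
  refine lintegral_mono fun z => ?_
  split_ifs with hz
  · calc _ ≤ ∫⁻ x : Rn n, (openCube (xp z) t).indicator (fun _ => Φ z) x := by
          refine lintegral_mono fun x => ?_
          by_cases hx : x ∈ openCube (xp z) t
          · rw [Set.indicator_of_mem hx]
            exact Set.indicator_apply_le fun _ => le_rfl
          · rw [Set.indicator_of_notMem]
            · exact bot_le
            · intro h
              apply hx
              intro i
              have := h (Fin.castAdd d i)
              simp only [Fin.append_left] at this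
              rw [abs_sub_comm]; exact this
      _ = _ := by
          rw [lintegral_indicator (measurableSet_openCube _ _), setLIntegral_const, volume_openCube,
            mul_comm]
  · rw [mul_zero]
    refine le_of_eq (lintegral_eq_zero_of_ae_eq_zero (ae_of_all _ fun x => ?_))
    refine Set.indicator_of_notMem ?_ _
    intro h
    exact hz (yp_norm_lt (x0 := x) ht h)

/-- The weight. -/
def wt {N : ℕ} (γ : Rn N → ℝ) (P : ℝ) (z : Rn N) : ℝ≥0∞ := ENNReal.ofReal (γ z ^ P)

lemma enorm_rpow_wt {N : ℕ} {γ : Rn N → ℝ} (hγ : IsWeight γ) (P : ℝ) (z : Rn N) :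
    ‖γ z‖ₑ ^ P = wt γ P z := by
  rw [Real.enorm_eq_ofReal (hγ.2 z).le, ENNReal.ofReal_rpow_of_pos (hγ.2 z)]; rfl

lemma wt_meas {N : ℕ} {γ : Rn N → ℝ} (hγ : IsWeight γ) (P : ℝ) : Measurable (wt γ P) := by
  have := hγ.1
  unfold wt; fun_prop

lemma Xi_sub {n d k : ℕ} {m : Fin n → ℤ} {x : Rn n} (hx : x ∈ dyadicCubeHalf n k m) {t : ℝ}
    (ht : (2 : ℝ) ^ (-(k : ℤ)) ≤ t) : Xi n d k m ⊆ openCube (Fin.append x (0 : Rn d)) t := by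
  intro z hz
  obtain ⟨h1, h2, -⟩ := hz
  have e : (2 : ℝ) ^ (-(k : ℤ)) = 1 / 2 ^ k := by rw [zpow_neg, zpow_natCast, one_div]
  rw [e] at ht h2
  intro i
  refine Fin.addCases (fun j => ?_) (fun j => ?_) i
  · simp only [Fin.append_left]
    have a := h1 j
    have b := hx j
    have c : ((m j : ℝ) + 1) / 2 ^ k = m j / 2 ^ k + 1 / 2 ^ k := by ring
    rw [c] at a b
    rw [abs_lt]
    constructor <;> [linarith [a.1, b.2]; linarith [a.2, b.1]]
  · simp only [Fin.append_right, Pi.zero_apply, sub_zero]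
    refine lt_of_le_of_lt ?_ (h2.trans_le ht)
    unfold euclNorm
    refine Real.le_sqrt_of_sq_le ?_
    rw [sq_abs]
    exact Finset.single_le_sum (f := fun i : Fin d => z (Fin.natAdd n i) ^ 2)
      (fun i _ => sq_nonneg _) (Finset.mem_univ j)

lemma gammaSeq_le {n d : ℕ} (p : ℝ≥0∞) (hp1 : 1 < p) (hp : p < ∞) (l : ℕ) {γ : Rn (n + d) → ℝ}
    (hγ : IsWeight γ) (k : ℕ) (x : Rn n) {t : ℝ} (ht : (2 : ℝ) ^ (-(k : ℤ)) ≤ t) :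
    gammaSeq n d p l γ k x ^ p.toReal ≤ ENNReal.ofReal ((2 : ℝ) ^ (-(k : ℤ))) ^ (-(l * p.toReal + n)) *
      ∫⁻ z in openCube (Fin.append x (0 : Rn d)) t, wt γ p.toReal z := by
  have hP : 0 < p.toReal := ENNReal.toReal_pos (by positivity) hp.ne
  unfold gammaSeq
  set m0 : Fin n → ℤ := fun i => ⌊x i * 2 ^ k⌋ with hm0
  have h2k : (0 : ℝ) < 2 ^ k := by positivity
  have hx0 : x ∈ dyadicCubeHalf n k m0 := by
    intro i
    rw [div_le_iff₀ h2k, lt_div_iff₀ h2k]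
    exact ⟨Int.floor_le _, Int.lt_floor_add_one _⟩
  rw [tsum_eq_single m0]
  swap
  · intro m hm
    rw [Set.indicator_of_notMem]
    intro h
    apply hm
    funext i
    have := h i
    rw [div_le_iff₀ h2k, lt_div_iff₀ h2k] at this
    exact (Int.floor_eq_iff.2 this).symm
  rw [Set.indicator_of_mem hx0, ENNReal.mul_rpow_of_nonneg _ _ hP.le]
  refine mul_le_mul' (le_of_eq ?_) ?_
  · have e1 : ENNReal.ofReal ((2 : ℝ) ^ (-(k : ℤ))) = (2 : ℝ≥0∞) ^ (-(k : ℝ)) := by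
      have : ((2 : ℝ) ^ (-(k : ℤ))) = (2 : ℝ) ^ (-(k : ℝ)) := by
        rw [Real.rpow_neg (by norm_num), Real.rpow_natCast, zpow_neg, zpow_natCast]
      rw [this, ← ENNReal.ofReal_rpow_of_pos (by norm_num)]
      simp
    rw [e1, ← ENNReal.rpow_mul, ← ENNReal.rpow_mul]
    congr 1
    field_simp
  · unfold gammaHat
    rw [eLpNorm_eq_lintegral_rpow_enorm_toReal (by positivity) hp.ne, ← ENNReal.rpow_mul,
      one_div_mul_cancel hP.ne', ENNReal.rpow_one]
    simp only [enorm_rpow_wt hγ]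
    exact lintegral_mono_set (Xi_sub hx0 ht)

lemma alg_main {n d l : ℕ} {R P : ℝ} (hR : 1 ≤ R) (hRP : R < P) {σ T I J w M C C2 c : ℝ≥0∞}
    (hσ0 : σ ≠ 0) (hσt : σ ≠ ∞)
    (hT : T ^ P ≤ σ ^ (-(l * P + n)) * w)
    (hI : (2⁻¹ * σ) ^ d * I ≤ C * (σ ^ l) ^ R * (4 * σ) ^ n * J)
    (hw : w * J ^ (P / R) ≤ C2 * ((c * σ) ^ (n + d)) ^ (P / R) * M) :
    (T * ((2 * σ) ^ (-(2 * (n : ℝ)) / R) * I ^ (1 / R))) ^ P ≤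
      ((2 ^ (-(2 * (n : ℝ)) / R)) ^ P * (2 ^ d * C * 4 ^ n) ^ (P / R) * C2 * (c ^ (n + d)) ^ (P / R)) *
        σ ^ (-(n : ℝ)) * M := by
  have hR0 : 0 < R := by linarith
  have hP0 : 0 < P := by linarith
  have hq0 : 0 ≤ P / R := by positivity
  have hI2 : I ≤ (2 ^ d * C * 4 ^ n) * σ ^ (l * R + n - d) * J := by
    have e1 : I = (2 ^ d * (σ ^ d)⁻¹) * ((2⁻¹ * σ) ^ d * I) := by
      have h1 : (2 : ℝ≥0∞) ^ d * 2⁻¹ ^ d = 1 := by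
        rw [← mul_pow, ENNReal.mul_inv_cancel (by simp) (by simp), one_pow]
      have h2 : (σ ^ d)⁻¹ * σ ^ d = 1 := ENNReal.inv_mul_cancel (pow_ne_zero _ hσ0) (by finiteness)
      calc I = ((2 : ℝ≥0∞) ^ d * 2⁻¹ ^ d) * ((σ ^ d)⁻¹ * σ ^ d) * I := by rw [h1, h2]; simp
        _ = _ := by rw [mul_pow]; ring
    rw [e1]
    refine (mul_le_mul_right hI _).trans (le_of_eq ?_)
    have e2 : σ ^ (l * R + n - d) = (σ ^ l) ^ R * σ ^ n * (σ ^ d)⁻¹ := by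
      rw [sub_eq_add_neg, ENNReal.rpow_add _ _ hσ0 hσt, ENNReal.rpow_add _ _ hσ0 hσt,
        ENNReal.rpow_neg, ENNReal.rpow_natCast, ENNReal.rpow_natCast, ENNReal.rpow_mul,
        ENNReal.rpow_natCast]
    rw [e2, mul_pow]; ring
  have e3 : (T * ((2 * σ) ^ (-(2 * (n : ℝ)) / R) * I ^ (1 / R))) ^ P =
      T ^ P * ((2 ^ (-(2 * (n : ℝ)) / R)) ^ P * σ ^ (-(2 * (n : ℝ)) / R * P) * I ^ (P / R)) := by
    rw [ENNReal.mul_rpow_of_nonneg _ _ hP0.le, ENNReal.mul_rpow_of_nonneg _ _ hP0.le,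
      ENNReal.mul_rpow_of_ne_top (by simp) hσt, ENNReal.mul_rpow_of_nonneg _ _ hP0.le,
      ← ENNReal.rpow_mul σ, ← ENNReal.rpow_mul I, show 1 / R * P = P / R by ring]
  have hI3 : I ^ (P / R) ≤ (2 ^ d * C * 4 ^ n) ^ (P / R) * σ ^ ((l * R + n - d) * (P / R)) *
      J ^ (P / R) := by
    refine (ENNReal.rpow_le_rpow hI2 hq0).trans (le_of_eq ?_)
    rw [ENNReal.mul_rpow_of_nonneg _ _ hq0, ENNReal.mul_rpow_of_nonneg _ _ hq0, ← ENNReal.rpow_mul σ]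
  have e4 : ((c * σ) ^ (n + d)) ^ (P / R) = (c ^ (n + d)) ^ (P / R) * σ ^ (((n : ℝ) + d) * (P / R)) := by
    rw [mul_pow, ENNReal.mul_rpow_of_nonneg _ _ hq0, ENNReal.rpow_mul]
    congr 2
    rw [← Nat.cast_add, ENNReal.rpow_natCast]
  rw [e3]
  rw [e4] at hw
  have e5 : σ ^ (-(n : ℝ)) = σ ^ (-(l * P + n)) * σ ^ (-(2 * (n : ℝ)) / R * P) *
      σ ^ ((l * R + n - d) * (P / R)) * σ ^ (((n : ℝ) + d) * (P / R)) := by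
    rw [← ENNReal.rpow_add _ _ hσ0 hσt, ← ENNReal.rpow_add _ _ hσ0 hσt, ← ENNReal.rpow_add _ _ hσ0 hσt]
    congr 1
    field_simp
    ring
  calc _ ≤ (σ ^ (-(l * P + n)) * w) * ((2 ^ (-(2 * (n : ℝ)) / R)) ^ P * σ ^ (-(2 * (n : ℝ)) / R * P) *
        ((2 ^ d * C * 4 ^ n) ^ (P / R) * σ ^ ((l * R + n - d) * (P / R)) * J ^ (P / R))) := by
        gcongr
    _ = ((2 ^ (-(2 * (n : ℝ)) / R)) ^ P * (2 ^ d * C * 4 ^ n) ^ (P / R)) *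
        (σ ^ (-(l * P + n)) * σ ^ (-(2 * (n : ℝ)) / R * P) * σ ^ ((l * R + n - d) * (P / R))) *
        (w * J ^ (P / R)) := by ring
    _ ≤ ((2 ^ (-(2 * (n : ℝ)) / R)) ^ P * (2 ^ d * C * 4 ^ n) ^ (P / R)) *
        (σ ^ (-(l * P + n)) * σ ^ (-(2 * (n : ℝ)) / R * P) * σ ^ ((l * R + n - d) * (P / R))) *
        (C2 * ((c ^ (n + d)) ^ (P / R) * σ ^ (((n : ℝ) + d) * (P / R))) * M) :=
        mul_le_mul_right hw _
    _ = _ := by rw [e5]; ring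

/-- WP on centred cubes. -/
lemma WP_center {N : ℕ} {w : Rn N → ℝ≥0∞} {q L : ℝ} {C : ℝ≥0∞} (H : WP N w q L C) (x : Rn N) (t : ℝ)
    (ht : 0 < t) (htL : 2 * t ≤ L) (g : Rn N → ℝ≥0∞) (hg : AEMeasurable g volume) :
    (∫⁻ z in openCube x t, w z) * (∫⁻ z in openCube x t, g z) ^ q ≤
      C * (ENNReal.ofReal (2 * t) ^ N) ^ q * ∫⁻ z in openCube x t, g z ^ q * w z := by
  have := H (fun i => x i - t) (2 * t) (by linarith) htL g hg
  rwa [← openCube_eq_cubeAt, volume_openCube] at this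

/-- Local `L_r` integrability. -/
lemma local_Lr {N : ℕ} {γ : Rn N → ℝ} (hγ : IsWeight γ) {P : ℝ} {r : ℝ≥0∞} (hr1 : 1 ≤ r) (hrt : r ≠ ∞)
    (hrP : r.toReal < P) (hWP : ∀ L : ℝ, ∃ C : ℝ≥0∞, C ≠ ∞ ∧ WP N (wt γ P) (P / r.toReal) L C)
    (g : Rn N → ℝ) (hg : Measurable g) (hfin : ∫⁻ z, ‖g z‖ₑ ^ P * wt γ P z ≠ ∞) (R : ℝ) :
    eLpNorm g r (volume.restrict (Metric.ball 0 R)) < ∞ := by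
  have hr : 1 ≤ r.toReal := by
    have := ENNReal.toReal_mono hrt hr1
    simpa using this
  have hq : 0 < P / r.toReal := div_pos (by linarith) (by linarith)
  have h0 : r ≠ 0 := (lt_of_lt_of_le one_pos hr1).ne'
  set t := |R| + 1 with ht
  have ht0 : 0 < t := by positivity
  obtain ⟨C, hC, H⟩ := hWP (2 * t)
  have h := WP_center H 0 t ht0 le_rfl (fun z => ‖g z‖ₑ ^ r.toReal) (hg.enorm.pow_const _).aemeasurable
  have hsub : Metric.ball (0 : Rn N) R ⊆ openCube 0 t := by
    rw [openCube_eq_ball ht0]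
    exact Metric.ball_subset_ball (by rw [ht]; linarith [le_abs_self R])
  have hpos : ∫⁻ z in openCube (0 : Rn N) t, wt γ P z ≠ 0 := by
    have : 0 < ∫⁻ z in openCube (0 : Rn N) t, wt γ P z := by
      rw [setLIntegral_pos_iff (wt_meas hγ P)]
      have e : Function.support (wt γ P) = Set.univ := by
        ext z
        simp only [Function.mem_support, Set.mem_univ, iff_true]
        unfold wt
        simpa using Real.rpow_pos_of_pos (hγ.2 z) P
      rw [e, Set.univ_inter, volume_openCube]
      exact ENNReal.pow_pos (by simpa using ht0) _
    exact this.ne'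
  have hR : C * (ENNReal.ofReal (2 * t) ^ N) ^ (P / r.toReal) *
      ∫⁻ z in openCube (0 : Rn N) t, (‖g z‖ₑ ^ r.toReal) ^ (P / r.toReal) * wt γ P z ≠ ∞ := by
    refine ENNReal.mul_ne_top (ENNReal.mul_ne_top hC
      (ENNReal.rpow_ne_top_of_nonneg hq.le (by finiteness))) ?_
    refine ne_top_of_le_ne_top hfin ((setLIntegral_le_lintegral _ _).trans (lintegral_mono fun z => ?_))
    rw [← ENNReal.rpow_mul, mul_div_cancel₀ _ (by linarith : r.toReal ≠ 0)]
  have hI : ∫⁻ z in openCube (0 : Rn N) t, ‖g z‖ₑ ^ r.toReal ≠ ∞ := by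
    intro hI
    rw [hI, ENNReal.top_rpow_of_pos hq, ENNReal.mul_top hpos] at h
    exact hR (top_le_iff.1 h)
  rw [eLpNorm_eq_lintegral_rpow_enorm_toReal h0 hrt]
  refine ENNReal.rpow_lt_top_of_nonneg (by positivity) ?_
  exact ne_top_of_le_ne_top hI (lintegral_mono_set hsub)

/-- Total weighted energy. -/
def Hen {N : ℕ} (l : ℕ) (P : ℝ) (γ : Rn N → ℝ) (D : (Fin N → ℕ) → Rn N → ℝ) : ℝ≥0∞ :=
  ∫⁻ z, (‖D 0 z‖ₑ ^ P + Gsum l D z ^ P) * wt γ P z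

lemma Hen_le {N l : ℕ} {p : ℝ≥0∞} (hp1 : 1 < p) (hp : p < ∞) {γ : Rn N → ℝ} (hγ : IsWeight γ)
    {D : (Fin N → ℕ) → Rn N → ℝ} (hDm : ∀ o, Measurable (D (ix l o))) :
    Hen l p.toReal γ D ≤ cK N l ^ (p.toReal - 1) * cK N l * sobNorm N p l γ D ^ p.toReal := by
  have hP : 1 ≤ p.toReal := by
    have := ENNReal.toReal_mono hp.ne hp1.le
    simpa using this
  have hb : ∀ o, ∫⁻ z, ‖D (ix l o) z‖ₑ ^ p.toReal * wt γ p.toReal z ≤ sobNorm N p l γ D ^ p.toReal := by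
    intro o
    have h1 : eLpNorm (fun x => γ x * D (ix l o) x) p volume ≤ sobNorm N p l γ D := by
      unfold sobNorm
      refine le_trans ?_ (ENNReal.le_tsum (ix l o))
      rw [if_pos (ix_sum o)]
    rw [eLpNorm_eq_lintegral_rpow_enorm_toReal (by positivity) hp.ne, rpow_one_div_le' (by linarith)] at h1
    refine le_trans (le_of_eq (lintegral_congr fun z => ?_)) h1
    rw [enorm_mul, ENNReal.mul_rpow_of_nonneg _ _ (by linarith), enorm_rpow_wt hγ, mul_comm]
  unfold Hen
  calc _ ≤ ∫⁻ z, cK N l ^ (p.toReal - 1) * ∑ o, ‖D (ix l o) z‖ₑ ^ p.toReal * wt γ p.toReal z := by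
        refine lintegral_mono fun z => ?_
        rw [← Finset.sum_mul, ← mul_assoc]
        exact mul_le_mul_left (ix_pow_le _ hP D z) _
    _ = cK N l ^ (p.toReal - 1) * ∑ o, ∫⁻ z, ‖D (ix l o) z‖ₑ ^ p.toReal * wt γ p.toReal z := by
        rw [lintegral_const_mul' _ _ (ENNReal.rpow_ne_top_of_nonneg (by linarith) (cK_ne_top N l)),
          lintegral_finsetSum]
        exact fun o _ => ((hDm o).enorm.pow_const _).mul (wt_meas hγ _)
    _ ≤ cK N l ^ (p.toReal - 1) * ∑ o : Option (Fin l → Fin N), sobNorm N p l γ D ^ p.toReal := by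
        gcongr with o; exact hb o
    _ = _ := by
        rw [Finset.sum_const, nsmul_eq_mul, mul_assoc]; rfl

lemma term_k {n d : ℕ} (l : ℕ) (p r : ℝ≥0∞) (hp1 : 1 < p) (hp : p < ∞) (hr1 : 1 ≤ r)
    (hrp : r < p) {γ : Rn (n + d) → ℝ} (hγ : IsWeight γ) (C C2 : ℝ≥0∞)
    (D : (Fin (n + d) → ℕ) → Rn (n + d) → ℝ) (hDm : ∀ o, Measurable (D (ix l o))) (φ : Rn n → ℝ)
    (hB : ∀ (s : ℝ), 0 < s → ∀ x0 : Rn n, ENNReal.ofReal (s / 2) ^ d *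
      (∫⁻ hx, ‖diffl l hx.1 φ hx.2‖ₑ ^ r.toReal
        ∂((volume.restrict (openCube (0 : Rn n) (2 * s))).prod (volume.restrict (openCube x0 s)))) ≤
        C * (ENNReal.ofReal s ^ l) ^ r.toReal * ENNReal.ofReal (4 * s) ^ n *
        Kint l r.toReal s (Gsum l D) x0)
    (hC : C ≠ ∞) (hC2 : C2 ≠ ∞)
    (hW : WP (n + d) (wt γ p.toReal) (p.toReal / r.toReal) (2 * (2 * l + 1)) C2) (k : ℕ) :
    ∫⁻ x, (gammaSeq n d p l γ (k + 1) x *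
        deltaE n l r ((2 : ℝ) ^ (1 - ((k : ℤ) + 1))) (openCube x ((2 : ℝ) ^ (-((k : ℤ) + 1)))) φ)
        ^ p.toReal ≤
      (((2 ^ (-(2 * (n : ℝ)) / r.toReal)) ^ p.toReal * (2 ^ d * C * 4 ^ n) ^ (p.toReal / r.toReal) *
        C2 * (ENNReal.ofReal (2 * (2 * l + 1)) ^ (n + d)) ^ (p.toReal / r.toReal)) *
        ENNReal.ofReal (2 * (2 * l + 1)) ^ n) *
      ∫⁻ z, (if 2 * ‖yp z‖ * 2 ^ k < 2 * l + 1 then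
        ENNReal.ofReal ((2 * ‖yp z‖ * 2 ^ k) ^ (thE d l r.toReal * (p.toReal / r.toReal))) else 0) *
        (Gsum l D z ^ p.toReal * wt γ p.toReal z) := by
  have hrt : r ≠ ∞ := (hrp.trans hp).ne
  have hR : 1 ≤ r.toReal := by
    have := ENNReal.toReal_mono hrt hr1
    simpa using this
  have hRP : r.toReal < p.toReal := (ENNReal.toReal_lt_toReal hrt hp.ne).2 hrp
  have h0 : r ≠ 0 := (lt_of_lt_of_le one_pos hr1).ne'
  have hq : 0 ≤ p.toReal / r.toReal := div_nonneg (by linarith) (by linarith)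
  set s : ℝ := (2 : ℝ) ^ (-((k : ℤ) + 1)) with hs
  have hs0 : 0 < s := by positivity
  have hs1 : s ≤ 1 := zpow_le_one_of_nonpos₀ (by norm_num) (by omega)
  have hsinv : ∀ a : ℝ, a / s = 2 * a * 2 ^ k := by
    intro a
    rw [hs, zpow_neg, div_inv_eq_mul, zpow_add₀ (by norm_num), zpow_natCast]; simp; ring
  have e2s : (2 : ℝ) ^ (1 - ((k : ℤ) + 1)) = 2 * s := by
    rw [hs, sub_eq_add_neg, zpow_add₀ (by norm_num), zpow_one]
  set t : ℝ := (2 * l + 1) * s with ht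
  have ht0 : 0 < t := by positivity
  have hst : s ≤ t := by
    have : (0 : ℝ) ≤ l := Nat.cast_nonneg l
    nlinarith
  have htL : 2 * t ≤ 2 * (2 * l + 1) := by
    have : (0 : ℝ) ≤ l := Nat.cast_nonneg l
    nlinarith
  set σ := ENNReal.ofReal s with hσ
  have hσ0 : σ ≠ 0 := by simpa [hσ] using hs0
  have hσt : σ ≠ ∞ := ENNReal.ofReal_ne_top
  set c : ℝ≥0∞ := ENNReal.ofReal (2 * (2 * l + 1)) with hc
  have hcσ : ENNReal.ofReal (2 * t) = c * σ := by
    rw [hc, hσ, ← ENNReal.ofReal_mul (by positivity)]; congr 1; rw [ht]; ring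
  set θ := thE d l r.toReal with hθ
  set q := p.toReal / r.toReal with hqd
  have hGm := Gsum_meas hDm
  set g : Rn (n + d) → ℝ≥0∞ := fun z => Wt θ s (yp z) * Gsum l D z ^ r.toReal with hg
  have hgm : Measurable g := ((Wt_meas _ _).comp yp_meas).mul (hGm.pow_const _)
  set A := ((2 : ℝ≥0∞) ^ (-(2 * (n : ℝ)) / r.toReal)) ^ p.toReal * (2 ^ d * C * 4 ^ n) ^ q *
        C2 * (c ^ (n + d)) ^ q with hA
  have hAt : A ≠ ∞ := by
    have h1 : ((2 : ℝ≥0∞) ^ (-(2 * (n : ℝ)) / r.toReal)) ^ p.toReal ≠ ∞ :=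
      ENNReal.rpow_ne_top_of_nonneg (by linarith) (ENNReal.rpow_ne_top_of_ne_zero (by simp) (by simp))
    have h2 : (2 ^ d * C * 4 ^ n) ^ q ≠ ∞ := ENNReal.rpow_ne_top_of_nonneg hq (by finiteness)
    have h3 : (c ^ (n + d)) ^ q ≠ ∞ := ENNReal.rpow_ne_top_of_nonneg hq (by finiteness)
    finiteness
  have hpt : ∀ x : Rn n, (gammaSeq n d p l γ (k + 1) x *
        deltaE n l r ((2 : ℝ) ^ (1 - ((k : ℤ) + 1))) (openCube x s) φ) ^ p.toReal ≤
      A * σ ^ (-(n : ℝ)) * ∫⁻ z in openCube (Fin.append x (0 : Rn d)) t, g z ^ q * wt γ p.toReal z := by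
    intro x
    have hT := gammaSeq_le p hp1 hp l hγ (k + 1) x (t := t) (by push_cast; exact hst)
    have hI := hB s hs0 x
    have hw := WP_center hW (Fin.append x (0 : Rn d)) t ht0 htL g hgm.aemeasurable
    rw [hcσ] at hw
    have e3 : ENNReal.ofReal (s / 2) = 2⁻¹ * σ := by
      rw [div_eq_inv_mul, ENNReal.ofReal_mul (by positivity), ENNReal.ofReal_inv_of_pos (by norm_num)]
      simp [hσ]
    have e4 : ENNReal.ofReal (4 * s) = 4 * σ := by
      rw [ENNReal.ofReal_mul (by positivity)]; simp [hσ]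
    have e5 : ENNReal.ofReal (2 * s) = 2 * σ := by
      rw [ENNReal.ofReal_mul (by positivity)]; simp [hσ]
    rw [e3, e4] at hI
    push_cast at hT
    have := alg_main hR hRP hσ0 hσt hT hI hw
    unfold deltaE
    rw [e2s, e5, eLpNorm_eq_lintegral_rpow_enorm_toReal h0 hrt]
    exact this
  calc _ ≤ ∫⁻ x : Rn n, A * σ ^ (-(n : ℝ)) *
        ∫⁻ z in openCube (Fin.append x (0 : Rn d)) t, g z ^ q * wt γ p.toReal z := lintegral_mono hpt
    _ = A * σ ^ (-(n : ℝ)) * ∫⁻ x : Rn n,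
        ∫⁻ z in openCube (Fin.append x (0 : Rn d)) t, g z ^ q * wt γ p.toReal z := by
        refine lintegral_const_mul' _ _ (ENNReal.mul_ne_top hAt ?_)
        exact ENNReal.rpow_ne_top_of_ne_zero hσ0 hσt
    _ ≤ A * σ ^ (-(n : ℝ)) * ((c * σ) ^ n * ∫⁻ z, (if ‖yp z‖ < t then g z ^ q * wt γ p.toReal z else 0)) := by
        rw [← hcσ]
        exact mul_le_mul_right (tonelli_cube _ ((hgm.pow_const _).mul (wt_meas hγ _)) t ht0) _
    _ = A * c ^ n * ∫⁻ z, (if ‖yp z‖ < t then g z ^ q * wt γ p.toReal z else 0) := by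
        have : σ ^ (-(n : ℝ)) * σ ^ n = 1 := by
          rw [ENNReal.rpow_neg, ENNReal.rpow_natCast]
          exact ENNReal.inv_mul_cancel (pow_ne_zero _ hσ0) (by finiteness)
        calc _ = A * c ^ n * (σ ^ (-(n : ℝ)) * σ ^ n) *
              ∫⁻ z, (if ‖yp z‖ < t then g z ^ q * wt γ p.toReal z else 0) := by
              rw [mul_pow]; ring
          _ = _ := by rw [this, mul_one]
    _ = _ := by
        congr 1
        refine lintegral_congr fun z => ?_
        have hiff : ‖yp z‖ < t ↔ 2 * ‖yp z‖ * 2 ^ k < 2 * l + 1 := by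
          rw [← hsinv, div_lt_iff₀ hs0]
        simp only [hiff]
        split_ifs with h
        · rw [hg]
          simp only
          unfold Wt
          rw [hsinv, ENNReal.mul_rpow_of_nonneg _ _ hq, ENNReal.ofReal_rpow_of_nonneg (by positivity) hq,
            ← Real.rpow_mul (by positivity), ← ENNReal.rpow_mul, hqd,
            mul_div_cancel₀ _ (by linarith : r.toReal ≠ 0), mul_assoc]
        · simp

lemma sum_k {n d : ℕ} (l : ℕ) (P R : ℝ) (hR : 1 ≤ R) (hRP : R < P) (hk : (d : ℝ) / R < l)
    {γ : Rn (n + d) → ℝ} (hγ : IsWeight γ) 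
    (D : (Fin (n + d) → ℕ) → Rn (n + d) → ℝ) (hDm : ∀ o, Measurable (D (ix l o))) (a : ℕ → ℝ≥0∞)
    (A : ℝ≥0∞) 
    (ha : ∀ k, a k ≤ A * ∫⁻ z, (if 2 * ‖yp z‖ * 2 ^ k < 2 * l + 1 then
        ENNReal.ofReal ((2 * ‖yp z‖ * 2 ^ k) ^ (thE d l R * (P / R))) else 0) *
        (Gsum l D z ^ P * wt γ P z)) :
    ∑' k, a k ≤ A * ENNReal.ofReal ((1 - (1 / 2 : ℝ) ^ (thE d l R * (P / R)))⁻¹ *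
        (2 * l + 1) ^ (thE d l R * (P / R))) * Hen l P γ D := by
  have hτ : 0 < thE d l R * (P / R) := mul_pos (thE_pos hR hk) (div_pos (by linarith) (by linarith))
  set τ := thE d l R * (P / R)
  have hGm := Gsum_meas hDm
  have hm : ∀ k : ℕ, Measurable fun z : Rn (n + d) => (if 2 * ‖yp z‖ * 2 ^ k < 2 * l + 1 then
        ENNReal.ofReal ((2 * ‖yp z‖ * 2 ^ k) ^ τ) else 0) := by
    intro k
    have h1 : Measurable fun z : Rn (n + d) => 2 * ‖yp z‖ * 2 ^ k :=
      (yp_meas.norm.const_mul 2).mul_const _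
    exact Measurable.ite (measurableSet_lt h1 measurable_const) (by fun_prop) measurable_const
  have hm2 : Measurable fun z => Gsum l D z ^ P * wt γ P z := (hGm.pow_const _).mul (wt_meas hγ _)
  refine (ENNReal.tsum_le_tsum ha).trans ?_
  rw [ENNReal.tsum_mul_left, mul_assoc]
  refine mul_le_mul_right ?_ _
  have hm3 : ∀ k : ℕ, AEMeasurable (fun z : Rn (n + d) =>
      (if 2 * ‖yp z‖ * 2 ^ k < 2 * l + 1 then
        ENNReal.ofReal ((2 * ‖yp z‖ * 2 ^ k) ^ τ) else 0) * (Gsum l D z ^ P * wt γ P z)) volume :=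
    fun k => ((hm k).mul hm2).aemeasurable
  rw [← lintegral_tsum hm3]
  unfold Hen
  rw [← lintegral_const_mul' _ _ ENNReal.ofReal_ne_top]
  refine lintegral_mono fun z => ?_
  simp only
  rw [ENNReal.tsum_mul_right]
  refine mul_le_mul' (geom_enn τ (2 * l + 1) hτ (by positivity) (2 * ‖yp z‖) (by positivity)) ?_
  exact mul_le_mul_left le_add_self _

lemma term_0 {n d : ℕ} (l : ℕ) (p r : ℝ≥0∞) (hp1 : 1 < p) (hp : p < ∞) (hr1 : 1 ≤ r)
    (hrp : r < p) {γ : Rn (n + d) → ℝ} (hγ : IsWeight γ) (C C2 : ℝ≥0∞)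
    (D : (Fin (n + d) → ℕ) → Rn (n + d) → ℝ) (hDm : ∀ o, Measurable (D (ix l o))) (φ : Rn n → ℝ)
    (hB : ∀ x0 : Rn n, ∫⁻ x in openCube x0 1, ‖φ x‖ₑ ^ r.toReal ≤
      C * ∫⁻ z in openCube (Fin.append x0 (0 : Rn d)) (2 * l + 1),
        (‖D 0 z‖ₑ ^ r.toReal + Gsum l D z ^ r.toReal))
    (hC : C ≠ ∞) (hC2 : C2 ≠ ∞)
    (hW : WP (n + d) (wt γ p.toReal) (p.toReal / r.toReal) (2 * (2 * l + 1)) C2) :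
    ∫⁻ x, (gammaSeq n d p l γ 0 x * eLpNorm φ r (volume.restrict (openCube x 1))) ^ p.toReal ≤
      (C ^ (p.toReal / r.toReal) *
        (C2 * (ENNReal.ofReal (2 * (2 * l + 1)) ^ (n + d)) ^ (p.toReal / r.toReal))) *
        ENNReal.ofReal (2 * (2 * l + 1)) ^ n * 2 ^ (p.toReal / r.toReal - 1) * Hen l p.toReal γ D := by
  have hrt : r ≠ ∞ := (hrp.trans hp).ne
  have hR : 1 ≤ r.toReal := by
    have := ENNReal.toReal_mono hrt hr1
    simpa using this
  have hRP : r.toReal < p.toReal := (ENNReal.toReal_lt_toReal hrt hp.ne).2 hrp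
  have h0 : r ≠ 0 := (lt_of_lt_of_le one_pos hr1).ne'
  have hP0 : 0 < p.toReal := by linarith
  have hq1 : 1 ≤ p.toReal / r.toReal := by rw [le_div_iff₀ (by linarith)]; linarith
  have ht0 : (0 : ℝ) < 2 * l + 1 := by positivity
  set q := p.toReal / r.toReal with hqd
  have hq : 0 ≤ q := by linarith
  have hGm := Gsum_meas hDm
  have hD0 : Measurable (D 0) := hDm none
  set g : Rn (n + d) → ℝ≥0∞ := fun z => ‖D 0 z‖ₑ ^ r.toReal + Gsum l D z ^ r.toReal with hg
  have hgm : Measurable g := (hD0.enorm.pow_const _).add (hGm.pow_const _)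
  set c : ℝ≥0∞ := ENNReal.ofReal (2 * (2 * l + 1)) with hc
  set A := C ^ q * (C2 * (c ^ (n + d)) ^ q) with hA
  have hAt : A ≠ ∞ := by
    have h2 : C ^ q ≠ ∞ := ENNReal.rpow_ne_top_of_nonneg hq hC
    have h3 : (c ^ (n + d)) ^ q ≠ ∞ := ENNReal.rpow_ne_top_of_nonneg hq (by finiteness)
    finiteness
  have hpt : ∀ x : Rn n, (gammaSeq n d p l γ 0 x * eLpNorm φ r (volume.restrict (openCube x 1))) ^ p.toReal ≤
      A * ∫⁻ z in openCube (Fin.append x (0 : Rn d)) (2 * l + 1), g z ^ q * wt γ p.toReal z := by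
    intro x
    have hT := gammaSeq_le p hp1 hp l hγ 0 x (t := 2 * l + 1) (by simp)
    simp only [Nat.cast_zero, neg_zero, zpow_zero, ENNReal.ofReal_one, ENNReal.one_rpow, one_mul] at hT
    have hw := WP_center hW (Fin.append x (0 : Rn d)) (2 * l + 1) ht0 le_rfl g hgm.aemeasurable
    rw [ENNReal.mul_rpow_of_nonneg _ _ hP0.le, eLpNorm_eq_lintegral_rpow_enorm_toReal h0 hrt,
      ← ENNReal.rpow_mul, show 1 / r.toReal * p.toReal = q by rw [hqd]; ring]
    calc _ ≤ (∫⁻ z in openCube (Fin.append x (0 : Rn d)) (2 * l + 1), wt γ p.toReal z) *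
          (C * ∫⁻ z in openCube (Fin.append x (0 : Rn d)) (2 * l + 1), g z) ^ q :=
          mul_le_mul' hT (ENNReal.rpow_le_rpow (hB x) hq)
      _ = C ^ q * ((∫⁻ z in openCube (Fin.append x (0 : Rn d)) (2 * l + 1), wt γ p.toReal z) *
          (∫⁻ z in openCube (Fin.append x (0 : Rn d)) (2 * l + 1), g z) ^ q) := by
          rw [ENNReal.mul_rpow_of_nonneg _ _ hq]; ring
      _ ≤ _ := mul_le_mul_right hw _
      _ = _ := by rw [hA]; ring
  calc _ ≤ ∫⁻ x : Rn n, A *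
        ∫⁻ z in openCube (Fin.append x (0 : Rn d)) (2 * l + 1), g z ^ q * wt γ p.toReal z := lintegral_mono hpt
    _ = A * ∫⁻ x : Rn n,
        ∫⁻ z in openCube (Fin.append x (0 : Rn d)) (2 * l + 1), g z ^ q * wt γ p.toReal z :=
        lintegral_const_mul' _ _ hAt
    _ ≤ A * (c ^ n * ∫⁻ z, (if ‖yp z‖ < 2 * l + 1 then g z ^ q * wt γ p.toReal z else 0)) :=
        mul_le_mul_right (tonelli_cube _ ((hgm.pow_const _).mul (wt_meas hγ _)) _ ht0) _
    _ ≤ A * (c ^ n * ∫⁻ z, 2 ^ (q - 1) * ((‖D 0 z‖ₑ ^ p.toReal + Gsum l D z ^ p.toReal) *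
          wt γ p.toReal z)) := by
        refine mul_le_mul_right (mul_le_mul_right (lintegral_mono fun z => ?_) _) _
        simp only
        split_ifs
        · rw [← mul_assoc]
          refine mul_le_mul_left ((ENNReal.rpow_add_le_mul_rpow_add_rpow _ _ hq1).trans (le_of_eq ?_)) _
          rw [← ENNReal.rpow_mul, ← ENNReal.rpow_mul, hqd, mul_div_cancel₀ _ (by linarith : r.toReal ≠ 0)]
        · exact bot_le
    _ = _ := by
        rw [lintegral_const_mul' _ _ (ENNReal.rpow_ne_top_of_nonneg (by linarith) (by simp))]
        unfold Hen
        ring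

lemma sob_term_le {N l : ℕ} {p : ℝ≥0∞} (hp1 : 1 < p) (hp : p < ∞) {γ : Rn N → ℝ} (hγ : IsWeight γ)
    {D : (Fin N → ℕ) → Rn N → ℝ} (o : Option (Fin l → Fin N)) :
    ∫⁻ z, ‖D (ix l o) z‖ₑ ^ p.toReal * wt γ p.toReal z ≤ sobNorm N p l γ D ^ p.toReal := by
  have hP : 1 ≤ p.toReal := by
    have := ENNReal.toReal_mono hp.ne hp1.le
    simpa using this
  have h1 : eLpNorm (fun x => γ x * D (ix l o) x) p volume ≤ sobNorm N p l γ D := by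
    unfold sobNorm
    refine le_trans ?_ (ENNReal.le_tsum (ix l o))
    rw [if_pos (ix_sum o)]
  rw [eLpNorm_eq_lintegral_rpow_enorm_toReal (by positivity) hp.ne, rpow_one_div_le' (by linarith)] at h1
  refine le_trans (le_of_eq (lintegral_congr fun z => ?_)) h1
  rw [enorm_mul, ENNReal.mul_rpow_of_nonneg _ _ (by linarith), enorm_rpow_wt hγ, mul_comm]

lemma meas_rep {N l : ℕ} {p : ℝ≥0∞} {γ : Rn N → ℝ} {f : Rn N → ℝ}
    {D : (Fin N → ℕ) → Rn N → ℝ} (h : MemW N p l γ f D) :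
    ∃ D' : (Fin N → ℕ) → Rn N → ℝ, (∀ o, Measurable (D' (ix l o))) ∧ D' 0 =ᵐ[volume] f ∧
      (∀ α : Fin N → ℕ, (∑ i, α i) ≤ l → LocallyIntegrable (D' α) volume ∧ IsWeakDeriv α f (D' α)) ∧
      sobNorm N p l γ D' = sobNorm N p l γ D := by
  obtain ⟨hf, h0, hD, hs⟩ := h
  have hm : ∀ α : Fin N → ℕ, ∃ g : Rn N → ℝ, (∑ i, α i) ≤ l → Measurable g ∧ D α =ᵐ[volume] g := by
    intro α
    by_cases ha : (∑ i, α i) ≤ l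
    · have h1 := (hD α ha).1.aestronglyMeasurable
      exact ⟨h1.mk (D α), fun _ => ⟨h1.stronglyMeasurable_mk.measurable, h1.ae_eq_mk⟩⟩
    · exact ⟨0, fun h => absurd h ha⟩
  choose D' hD' using hm
  refine ⟨D', fun o => (hD' _ (ix_sum o)).1, ?_, ?_, ?_⟩
  · rw [← h0]; exact (hD' 0 (by simp)).2.symm
  · intro α ha
    obtain ⟨h1, h2⟩ := hD α ha
    refine ⟨fun x => ?_, ?_⟩
    · obtain ⟨s, hs, hi⟩ := h1 x
      exact ⟨s, hs, hi.congr (ae_restrict_of_ae (hD' α ha).2)⟩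
    · intro ψ hψ hc
      rw [h2 ψ hψ hc]
      congr 1
      refine integral_congr_ae ?_
      filter_upwards [(hD' α ha).2] with x hx
      rw [hx]
  · unfold sobNorm
    refine tsum_congr fun α => ?_
    split_ifs with ha
    · refine eLpNorm_congr_ae ?_
      filter_upwards [(hD' α ha).2] with x hx
      rw [hx]
    · rfl

lemma root_le {P : ℝ} (hP : 1 ≤ P) {a A H K S : ℝ≥0∞} (h1 : a ≤ A * H) (h2 : H ≤ K * S ^ P) :
    a ^ (1 / P) ≤ (A * K) ^ (1 / P) * S := by
  have h0 : (0 : ℝ) ≤ 1 / P := by positivity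
  calc a ^ (1 / P) ≤ ((A * K) * S ^ P) ^ (1 / P) := by
        refine ENNReal.rpow_le_rpow (h1.trans ?_) h0
        rw [mul_assoc]; exact mul_le_mul_right h2 _
    _ = _ := by
        rw [ENNReal.mul_rpow_of_nonneg _ _ h0, ← ENNReal.rpow_mul, mul_one_div_cancel (by linarith),
          ENNReal.rpow_one]

/-- **Theorem 3.1, direct part: existence and boundedness of the trace of a weighted
Sobolev function.** -/
theorem sobolev_trace (n d : ℕ) (hn : 0 < n) (hd : 0 < d) (p r : ℝ≥0∞)
    (hp1 : 1 < p) (hp : p < ∞) (hr1 : 1 ≤ r) (hrp : r < p) (l : ℕ)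
    (hl : (d : ℝ) / r.toReal < l)
    (γ : Rn (n + d) → ℝ) (hγ : IsWeight γ)
    (hA : MemAlocP (n + d) (p.toReal / r.toReal) (fun x => γ x ^ p.toReal)) :
    ∃ C : ℝ≥0∞, 0 < C ∧ C < ∞ ∧
      ∀ (f : Rn (n + d) → ℝ) (D : (Fin (n + d) → ℕ) → Rn (n + d) → ℝ),
        MemW (n + d) p l γ f D →
        ∃ φ : Rn n → ℝ, MemLrLoc n r φ ∧ IsTraceSob f φ ∧
          tildeBnormE n l p p r (gammaSeq n d p l γ) φ < ∞ ∧
          tildeBnormE n l p p r (gammaSeq n d p l γ) φ ≤ C * sobNorm (n + d) p l γ D := by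
  have hrt : r ≠ ∞ := (hrp.trans hp).ne
  have hR : 1 ≤ r.toReal := by
    have := ENNReal.toReal_mono hrt hr1
    simpa using this
  have hRP : r.toReal < p.toReal := (ENNReal.toReal_lt_toReal hrt hp.ne).2 hrp
  have hP : 1 ≤ p.toReal := by linarith
  have hq1 : 1 < p.toReal / r.toReal := by rw [lt_div_iff₀ (by linarith)]; linarith
  have hq : 0 ≤ p.toReal / r.toReal := by linarith
  have hl0 : 0 < l := by
    have h1 : (0 : ℝ) ≤ (d : ℝ) / r.toReal := by positivity
    exact_mod_cast lt_of_le_of_lt h1 hl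
  have hA' : MemAlocGt (n + d) (p.toReal / r.toReal) (fun x => γ x ^ p.toReal) := by
    unfold MemAlocP at hA
    rwa [if_neg hq1.ne'] at hA
  have hWP : ∀ L : ℝ, ∃ C : ℝ≥0∞, C ≠ ∞ ∧ WP (n + d) (wt γ p.toReal) (p.toReal / r.toReal) L C :=
    fun L => WP_all hq1 (hγ.1.pow_const _) (fun x => Real.rpow_pos_of_pos (hγ.2 x) _) hA' L
  obtain ⟨C2, hC2, hW⟩ := hWP (2 * (2 * l + 1))
  obtain ⟨Ca, hCa, hB1⟩ := B1 (n := n) hd l hl0 r hr1 hrt hl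
  obtain ⟨Cb, hCb, hB2⟩ := B2 (n := n) hd l hl0 r hr1 hrt hl
  set A1 : ℝ≥0∞ := (((2 ^ (-(2 * (n : ℝ)) / r.toReal)) ^ p.toReal * (2 ^ d * Ca * 4 ^ n) ^ (p.toReal / r.toReal) *
        C2 * (ENNReal.ofReal (2 * (2 * l + 1)) ^ (n + d)) ^ (p.toReal / r.toReal)) *
        ENNReal.ofReal (2 * (2 * l + 1)) ^ n) * 
        ENNReal.ofReal ((1 - (1 / 2 : ℝ) ^ (thE d l r.toReal * (p.toReal / r.toReal)))⁻¹ *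
        (2 * l + 1) ^ (thE d l r.toReal * (p.toReal / r.toReal))) with hA1
  set A2 : ℝ≥0∞ := (Cb ^ (p.toReal / r.toReal) *
        (C2 * (ENNReal.ofReal (2 * (2 * l + 1)) ^ (n + d)) ^ (p.toReal / r.toReal))) *
        ENNReal.ofReal (2 * (2 * l + 1)) ^ n * 2 ^ (p.toReal / r.toReal - 1) with hA2
  set K : ℝ≥0∞ := cK (n + d) l ^ (p.toReal - 1) * cK (n + d) l with hK
  have hc3 : (ENNReal.ofReal (2 * (2 * l + 1)) ^ (n + d)) ^ (p.toReal / r.toReal) ≠ ∞ :=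
    ENNReal.rpow_ne_top_of_nonneg hq (by finiteness)
  have hA1t : A1 ≠ ∞ := by
    have h1 : ((2 : ℝ≥0∞) ^ (-(2 * (n : ℝ)) / r.toReal)) ^ p.toReal ≠ ∞ :=
      ENNReal.rpow_ne_top_of_nonneg (by linarith) (ENNReal.rpow_ne_top_of_ne_zero (by simp) (by simp))
    have h2 : (2 ^ d * Ca * 4 ^ n) ^ (p.toReal / r.toReal) ≠ ∞ :=
      ENNReal.rpow_ne_top_of_nonneg hq (by finiteness)
    rw [hA1]; finiteness
  have hA2t : A2 ≠ ∞ := by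
    have h1 : Cb ^ (p.toReal / r.toReal) ≠ ∞ := ENNReal.rpow_ne_top_of_nonneg hq hCb
    have h2 : (2 : ℝ≥0∞) ^ (p.toReal / r.toReal - 1) ≠ ∞ :=
      ENNReal.rpow_ne_top_of_nonneg (by linarith) (by simp)
    rw [hA2]; finiteness
  have hKt : K ≠ ∞ := by
    have h1 : cK (n + d) l ^ (p.toReal - 1) ≠ ∞ :=
      ENNReal.rpow_ne_top_of_nonneg (by linarith) (cK_ne_top _ _)
    exact ENNReal.mul_ne_top h1 (cK_ne_top _ _)
  have hP0 : (0 : ℝ) ≤ 1 / p.toReal := by positivity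
  have hCt : (A1 * K) ^ (1 / p.toReal) + (A2 * K) ^ (1 / p.toReal) + 1 < ∞ := by
    have h1 : (A1 * K) ^ (1 / p.toReal) ≠ ∞ :=
      ENNReal.rpow_ne_top_of_nonneg hP0 (ENNReal.mul_ne_top hA1t hKt)
    have h2 : (A2 * K) ^ (1 / p.toReal) ≠ ∞ :=
      ENNReal.rpow_ne_top_of_nonneg hP0 (ENNReal.mul_ne_top hA2t hKt)
    finiteness
  refine ⟨(A1 * K) ^ (1 / p.toReal) + (A2 * K) ^ (1 / p.toReal) + 1,
    lt_of_lt_of_le one_pos le_add_self, hCt, ?_⟩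
  intro f D hMW
  obtain ⟨D', hDm, hD0, hDw, hsob⟩ := meas_rep hMW
  have hsfin : sobNorm (n + d) p l γ D < ∞ := hMW.2.2.2
  have hloc : ∀ o, LocallyIntegrable (D' (ix l o)) volume ∧ IsWeakDeriv (ix l o) f (D' (ix l o)) ∧
      ∀ R : ℝ, eLpNorm (D' (ix l o)) r (volume.restrict (Metric.ball 0 R)) < ∞ := by
    intro o
    refine ⟨(hDw _ (ix_sum o)).1, (hDw _ (ix_sum o)).2, fun R => ?_⟩
    refine local_Lr hγ hr1 hrt hRP hWP _ (hDm o) ?_ R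
    refine ne_top_of_le_ne_top ?_ (sob_term_le hp1 hp hγ o)
    rw [hsob]
    exact ENNReal.rpow_ne_top_of_nonneg (by linarith) hsfin.ne
  obtain ⟨u, hu⟩ := approx_exists l r hr1 hrt f D' hMW.1 hloc
  obtain ⟨φ, hφ, htr, hlim⟩ := trace_exists hd l hl0 r hr1 hrt hl u D' hu hDm f hD0
  have hH := Hen_le (l := l) hp1 hp hγ hDm
  rw [hsob] at hH
  have hbd : tildeBnormE n l p p r (gammaSeq n d p l γ) φ ≤
      ((A1 * K) ^ (1 / p.toReal) + (A2 * K) ^ (1 / p.toReal) + 1) * sobNorm (n + d) p l γ D := by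
    have e1 := sum_k l p.toReal r.toReal hR hRP hl hγ D' hDm _ _
      (term_k l p r hp1 hp hr1 hrp hγ Ca C2 D' hDm φ (hB1 u D' hu hDm φ hlim) hCa hC2 hW)
    have e2 := term_0 l p r hp1 hp hr1 hrp hγ Cb C2 D' hDm φ (hB2 u D' hu hDm φ hlim) hCb hC2 hW
    have f1 := root_le hP e1 hH
    have f2 := root_le hP e2 hH
    unfold tildeBnormE lqNorm lpNormE
    simp only [if_neg hp.ne]
    simp only [← ENNReal.rpow_mul (_ : ℝ≥0∞) (1 / p.toReal) p.toReal,
      one_div_mul_cancel (by linarith : p.toReal ≠ 0), ENNReal.rpow_one]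
    rw [add_mul, add_mul]
    exact (add_le_add f1 f2).trans le_self_add
  exact ⟨φ, hφ, htr, lt_of_le_of_lt hbd (ENNReal.mul_lt_top hCt hsfin), hbd⟩

end
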